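/- Let (R, m) be a Noetherian complete local domain of dimension 4 and let I be an ideal of R with height I = 2. Then I ∉ 𝓘(R); that is, there exist a finitely generated R-module M and an integer i ≥ 0 such that H^i_I(M) is not I-cofinite. -/

import Mathlib

universe u

open CategoryTheory

/-- An `R`-module `L` is `I`-cofinite if `Supp L ⊆ V(I)` and `Ext^i_R(R/I, L)` is a finitely
generated `R`-module for all `i ≥ 0`. -/
def IsCofinite {R : Type u} [CommRing R] (I : Ideal R) (L : ModuleCat.{u} R) : Prop :=
  Module.support R L ⊆ PrimeSpectrum.zeroLocus (I : Set R) ∧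
    ∀ i : ℕ, Module.Finite R
      (((Ext R (ModuleCat.{u} R) i).obj (Opposite.op (ModuleCat.of R (R ⧸ I)))).obj L)

/-- `I ∈ 𝓘(R)`: for every finitely generated `R`-module `M`, the local cohomology modules
`H^i_I(M)` are `I`-cofinite for all `i ≥ 0`. -/
def MemCofiniteClass (R : Type u) [CommRing R] (I : Ideal R) : Prop :=
  ∀ M : ModuleCat.{u} R, Module.Finite R M →
    ∀ i : ℕ, IsCofinite I ((localCohomology I i).obj M)

/-- The height of an ideal `I`: the infimum of the heights of the prime ideals containing `I`. -/
noncomputable def idealHeight {R : Type*} [CommRing R] (I : Ideal R) : ℕ∞ :=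
  ⨅ p ∈ {p : PrimeSpectrum R | I ≤ p.asIdeal}, Order.height p

section FileA
open CategoryTheory Limits Opposite

section compare
variable {R : Type u} [CommRing R]

/-- The map of Hom complexes induced by a map of chain complexes. -/
noncomputable def linYonMap {K L : ChainComplex (ModuleCat.{u} R) ℕ} (φ : K ⟶ L) (Y : ModuleCat.{u} R) :
    L.linearYonedaObj R Y ⟶ K.linearYonedaObj R Y :=
  (HomologicalComplex.unopFunctor _ _).map
    (((((linearYoneda R (ModuleCat.{u} R)).obj Y).rightOp.mapHomologicalComplex _).map φ).op)

lemma linYonMap_f {K L : ChainComplex (ModuleCat.{u} R) ℕ} (φ : K ⟶ L) (Y : ModuleCat.{u} R) (n : ℕ)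
    (f : L.X n ⟶ Y) : ((linYonMap φ Y).f n).hom f = (φ.f n ≫ f : K.X n ⟶ Y) := rfl

lemma linYon_d {K : ChainComplex (ModuleCat.{u} R) ℕ} (Y : ModuleCat.{u} R) (n m : ℕ)
    (f : K.X n ⟶ Y) : ((K.linearYonedaObj R Y).d n m).hom f = (K.d m n ≫ f : K.X m ⟶ Y) := rfl

lemma homologyUnop_nat {K L : ChainComplex (ModuleCat.{u} R)ᵒᵖ ℕ} (ψ : K ⟶ L) (n : ℕ) :
    HomologicalComplex.homologyMap ((HomologicalComplex.unopFunctor _ _).map ψ.op) n ≫ (K.homologyUnop n).hom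
      = (L.homologyUnop n).hom ≫ (HomologicalComplex.homologyMap ψ n).unop := by
  have := HomologicalComplex.homologyOp_hom_naturality ((HomologicalComplex.unopFunctor _ _).map ψ.op) n
  apply Quiver.Hom.op_inj
  exact this.symm

lemma isoExt_aux' {C : Type*} [Category* C] {A B A' B' : C} (a : A ≅ B) (b : A' ≅ B') (f : A ⟶ A')
    (g : B ⟶ B') (h : f ≫ b.hom = a.hom ≫ g) : g ≫ b.inv = a.inv ≫ f := by
  rw [Iso.eq_inv_comp, ← Category.assoc, ← h]; simp

lemma isoExt_aux {C : Type*} [Category* C] {A A' B B' D D' : C} (d : A ⟶ A') (i' : A' ⟶ B') (i : A ⟶ B)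
    (h : B ⟶ B') (j : B ⟶ D) (j' : B' ⟶ D') (k : D ⟶ D') (_ : Unit) (h1 : d ≫ i' = i ≫ h) (h2 : h ≫ j' = j ≫ k) :
    d ≫ i' ≫ j' = (i ≫ j) ≫ k := by
  rw [reassoc_of% h1, h2, Category.assoc]

lemma isoExt_nat {X X' : ModuleCat.{u} R} (g : X' ⟶ X) (P' : ProjectiveResolution X')
    (P : ProjectiveResolution X) (φ : ProjectiveResolution.Hom P' P g) (n : ℕ) (Y : ModuleCat.{u} R) :
    ((Ext R (ModuleCat.{u} R) n).map g.op).app Y ≫ (P'.isoExt n Y).hom =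
      (P.isoExt n Y).hom ≫ HomologicalComplex.homologyMap (linYonMap φ.hom Y) n := by
  have h1 := ProjectiveResolution.isoLeftDerivedObj_inv_naturality g P' P φ.hom
    (by have := φ.hom_f_zero_comp_π_f_zero; simpa using this)
    ((linearYoneda R (ModuleCat.{u} R)).obj Y).rightOp n
  have h2 := homologyUnop_nat ((((linearYoneda R (ModuleCat.{u} R)).obj Y).rightOp.mapHomologicalComplex _).map φ.hom) n
  have h3 := congrArg Quiver.Hom.unop h1
  exact isoExt_aux _ _ _ _ _ _ _ () h3 (isoExt_aux' _ _ _ _ h2)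

lemma extMk_zero_deg {X Y : ModuleCat.{u} R} (P : ProjectiveResolution X) (f : P.complex.X 0 ⟶ Y)
    (hf : P.complex.d 1 0 ≫ f = 0) (h : P.extMk f 1 rfl hf = 0) : f = 0 := by
  simp only [← P.extEquivCohomologyClass.apply_eq_iff_eq,
    ProjectiveResolution.extEquivCohomologyClass_extMk, ProjectiveResolution.extEquivCohomologyClass_zero,
    CochainComplex.HomComplex.CohomologyClass.mk_eq_zero_iff] at h
  rw [CochainComplex.HomComplex.Cocycle.toSingleMk_mem_coboundaries_iff _ _ _ _ _ 1 (by simp)] at h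
  obtain ⟨g, hg⟩ := h
  have h0 : P.cochainComplex.d (-(0:ℕ)) 1 = 0 := by
    have : IsZero (P.cochainComplex.X 1) := by
      exact CochainComplex.isZero_of_isStrictlyLE P.cochainComplex 0 1 (by norm_num)
    exact this.eq_of_tgt _ _
  rw [h0, zero_comp] at hg
  rw [← cancel_epi (P.cochainComplexXIso (-(0:ℕ)) 0 rfl).hom, ← hg]
  simp

lemma smul_extMk {X Y : ModuleCat.{u} R} (P : ProjectiveResolution X) {n : ℕ} (f : P.complex.X n ⟶ Y) (m : ℕ)
    (hm : n + 1 = m) (hf : P.complex.d m n ≫ f = 0) (r : R) :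
    r • P.extMk f m hm hf = P.extMk (r • f) m hm (by simp [hf]) := by
  rw [Abelian.Ext.smul_eq_comp_mk₀, ProjectiveResolution.extMk_comp_mk₀]
  congr 1

/-- inclusion of cocycles -/
noncomputable def cycHom {X : ModuleCat.{u} R} (P : ProjectiveResolution X) (Y : ModuleCat.{u} R) (n : ℕ) :
    (P.complex.linearYonedaObj R Y).cycles n →ₗ[R] (P.complex.X n ⟶ Y) :=
  ((P.complex.linearYonedaObj R Y).iCycles n).hom

lemma cycHom_d {X : ModuleCat.{u} R} (P : ProjectiveResolution X) (Y : ModuleCat.{u} R) (n : ℕ)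
    (z : (P.complex.linearYonedaObj R Y).cycles n) : P.complex.d (n+1) n ≫ cycHom P Y n z = 0 := by
  have := (P.complex.linearYonedaObj R Y).iCycles_d n (n+1)
  have := congrArg (fun q => q.hom z) this
  exact this

lemma cycHom_inj {X : ModuleCat.{u} R} (P : ProjectiveResolution X) (Y : ModuleCat.{u} R) (n : ℕ) :
    Function.Injective (cycHom P Y n) :=
  (ModuleCat.mono_iff_injective ((P.complex.linearYonedaObj R Y).iCycles n)).1 inferInstance

/-- coboundaries to cocycles -/
noncomputable def cycB {X : ModuleCat.{u} R} (P : ProjectiveResolution X) (Y : ModuleCat.{u} R) (p n : ℕ) :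
    (P.complex.X p ⟶ Y) →ₗ[R] (P.complex.linearYonedaObj R Y).cycles n :=
  ((P.complex.linearYonedaObj R Y).toCycles p n).hom

lemma cycHom_cycB {X : ModuleCat.{u} R} (P : ProjectiveResolution X) (Y : ModuleCat.{u} R) (p n : ℕ)
    (g : P.complex.X p ⟶ Y) : cycHom P Y n (cycB P Y p n g) = P.complex.d n p ≫ g := by
  have := (P.complex.linearYonedaObj R Y).toCycles_i p n
  exact congrArg (fun q => q.hom g) this

lemma cycπ_eq_zero {X : ModuleCat.{u} R} (P : ProjectiveResolution X) (Y : ModuleCat.{u} R) (p n : ℕ)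
    (hp : (ComplexShape.up ℕ).prev n = p) (z : (P.complex.linearYonedaObj R Y).cycles n) :
    ((P.complex.linearYonedaObj R Y).homologyπ n).hom z = 0 ↔ ∃ g, cycB P Y p n g = z := by
  have hex : (ShortComplex.mk _ _ ((P.complex.linearYonedaObj R Y).toCycles_comp_homologyπ p n)).Exact :=
    ShortComplex.exact_of_g_is_cokernel _ ((P.complex.linearYonedaObj R Y).homologyIsCokernel p n hp)
  constructor
  · exact (ShortComplex.moduleCat_exact_iff _).1 hex z
  · rintro ⟨g, rfl⟩
    exact congrArg (fun q => q.hom g) ((P.complex.linearYonedaObj R Y).toCycles_comp_homologyπ p n)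

/-- cocycles to Ext -/
noncomputable def cycToExt {X : ModuleCat.{u} R} (P : ProjectiveResolution X) (Y : ModuleCat.{u} R) (n : ℕ) :
    (P.complex.linearYonedaObj R Y).cycles n →ₗ[R] Abelian.Ext X Y n where
  toFun z := P.extMk (cycHom P Y n z) (n+1) rfl (cycHom_d P Y n z)
  map_add' a b := by
    rw [ProjectiveResolution.add_extMk]
    congr 1
    exact map_add _ a b
  map_smul' r a := by
    simp only [RingHom.id_apply]
    rw [smul_extMk]
    congr 1
    exact map_smul _ r a

lemma cycToExt_apply {X : ModuleCat.{u} R} (P : ProjectiveResolution X) (Y : ModuleCat.{u} R) (n : ℕ)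
    (z : (P.complex.linearYonedaObj R Y).cycles n) (f : P.complex.X n ⟶ Y)
    (hf : cycHom P Y n z = f) (h) :
    cycToExt P Y n z = P.extMk f (n+1) rfl h := by
  subst hf; rfl

lemma cycToExt_surj {X : ModuleCat.{u} R} (P : ProjectiveResolution X) (Y : ModuleCat.{u} R) (n : ℕ) :
    Function.Surjective (cycToExt P Y n) := by
  intro α
  obtain ⟨f, hf, rfl⟩ := P.extMk_surjective α (n+1) rfl
  have : ∃ z, cycHom P Y n z = f := by
    have hex : (ShortComplex.mk _ _ ((P.complex.linearYonedaObj R Y).iCycles_d n (n+1))).Exact :=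
      ShortComplex.exact_of_f_is_kernel _ ((P.complex.linearYonedaObj R Y).cyclesIsKernel n (n+1) (by simp))
    exact (ShortComplex.moduleCat_exact_iff _).1 hex f hf
  obtain ⟨z, hz⟩ := this
  exact ⟨z, cycToExt_apply P Y n z f hz _⟩

lemma cycToExt_ker {X : ModuleCat.{u} R} (P : ProjectiveResolution X) (Y : ModuleCat.{u} R) (n : ℕ)
    (z : (P.complex.linearYonedaObj R Y).cycles n) :
    cycToExt P Y n z = 0 ↔ ((P.complex.linearYonedaObj R Y).homologyπ n).hom z = 0 := by
  cases n with
  | zero =>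
    rw [cycπ_eq_zero P Y 0 0 (by simp)]
    constructor
    · intro h
      have := extMk_zero_deg P _ (cycHom_d P Y 0 z) h
      have hz : z = 0 := cycHom_inj P Y 0 (by rw [this]; exact (map_zero _).symm)
      exact ⟨0, by rw [hz, map_zero]⟩
    · rintro ⟨g, rfl⟩
      have : cycB P Y 0 0 g = 0 := cycHom_inj P Y 0 (by
        rw [cycHom_cycB, HomologicalComplex.shape _ _ _ (by simp), zero_comp, map_zero])
      rw [this, map_zero]
  | succ p =>
    rw [cycπ_eq_zero P Y p (p+1) (by simp)]
    refine (ProjectiveResolution.extMk_eq_zero_iff P _ _ rfl (cycHom_d P Y (p+1) z) p rfl).trans ?_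
    constructor
    · rintro ⟨g, hg⟩
      exact ⟨g, cycHom_inj P Y _ ((cycHom_cycB P Y p (p+1) g).trans hg)⟩
    · rintro ⟨g, rfl⟩
      exact ⟨g, (cycHom_cycB P Y p (p+1) g).symm⟩

lemma cycπ_surj {X : ModuleCat.{u} R} (P : ProjectiveResolution X) (Y : ModuleCat.{u} R) (n : ℕ) :
    Function.Surjective ((P.complex.linearYonedaObj R Y).homologyπ n).hom :=
  (ModuleCat.epi_iff_surjective _).1 inferInstance

/-- homology of the Hom complex is Ext -/
noncomputable def homologyEquivExt {X : ModuleCat.{u} R} (P : ProjectiveResolution X) (Y : ModuleCat.{u} R) (n : ℕ) :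
    (P.complex.linearYonedaObj R Y).homology n ≃ₗ[R] Abelian.Ext X Y n :=
  ((LinearMap.quotKerEquivOfSurjective _ (cycπ_surj P Y n)).symm.trans
    (Submodule.quotEquivOfEq _ _ (by ext z; exact (cycToExt_ker P Y n z).symm))).trans
    (LinearMap.quotKerEquivOfSurjective _ (cycToExt_surj P Y n))

lemma homologyEquivExt_π {X : ModuleCat.{u} R} (P : ProjectiveResolution X) (Y : ModuleCat.{u} R) (n : ℕ)
    (z : (P.complex.linearYonedaObj R Y).cycles n) :
    homologyEquivExt P Y n (((P.complex.linearYonedaObj R Y).homologyπ n).hom z) = cycToExt P Y n z := by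
  have : (LinearMap.quotKerEquivOfSurjective _ (cycπ_surj P Y n)).symm
      (((P.complex.linearYonedaObj R Y).homologyπ n).hom z) = Submodule.Quotient.mk z := by
    rw [LinearEquiv.symm_apply_eq]; rfl
  simp only [homologyEquivExt, LinearEquiv.trans_apply]
  erw [this]
  rfl

lemma homologyEquivExt_nat {X X' : ModuleCat.{u} R} (g : X' ⟶ X) (P' : ProjectiveResolution X')
    (P : ProjectiveResolution X) (φ : ProjectiveResolution.Hom P' P g) (n : ℕ) (Y : ModuleCat.{u} R)
    (w : (P.complex.linearYonedaObj R Y).homology n) :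
    homologyEquivExt P' Y n ((HomologicalComplex.homologyMap (linYonMap φ.hom Y) n).hom w) =
      (Abelian.Ext.mk₀ g).comp (homologyEquivExt P Y n w) (zero_add n) := by
  obtain ⟨z, rfl⟩ := cycπ_surj P Y n w
  have h1 : (HomologicalComplex.homologyMap (linYonMap φ.hom Y) n).hom
      (((P.complex.linearYonedaObj R Y).homologyπ n).hom z) =
      ((P'.complex.linearYonedaObj R Y).homologyπ n).hom ((HomologicalComplex.cyclesMap (linYonMap φ.hom Y) n).hom z) :=
    congrArg (fun q => q.hom z) (HomologicalComplex.homologyπ_naturality (linYonMap φ.hom Y) n)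
  have h2 : cycHom P' Y n ((HomologicalComplex.cyclesMap (linYonMap φ.hom Y) n).hom z) =
      φ.hom.f n ≫ cycHom P Y n z :=
    congrArg (fun q => q.hom z) (HomologicalComplex.cyclesMap_i (linYonMap φ.hom Y) n)
  rw [h1, homologyEquivExt_π, homologyEquivExt_π, cycToExt_apply P Y n z _ rfl (cycHom_d P Y n z),
    ProjectiveResolution.mk₀_comp_extMk _ _ _ _ φ]
  exact cycToExt_apply _ _ _ _ _ h2 _

/-- Comparison of the two Ext's. -/
noncomputable def oldExtEquiv (X Y : ModuleCat.{u} R) (n : ℕ) :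
    (((Ext R (ModuleCat.{u} R) n).obj (op X)).obj Y) ≃ₗ[R] Abelian.Ext X Y n :=
  ((projectiveResolution X).isoExt n Y).toLinearEquiv.trans (homologyEquivExt (projectiveResolution X) Y n)

lemma oldExtEquiv_nat {X X' : ModuleCat.{u} R} (g : X' ⟶ X) (Y : ModuleCat.{u} R) (n : ℕ)
    (w : (((Ext R (ModuleCat.{u} R) n).obj (op X)).obj Y)) :
    oldExtEquiv X' Y n ((((Ext R (ModuleCat.{u} R) n).map g.op).app Y).hom w) =
      (Abelian.Ext.mk₀ g).comp (oldExtEquiv X Y n w) (zero_add n) := by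
  have φ : ProjectiveResolution.Hom (projectiveResolution X') (projectiveResolution X) g :=
    { hom := ProjectiveResolution.lift g _ _
      hom_f_zero_comp_π_f_zero := by
        rw [← HomologicalComplex.comp_f, ProjectiveResolution.lift_commutes, HomologicalComplex.comp_f] }
  have h := congrArg (fun q => q.hom w) (isoExt_nat g _ _ φ n Y)
  simp only [ModuleCat.hom_comp, LinearMap.comp_apply] at h
  exact (congrArg (homologyEquivExt _ Y n) h).trans (homologyEquivExt_nat g _ _ φ n Y _)
end compare
end FileA

section FileB
open CategoryTheory Limits Opposite

section LC
variable {R : Type u} [CommRing R]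

/-- transition `R/I^n → R/I^m`, `m ≤ n` -/
noncomputable def powProj (I : Ideal R) {m n : ℕ} (h : m ≤ n) :
    ModuleCat.of R (R ⧸ I ^ n) ⟶ ModuleCat.of R (R ⧸ I ^ m) :=
  ModuleCat.ofHom <| Submodule.mapQ _ _ LinearMap.id (Ideal.pow_le_pow_right h)

/-- transition maps on Ext -/
noncomputable def extTrans (I : Ideal R) (i : ℕ) (N : ModuleCat.{u} R) (m n : ℕ) (h : m ≤ n) :
    Abelian.Ext (ModuleCat.of R (R ⧸ I ^ m)) N i →ₗ[R] Abelian.Ext (ModuleCat.of R (R ⧸ I ^ n)) N i :=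
  Abelian.Ext.precompOfLinear (Abelian.Ext.mk₀ (powProj I h)) R N (zero_add i)

lemma powProj_comp (I : Ideal R) {m n k : ℕ} (h : m ≤ n) (h' : n ≤ k) :
    powProj I h' ≫ powProj I h = powProj I (h.trans h') := by
  ext x
  rfl

lemma powProj_id (I : Ideal R) {m : ℕ} : powProj I (le_refl m) = 𝟙 _ := by
  ext x
  rfl

lemma extTrans_apply (I : Ideal R) (i : ℕ) (N : ModuleCat.{u} R) (m n : ℕ) (h : m ≤ n)
    (x : Abelian.Ext (ModuleCat.of R (R ⧸ I ^ m)) N i) :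
    extTrans I i N m n h x = (Abelian.Ext.mk₀ (powProj I h)).comp x (zero_add i) := rfl

instance (I : Ideal R) (i : ℕ) (N : ModuleCat.{u} R) :
    DirectedSystem (fun n : ℕ => Abelian.Ext (ModuleCat.of R (R ⧸ I ^ n)) N i)
      (fun m n h => extTrans I i N m n h) where
  map_self m x := by
    rw [extTrans_apply, powProj_id, Abelian.Ext.mk₀_id_comp]
  map_map k j i' h h' x := by
    simp only [extTrans_apply]
    rw [← Abelian.Ext.comp_assoc_of_second_deg_zero, Abelian.Ext.mk₀_comp_mk₀, powProj_comp]

/-- Local cohomology as a direct limit. -/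
abbrev LCc (I : Ideal R) (i : ℕ) (N : ModuleCat.{u} R) : Type u :=
  Module.DirectLimit (fun n : ℕ => Abelian.Ext (ModuleCat.of R (R ⧸ I ^ n)) N i)
    (fun m n h => extTrans I i N m n h)

/-- structure map -/
noncomputable abbrev LCc.of (I : Ideal R) (i : ℕ) (N : ModuleCat.{u} R) (n : ℕ) :
    Abelian.Ext (ModuleCat.of R (R ⧸ I ^ n)) N i →ₗ[R] LCc I i N :=
  Module.DirectLimit.of R ℕ (fun n : ℕ => Abelian.Ext (ModuleCat.of R (R ⧸ I ^ n)) N i)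
    (fun m n h => extTrans I i N m n h) n

/-- postcomposition with an Ext class -/
noncomputable def LCc.post (I : Ideal R) {N N' : ModuleCat.{u} R} {k : ℕ} (β : Abelian.Ext N N' k) (i j : ℕ)
    (h : i + k = j) : LCc I i N →ₗ[R] LCc I j N' :=
  Module.DirectLimit.map (fun n => Abelian.Ext.postcompOfLinear β R _ h) (by
    intro m n hmn
    ext x
    simp only [LinearMap.comp_apply]
    change ((Abelian.Ext.mk₀ (powProj I hmn)).comp x (zero_add i)).comp β h = 
      (Abelian.Ext.mk₀ (powProj I hmn)).comp (x.comp β h) (zero_add j)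
    exact Abelian.Ext.comp_assoc _ _ _ _ _ (by lia))

lemma LCc.post_of (I : Ideal R) {N N' : ModuleCat.{u} R} {k : ℕ} (β : Abelian.Ext N N' k) (i j : ℕ)
    (h : i + k = j) (n : ℕ) (x) : LCc.post I β i j h (LCc.of I i N n x) = LCc.of I j N' n (x.comp β h) := by
  unfold LCc.post
  rw [Module.DirectLimit.map_apply_of]
  rfl

lemma LCc.rep (I : Ideal R) (i : ℕ) (N : ModuleCat.{u} R) (z : LCc I i N) : ∃ n x, LCc.of I i N n x = z :=
  Module.DirectLimit.exists_of z

lemma LCc.exact_of (I : Ideal R) {N N' N'' : ModuleCat.{u} R} {k l : ℕ} (β : Abelian.Ext N N' k)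
    (γ : Abelian.Ext N' N'' l) (i j p : ℕ) (h : i + k = j) (h' : j + l = p)
    (H : ∀ (X : ModuleCat.{u} R) (x : Abelian.Ext X N' j), x.comp γ h' = 0 → ∃ y : Abelian.Ext X N i, y.comp β h = x)
    (H0 : β.comp γ rfl = 0) :
    Function.Exact (LCc.post I β i j h) (LCc.post I γ j p h') := by
  intro z
  obtain ⟨n, x, rfl⟩ := LCc.rep I _ _ z
  constructor
  · intro hz
    rw [LCc.post_of] at hz
    obtain ⟨m, hm, hx⟩ := Module.DirectLimit.of.zero_exact hz
    obtain ⟨y, hy⟩ := H _ (extTrans I j N' n m hm x) (by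
      rw [extTrans_apply] at hx ⊢
      rw [← hx]
      exact Abelian.Ext.comp_assoc _ _ _ _ _ (by lia))
    refine ⟨LCc.of I i N m y, ?_⟩
    rw [LCc.post_of, hy]
    exact Module.DirectLimit.of_f
  · rintro ⟨y, hy⟩
    rw [← hy]
    obtain ⟨m, y, rfl⟩ := LCc.rep I _ _ y
    rw [LCc.post_of, LCc.post_of, Abelian.Ext.comp_assoc y β γ h rfl (by lia), H0, Abelian.Ext.comp_zero, map_zero]
end LC
end FileB

section FileC
open CategoryTheory Limits Opposite

section LCapi
variable {R : Type u} [CommRing R]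

/-- Local cohomology as a direct limit, unbundled. -/
def LC (I : Ideal R) (i : ℕ) (N : Type u) [AddCommGroup N] [Module R N] : Type u :=
  LCc I i (ModuleCat.of R N)

noncomputable instance (I : Ideal R) (i : ℕ) (N : Type u) [AddCommGroup N] [Module R N] :
    AddCommGroup (LC I i N) := inferInstanceAs (AddCommGroup (LCc I i (ModuleCat.of R N)))

noncomputable instance (I : Ideal R) (i : ℕ) (N : Type u) [AddCommGroup N] [Module R N] :
    Module R (LC I i N) := inferInstanceAs (Module R (LCc I i (ModuleCat.of R N)))

variable {N N' N'' : Type u} [AddCommGroup N] [Module R N] [AddCommGroup N'] [Module R N']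
  [AddCommGroup N''] [Module R N'']

/-- structure maps -/
noncomputable def LC.of (I : Ideal R) (i : ℕ) (N : Type u) [AddCommGroup N] [Module R N] (n : ℕ) :
    Abelian.Ext (ModuleCat.of R (R ⧸ I ^ n)) (ModuleCat.of R N) i →ₗ[R] LC I i N :=
  LCc.of I i (ModuleCat.of R N) n

/-- functoriality -/
noncomputable def LC.map (I : Ideal R) (i : ℕ) (f : N →ₗ[R] N') : LC I i N →ₗ[R] LC I i N' :=
  LCc.post I (Abelian.Ext.mk₀ (ModuleCat.ofHom f)) i i (add_zero i)

lemma LC.map_of (I : Ideal R) (i : ℕ) (f : N →ₗ[R] N') (n : ℕ) (x) :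
    LC.map I i f (LC.of I i N n x) =
      LC.of I i N' n (x.comp (Abelian.Ext.mk₀ (ModuleCat.ofHom f)) (add_zero i)) :=
  LCc.post_of _ _ _ _ _ _ _

lemma LC.rep {I : Ideal R} {i : ℕ} (z : LC I i N) : ∃ n x, LC.of I i N n x = z :=
  LCc.rep I i _ z

lemma LC.of_trans (I : Ideal R) (i : ℕ) (m n : ℕ) (h : m ≤ n) (x) :
    LC.of I i N n (extTrans I i (ModuleCat.of R N) m n h x) = LC.of I i N m x :=
  Module.DirectLimit.of_f

lemma LC.of_eq_zero {I : Ideal R} {i n : ℕ} {x} (h : LC.of I i N n x = 0) :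
    ∃ m, ∃ hm : n ≤ m, extTrans I i (ModuleCat.of R N) n m hm x = 0 := 
  Module.DirectLimit.of.zero_exact h

lemma LC.map_comp (I : Ideal R) (i : ℕ) (f : N →ₗ[R] N') (g : N' →ₗ[R] N'') (z : LC I i N) :
    LC.map I i g (LC.map I i f z) = LC.map I i (g.comp f) z := by
  obtain ⟨n, x, rfl⟩ := LC.rep z
  rw [LC.map_of, LC.map_of, LC.map_of, Abelian.Ext.comp_assoc_of_third_deg_zero, Abelian.Ext.mk₀_comp_mk₀]
  rfl

lemma LC.map_id (I : Ideal R) (i : ℕ) (z : LC I i N) :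
    LC.map I i LinearMap.id z = z := by
  obtain ⟨n, x, rfl⟩ := LC.rep z
  rw [LC.map_of, ModuleCat.ofHom_id, Abelian.Ext.comp_mk₀_id]

lemma LC.map_add (I : Ideal R) (i : ℕ) (f g : N →ₗ[R] N') (z : LC I i N) :
    LC.map I i (f + g) z = LC.map I i f z + LC.map I i g z := by
  obtain ⟨n, x, rfl⟩ := LC.rep z
  rw [LC.map_of, LC.map_of, LC.map_of, ModuleCat.ofHom_add, Abelian.Ext.mk₀_add, Abelian.Ext.comp_add,
    _root_.map_add]

lemma LC.map_smul (I : Ideal R) (i : ℕ) (r : R) (f : N →ₗ[R] N') (z : LC I i N) :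
    LC.map I i (r • f) z = r • LC.map I i f z := by
  obtain ⟨n, x, rfl⟩ := LC.rep z
  rw [LC.map_of, LC.map_of]
  have : ModuleCat.ofHom (r • f) = r • ModuleCat.ofHom f := rfl
  rw [this, Abelian.Ext.mk₀_smul, Abelian.Ext.comp_smul, _root_.map_smul]

lemma LC.map_zero (I : Ideal R) (i : ℕ) (z : LC I i N) :
    LC.map I i (0 : N →ₗ[R] N') z = 0 := by
  have := LC.map_smul I i (0:R) (0 : N →ₗ[R] N') z
  rwa [zero_smul, zero_smul] at this

lemma LC.map_smul_id (I : Ideal R) (i : ℕ) (r : R) (z : LC I i N) :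
    LC.map I i (r • LinearMap.id) z = r • z := by
  rw [LC.map_smul, LC.map_id]

section
variable (I : Ideal R) (f : N →ₗ[R] N') (g : N' →ₗ[R] N'') (hf : Function.Injective f) (hg : Function.Surjective g)
  (hfg : Function.Exact f g)

/-- the short complex -/
noncomputable def scOf (f : N →ₗ[R] N') (g : N' →ₗ[R] N'') (hfg : Function.Exact f g) : ShortComplex (ModuleCat.{u} R) :=
  ShortComplex.mk (ModuleCat.ofHom f) (ModuleCat.ofHom g) (by
    ext x; exact hfg.apply_apply_eq_zero x)

lemma LCc.les₃ {S : ShortComplex (ModuleCat.{u} R)} (hS : S.ShortExact) (i : ℕ) :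
    Function.Exact (LCc.post I (Abelian.Ext.mk₀ S.g) i i (add_zero i))
      (LCc.post I hS.extClass i (i+1) rfl) := by
  refine LCc.exact_of I (Abelian.Ext.mk₀ S.g) hS.extClass i i (i+1) (add_zero i) rfl ?_ ?_
  · intro X x hx
    exact Abelian.Ext.covariant_sequence_exact₃ X hS x rfl hx
  · exact hS.comp_extClass

lemma LCc.les₁ {S : ShortComplex (ModuleCat.{u} R)} (hS : S.ShortExact) (i : ℕ) :
    Function.Exact (LCc.post I hS.extClass i (i+1) rfl)
      (LCc.post I (Abelian.Ext.mk₀ S.f) (i+1) (i+1) (add_zero _)) := by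
  refine LCc.exact_of I hS.extClass (Abelian.Ext.mk₀ S.f) i (i+1) (i+1) rfl (add_zero _) ?_ ?_
  · intro X x hx
    exact Abelian.Ext.covariant_sequence_exact₁ X hS x hx rfl
  · exact hS.extClass_comp

include hf hg in
lemma scOf_shortExact : (scOf f g hfg).ShortExact where
  exact := by
    rw [ShortComplex.ShortExact.moduleCat_exact_iff_function_exact]
    exact hfg
  mono_f := (ModuleCat.mono_iff_injective (ModuleCat.ofHom f)).2 hf
  epi_g := (ModuleCat.epi_iff_surjective (ModuleCat.ofHom g)).2 hg

include hf hg hfg in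
lemma LC.exact_mid (i : ℕ) : Function.Exact (LC.map I i f) (LC.map I i g) :=
  LCc.exact_of I _ _ i i i _ _ (fun X x hx =>
    Abelian.Ext.covariant_sequence_exact₂ X (scOf_shortExact f g hf hg hfg) x hx) (by
      rw [Abelian.Ext.mk₀_comp_mk₀]
      have := (scOf f g hfg).zero
      exact (congrArg Abelian.Ext.mk₀ this).trans (Abelian.Ext.mk₀_zero _ _))

include hf hg hfg in
lemma LC.les (i : ℕ) : ∃ δ : LC I i N'' →ₗ[R] LC I (i+1) N,
    Function.Exact (LC.map I i g) δ ∧ Function.Exact δ (LC.map I (i+1) f) := by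
  have hS := scOf_shortExact f g hf hg hfg
  exact ⟨LCc.post I hS.extClass i (i+1) rfl, LCc.les₃ I hS i, LCc.les₁ I hS i⟩

end

lemma LC.zero_inj (I : Ideal R) (f : N →ₗ[R] N') (hf : Function.Injective f) :
    Function.Injective (LC.map I 0 f) := by
  rw [injective_iff_map_eq_zero]
  intro z hz
  obtain ⟨n, x, rfl⟩ := LC.rep z
  rw [LC.map_of] at hz
  obtain ⟨m, hm, hx⟩ := LC.of_eq_zero hz
  have : Mono (ModuleCat.ofHom f) := (ModuleCat.mono_iff_injective _).2 hf
  have h1 : extTrans I 0 _ n m hm x = 0 := by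
    apply Abelian.Ext.postcomp_mk₀_injective_of_mono _ (ModuleCat.ofHom f)
    rw [_root_.map_zero, ← hx]
    rw [extTrans_apply, extTrans_apply]
    exact Abelian.Ext.comp_assoc _ _ _ _ _ (by lia)
  rw [← LC.of_trans I 0 n m hm, h1, _root_.map_zero]

lemma LC.torsion {I : Ideal R} {i : ℕ} (z : LC I i N) : ∃ n : ℕ, ∀ r ∈ I ^ n, r • z = 0 := by
  obtain ⟨n, x, rfl⟩ := LC.rep z
  refine ⟨n, fun r hr => ?_⟩
  have : r • x = 0 := by
    have h1 : x = (Abelian.Ext.mk₀ (𝟙 _)).comp x (zero_add i) := by simp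
    rw [h1, ← Abelian.Ext.smul_comp, ← Abelian.Ext.mk₀_smul]
    have : r • 𝟙 (ModuleCat.of R (R ⧸ I ^ n)) = 0 := by
      ext
      change r • (Ideal.Quotient.mk (I^n) 1) = 0
      rw [Algebra.smul_def]
      change Ideal.Quotient.mk _ r * _ = 0
      rw [Ideal.Quotient.eq_zero_iff_mem.2 hr, zero_mul]
    rw [this, Abelian.Ext.mk₀_zero, Abelian.Ext.zero_comp]
  rw [← _root_.map_smul, this, _root_.map_zero]

lemma LC.of_injective (I : Ideal R) (i : ℕ) [Module.Injective R N] (z : LC I (i+1) N) : z = 0 := by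
  obtain ⟨n, x, rfl⟩ := LC.rep z
  have : Injective (ModuleCat.of R N) := Module.injective_object_of_injective_module R N
  rw [Abelian.Ext.eq_zero_of_injective x, _root_.map_zero]

/-- evaluation at level `n` -/
noncomputable def LC.evn (I : Ideal R) (N : Type u) [AddCommGroup N] [Module R N] (n : ℕ) :
    Abelian.Ext (ModuleCat.of R (R ⧸ I ^ n)) (ModuleCat.of R N) 0 →ₗ[R] N where
  toFun x := (Abelian.Ext.linearEquiv₀ (R := R) x).hom (Ideal.Quotient.mk (I^n) 1)
  map_add' x y := by rw [_root_.map_add]; rfl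
  map_smul' r x := by rw [_root_.map_smul]; rfl

lemma LC.evn_mk (I : Ideal R) (n : ℕ) (y : ModuleCat.of R (R ⧸ I ^ n) ⟶ ModuleCat.of R N) :
    LC.evn I N n (Abelian.Ext.mk₀ y) = y.hom (Ideal.Quotient.mk (I^n) 1) := by
  have : (Abelian.Ext.linearEquiv₀ (R := R)) (Abelian.Ext.mk₀ y) = y :=
    (Abelian.Ext.linearEquiv₀ (R := R)).apply_symm_apply y
  exact congrArg (fun q => q.hom (Ideal.Quotient.mk (I^n) 1)) this

lemma LC.ext0 {X Y : ModuleCat.{u} R} (x : Abelian.Ext X Y 0) : ∃ y : X ⟶ Y, Abelian.Ext.mk₀ y = x :=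
  (Abelian.Ext.linearEquiv₀ (R := R)).symm.surjective x

/-- evaluation `H^0 → N` -/
noncomputable def LC.ev (I : Ideal R) (N : Type u) [AddCommGroup N] [Module R N] : LC I 0 N →ₗ[R] N :=
  Module.DirectLimit.lift R ℕ _ _ (fun n => LC.evn I N n) (by
    intro m n hmn x
    obtain ⟨y, rfl⟩ := LC.ext0 x
    rw [extTrans_apply, Abelian.Ext.mk₀_comp_mk₀, LC.evn_mk, LC.evn_mk]
    rfl)

lemma LC.ev_of (I : Ideal R) (n : ℕ) (x) : LC.ev I N (LC.of I 0 N n x) = LC.evn I N n x :=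
  Module.DirectLimit.lift_of _ _ _

lemma LC.ev_map (I : Ideal R) (f : N →ₗ[R] N') (z : LC I 0 N) :
    LC.ev I N' (LC.map I 0 f z) = f (LC.ev I N z) := by
  obtain ⟨n, x, rfl⟩ := LC.rep z
  obtain ⟨y, rfl⟩ := LC.ext0 x
  rw [LC.map_of, LC.ev_of, LC.ev_of, Abelian.Ext.mk₀_comp_mk₀, LC.evn_mk, LC.evn_mk]
  rfl

lemma LC.ev_inj (I : Ideal R) : Function.Injective (LC.ev I N) := by
  rw [injective_iff_map_eq_zero]
  intro z hz
  obtain ⟨n, x, rfl⟩ := LC.rep z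
  obtain ⟨y, rfl⟩ := LC.ext0 x
  rw [LC.ev_of, LC.evn_mk] at hz
  have : y = 0 := by
    ext
    exact hz
  rw [this, Abelian.Ext.mk₀_zero, _root_.map_zero]

lemma LC.mem_range_ev (I : Ideal R) (a : N) :
    a ∈ LinearMap.range (LC.ev I N) ↔ ∃ n : ℕ, ∀ r ∈ I ^ n, r • a = 0 := by
  constructor
  · rintro ⟨z, rfl⟩
    obtain ⟨n, hn⟩ := LC.torsion z
    exact ⟨n, fun r hr => by rw [← _root_.map_smul, hn r hr, _root_.map_zero]⟩
  · rintro ⟨n, hn⟩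
    let φ : (R ⧸ I ^ n) →ₗ[R] N := Submodule.liftQ (I^n) (LinearMap.toSpanSingleton R N a) (by
      intro r hr; exact hn r hr)
    refine ⟨LC.of I 0 N n (Abelian.Ext.mk₀ (ModuleCat.ofHom φ)), ?_⟩
    rw [LC.ev_of, LC.evn_mk]
    change LinearMap.toSpanSingleton R N a 1 = a
    simp
end LCapi
end FileC

section FileC2
open CategoryTheory Limits Opposite

section LCcompare
variable {R : Type u} [CommRing R]

lemma extApp_comp (I : Ideal R) (i : ℕ) (M : ModuleCat.{u} R) {m n : ℕ} (h : m ≤ n) 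
   (w : ((Ext R (ModuleCat R) i).obj (op (ModuleCat.of R (R ⧸ I ^ m)))).obj M) :
   oldExtEquiv _ M i ((((Ext R (ModuleCat R) i).map (powProj I h).op).app M).hom w) =
     extTrans I i M m n h (oldExtEquiv _ M i w) := oldExtEquiv_nat _ _ _ _

/-- the evaluated diagram -/
noncomputable abbrev lcDiag (I : Ideal R) (i : ℕ) (M : ModuleCat.{u} R) : ℕᵒᵖᵒᵖ ⥤ ModuleCat.{u} R :=
  localCohomology.diagram (localCohomology.idealPowersDiagram I) i ⋙ (evaluation _ _).obj M

/-- component -/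
noncomputable def lcι (I : Ideal R) (i : ℕ) (M : ModuleCat.{u} R) (j : ℕᵒᵖᵒᵖ) :
    (lcDiag I i M).obj j →ₗ[R] LCc I i M :=
  (LCc.of I i M j.unop.unop).comp
    (oldExtEquiv (ModuleCat.of R (R ⧸ I ^ j.unop.unop)) M i).toLinearMap

lemma lcDiag_map (I : Ideal R) (i : ℕ) (M : ModuleCat.{u} R) {j k : ℕᵒᵖᵒᵖ} (f : j ⟶ k)
    (w : (lcDiag I i M).obj j) :
    lcι I i M k (((lcDiag I i M).map f).hom w) = lcι I i M j w := by
  have h : j.unop.unop ≤ k.unop.unop := f.unop.unop.down.down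
  have := extApp_comp I i M h w
  change LCc.of I i M k.unop.unop (oldExtEquiv _ M i _) = LCc.of I i M j.unop.unop (oldExtEquiv _ M i w)
  refine Eq.trans (congrArg _ this) ?_
  exact Module.DirectLimit.of_f

/-- cocone -/
noncomputable def lcCocone (I : Ideal R) (i : ℕ) (M : ModuleCat.{u} R) : Cocone (lcDiag I i M) where
  pt := ModuleCat.of R (LCc I i M)
  ι := { app := fun j => ModuleCat.ofHom (lcι I i M j)
         naturality := by
          intro j k f
          ext w
          exact lcDiag_map I i M f w }

lemma lcCocone_w (I : Ideal R) (i : ℕ) (M : ModuleCat.{u} R) (s : Cocone (lcDiag I i M)) 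
    (m n : ℕ) (h : m ≤ n) (x : Abelian.Ext (ModuleCat.of R (R ⧸ I ^ m)) M i) :
    (s.ι.app (op (op n))).hom ((oldExtEquiv (ModuleCat.of R (R ⧸ I ^ n)) M i).symm
      (extTrans I i M m n h x)) = (s.ι.app (op (op m))).hom
        ((oldExtEquiv (ModuleCat.of R (R ⧸ I ^ m)) M i).symm x) := by
  obtain ⟨w, rfl⟩ := (oldExtEquiv (ModuleCat.of R (R ⧸ I ^ m)) M i).surjective x
  rw [← extApp_comp, LinearEquiv.symm_apply_apply, LinearEquiv.symm_apply_apply]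
  have := s.w (homOfLE h).op.op
  exact congrArg (fun q => q.hom w) this

/-- the descended map -/
noncomputable def lcDesc (I : Ideal R) (i : ℕ) (M : ModuleCat.{u} R) (s : Cocone (lcDiag I i M)) :
    LCc I i M →ₗ[R] s.pt := Module.DirectLimit.lift R ℕ _ _ 
    (fun n => (s.ι.app (op (op n))).hom.comp (oldExtEquiv (ModuleCat.of R (R ⧸ I ^ n)) M i).symm.toLinearMap)
    (fun m n h x => lcCocone_w I i M s m n h x)

lemma lcDesc_of (I : Ideal R) (i : ℕ) (M : ModuleCat.{u} R) (s : Cocone (lcDiag I i M)) (n : ℕ) (x) :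
    lcDesc I i M s (LCc.of I i M n x) = (s.ι.app (op (op n))).hom
      ((oldExtEquiv (ModuleCat.of R (R ⧸ I ^ n)) M i).symm x) := by
  unfold lcDesc
  rw [Module.DirectLimit.lift_of]
  rfl

/-- it is a colimit -/
noncomputable def lcCoconeIsColimit (I : Ideal R) (i : ℕ) (M : ModuleCat.{u} R) : IsColimit (lcCocone I i M) where
  desc s := ModuleCat.ofHom (lcDesc I i M s)
  fac s j := by
    ext w
    refine (lcDesc_of I i M s j.unop.unop (oldExtEquiv (ModuleCat.of R (R ⧸ I ^ j.unop.unop)) M i w)).trans ?_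
    exact congrArg (s.ι.app j).hom
      ((oldExtEquiv (ModuleCat.of R (R ⧸ I ^ j.unop.unop)) M i).symm_apply_apply w)
  uniq s m hm := by
    ext z
    obtain ⟨n, x, rfl⟩ := LCc.rep I i M z
    obtain ⟨w, rfl⟩ := (oldExtEquiv (ModuleCat.of R (R ⧸ I ^ n)) M i).surjective x
    refine Eq.trans ?_ (lcDesc_of I i M s n _).symm
    rw [LinearEquiv.symm_apply_apply, ← hm]
    rfl

theorem localCohomology_equiv (I : Ideal R) (i : ℕ) (M : ModuleCat.{u} R) :
    Nonempty (((localCohomology I i).obj M) ≃ₗ[R] LCc I i M) := by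
  have := localCohomology.hasColimitDiagram (localCohomology.idealPowersDiagram I) i
  have h1 := isColimitOfPreserves ((evaluation (ModuleCat.{u} R) (ModuleCat.{u} R)).obj M)
    (colimit.isColimit (localCohomology.diagram (localCohomology.idealPowersDiagram I) i))
  exact ⟨(h1.coconePointUniqueUpToIso (lcCoconeIsColimit I i M)).toLinearEquiv⟩
end LCcompare
end FileC2

section FileD
open CategoryTheory Limits Opposite

section gamma
variable {R : Type u} [CommRing R]

/-- the `I`-power torsion submodule -/
def gam (I : Ideal R) (N : Type*) [AddCommGroup N] [Module R N] : Submodule R N where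
  carrier := {a | ∃ n : ℕ, ∀ r ∈ I ^ n, r • a = 0}
  zero_mem' := ⟨0, fun r _ => smul_zero r⟩
  add_mem' := by
    rintro a b ⟨n, hn⟩ ⟨m, hm⟩
    refine ⟨n + m, fun r hr => ?_⟩
    rw [smul_add, hn r (Ideal.pow_le_pow_right (by lia) hr), hm r (Ideal.pow_le_pow_right (by lia) hr),
      add_zero]
  smul_mem' := by
    rintro c a ⟨n, hn⟩
    exact ⟨n, fun r hr => by rw [smul_comm, hn r hr, smul_zero]⟩

lemma mem_gam {I : Ideal R} {N : Type*} [AddCommGroup N] [Module R N] {a : N} :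
    a ∈ gam I N ↔ ∃ n : ℕ, ∀ r ∈ I ^ n, r • a = 0 := Iff.rfl

lemma gam_fg {I : Ideal R} {N : Type*} [AddCommGroup N] [Module R N] (S : Submodule R N) (hS : S.FG)
    (h : S ≤ gam I N) : ∃ n : ℕ, ∀ r ∈ I ^ n, ∀ s ∈ S, r • s = 0 := by
  classical
  obtain ⟨t, rfl⟩ := hS
  induction t using Finset.induction_on with
  | empty => exact ⟨0, fun r _ s hs => by
      simp only [Finset.coe_empty, Submodule.span_empty, Submodule.mem_bot] at hs; rw [hs, smul_zero]⟩
  | insert a t _ ih =>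
    rw [Finset.coe_insert, Submodule.span_insert] at h ⊢
    obtain ⟨n, hn⟩ := ih (le_sup_right.trans h)
    obtain ⟨m, hm⟩ := h (Submodule.mem_sup_left (Submodule.mem_span_singleton_self a))
    refine ⟨n + m, fun r hr s hs => ?_⟩
    obtain ⟨y, hy, z, hz, rfl⟩ := Submodule.mem_sup.1 hs
    obtain ⟨c, rfl⟩ := Submodule.mem_span_singleton.1 hy
    rw [smul_add, smul_comm, hm r (Ideal.pow_le_pow_right (by lia) hr),
      hn r (Ideal.pow_le_pow_right (by lia) hr) z hz, smul_zero, add_zero]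

lemma gam_quot [IsNoetherianRing R] (I : Ideal R) (N : Type*) [AddCommGroup N] [Module R N] [Module.Finite R N] :
    gam I (N ⧸ gam I N) = ⊥ := by
  rw [eq_bot_iff]
  intro a ha
  obtain ⟨a, rfl⟩ := Submodule.Quotient.mk_surjective _ a
  obtain ⟨n, hn⟩ := ha
  obtain ⟨m, hm⟩ := gam_fg (gam I N) (IsNoetherian.noetherian _) le_rfl
  rw [Submodule.mem_bot, Submodule.Quotient.mk_eq_zero]
  refine ⟨m + n, fun r hr => ?_⟩
  rw [pow_add] at hr
  refine Submodule.mul_induction_on hr ?_ ?_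
  · intro x hx y hy
    rw [mul_smul]
    refine hm x hx _ ?_
    have := hn y hy
    rwa [← Submodule.Quotient.mk_smul, Submodule.Quotient.mk_eq_zero] at this
  · intro x y hx hy
    rw [add_smul, hx, hy, add_zero]

theorem gam_injective [IsNoetherianRing R] (I : Ideal R) (J : Type u) [AddCommGroup J] [Module R J]
    [Module.Injective R J] : Module.Injective R (gam I J) := by
  apply Module.Baer.injective
  intro A h
  have hb : Module.Baer R J := Module.Baer.of_injective inferInstance
  obtain ⟨n, hn⟩ := gam_fg (I := I) (LinearMap.range ((gam I J).subtype.comp h))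
    (by rw [LinearMap.range_eq_map]; exact (IsNoetherian.noetherian (⊤ : Submodule R A)).map _) (by rintro _ ⟨x, rfl⟩; exact (h x).2)
  obtain ⟨k, hk⟩ := Ideal.exists_pow_inf_eq_pow_smul I (M := R) A
  have hAR : ∀ x, x ∈ I ^ (n + k) → x ∈ A → x ∈ I ^ n • A := by
    intro x hx hxA
    have h1 := hk (n + k) (by lia)
    have h2 : x ∈ I ^ (n+k) • (⊤ : Submodule R R) ⊓ A := ⟨by simpa using hx, hxA⟩
    rw [h1] at h2
    refine Submodule.smul_mono ?_ inf_le_right h2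
    exact Ideal.pow_le_pow_right (by lia)
  have hkill' : ∀ x (hx : x ∈ I ^ n • A), ∃ (hxA : x ∈ A), (h ⟨x, hxA⟩ : J) = 0 := by
    intro x hx
    refine Submodule.smul_induction_on hx ?_ ?_
    · intro r hr y hy
      refine ⟨A.smul_mem r hy, ?_⟩
      have := hn r hr _ ⟨⟨y, hy⟩, rfl⟩
      have h3 : (⟨r • y, A.smul_mem r hy⟩ : A) = r • ⟨y, hy⟩ := rfl
      rw [h3, map_smul]
      exact this
    · rintro y z ⟨hyA, hy⟩ ⟨hzA, hz⟩
      refine ⟨A.add_mem hyA hzA, ?_⟩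
      have h3 : (⟨y + z, A.add_mem hyA hzA⟩ : A) = ⟨y, hyA⟩ + ⟨z, hzA⟩ := rfl
      rw [h3, map_add, Submodule.coe_add, hy, hz, add_zero]
  have hkill : ∀ x (hx : x ∈ I ^ n • A) (hxA : x ∈ A), (h ⟨x, hxA⟩ : J) = 0 :=
    fun x hx hxA => (hkill' x hx).2
  let f : R →ₗ.[R] J := ⟨A, (gam I J).subtype.comp h⟩
  let g : R →ₗ.[R] J := ⟨I ^ (n + k), 0⟩
  have hfg : ∀ (x : f.domain) (y : g.domain), (x : R) = y → f x = g y := by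
    rintro ⟨x, hx⟩ ⟨y, hy⟩ (rfl : x = y)
    exact hkill x (hAR x hy hx) hx
  obtain ⟨e, he⟩ := hb (f.sup g hfg).domain (f.sup g hfg).toFun
  have heA : ∀ x (hx : x ∈ A), e x = h ⟨x, hx⟩ := by
    intro x hx
    have hle := f.left_le_sup g hfg
    rw [he x (hle.1 hx)]
    exact (hle.2 (x := ⟨x, hx⟩) (y := ⟨x, hle.1 hx⟩) rfl).symm
  have heI : ∀ x (hx : x ∈ I ^ (n + k)), e x = 0 := by
    intro x hx
    have hle := f.right_le_sup g hfg
    rw [he x (hle.1 hx)]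
    exact (hle.2 (x := ⟨x, hx⟩) (y := ⟨x, hle.1 hx⟩) rfl).symm
  refine ⟨e.codRestrict (gam I J) ?_, ?_⟩
  · intro c
    refine ⟨n + k, fun r hr => ?_⟩
    rw [← map_smul]
    exact heI _ (Ideal.mul_mem_right _ _ hr)
  · intro x hx
    exact Subtype.ext (heA x hx)

lemma exists_injective_embedding (N : Type u) [AddCommGroup N] [Module R N] :
    ∃ (J : Type u) (_ : AddCommGroup J) (_ : Module R J) (f : N →ₗ[R] J), Module.Injective R J ∧
      Function.Injective f := by
  refine ⟨(Injective.under (ModuleCat.of R N) : ModuleCat R), inferInstance, inferInstance, (Injective.ι (ModuleCat.of R N)).hom,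
    ?_, ?_⟩
  · have : Injective (ModuleCat.of R (Injective.under (ModuleCat.of R N) : ModuleCat R)) :=
      (inferInstance : Injective (Injective.under (ModuleCat.of R N)))
    exact Module.injective_module_of_injective_object R _
  · exact (ModuleCat.mono_iff_injective _).1 inferInstance

theorem LC.of_torsion [IsNoetherianRing R] (I : Ideal R) (i : ℕ) : ∀ (N : Type u) [AddCommGroup N] [Module R N],
    gam I N = ⊤ → ∀ z : LC I (i+1) N, z = 0 := by
  induction i with
  | zero =>
    intro N _ _ hN z
    obtain ⟨J, _, _, f, hJ, hf⟩ := exists_injective_embedding (R := R) N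
    have hJ' := gam_injective I J
    let f' : N →ₗ[R] gam I J := f.codRestrict _ (fun a => by
      obtain ⟨n, hn⟩ := (hN ▸ Submodule.mem_top : a ∈ gam I N)
      exact ⟨n, fun r hr => by rw [← _root_.map_smul, hn r hr, _root_.map_zero]⟩)
    have hf' : Function.Injective f' := fun a b hab => hf (congrArg Subtype.val hab)
    obtain ⟨δ, h1, h2⟩ := LC.les I f' (LinearMap.range f').mkQ hf' (Submodule.mkQ_surjective _)
      (LinearMap.exact_iff.2 (by simp)) 0
    obtain ⟨w, rfl⟩ := (h2 z).1 (LC.of_injective I 0 _)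
    obtain ⟨γ, hγ⟩ := Submodule.Quotient.mk_surjective _ (LC.ev I _ w)
    obtain ⟨v, hv⟩ := (LC.mem_range_ev I γ).2 (by
      obtain ⟨n, hn⟩ := γ.2
      exact ⟨n, fun r hr => Subtype.ext (hn r hr)⟩)
    refine (h1 w).2 ⟨v, LC.ev_inj I ?_⟩
    rw [LC.ev_map, hv, ← hγ]
    rfl
  | succ i ih =>
    intro N _ _ hN z
    obtain ⟨J, _, _, f, hJ, hf⟩ := exists_injective_embedding (R := R) N
    have hJ' := gam_injective I J
    let f' : N →ₗ[R] gam I J := f.codRestrict _ (fun a => by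
      obtain ⟨n, hn⟩ := (hN ▸ Submodule.mem_top : a ∈ gam I N)
      exact ⟨n, fun r hr => by rw [← _root_.map_smul, hn r hr, _root_.map_zero]⟩)
    have hf' : Function.Injective f' := fun a b hab => hf (congrArg Subtype.val hab)
    obtain ⟨δ, h1, h2⟩ := LC.les I f' (LinearMap.range f').mkQ hf' (Submodule.mkQ_surjective _)
      (LinearMap.exact_iff.2 (by simp)) (i+1)
    obtain ⟨w, rfl⟩ := (h2 z).1 (LC.of_injective I (i+1) _)
    rw [ih _ ?_ w, _root_.map_zero]
    rw [eq_top_iff]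
    intro q _
    obtain ⟨γ, rfl⟩ := Submodule.Quotient.mk_surjective _ q
    obtain ⟨n, hn⟩ := γ.2
    exact ⟨n, fun r hr => by
      rw [← Submodule.Quotient.mk_smul, (Subtype.ext (hn r hr) : r • γ = 0), Submodule.Quotient.mk_zero]⟩

/-- Modding out torsion does not change higher local cohomology. -/
theorem LC.mod_gam [IsNoetherianRing R] (I : Ideal R) (i : ℕ) (N : Type u) [AddCommGroup N] [Module R N] :
    Function.Bijective (LC.map I (i+1) (gam I N).mkQ) := by
  have ht : gam I (gam I N) = ⊤ := by
    rw [eq_top_iff]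
    rintro ⟨a, n, hn⟩ -
    exact ⟨n, fun r hr => Subtype.ext (hn r hr)⟩
  have hex : Function.Exact (gam I N).subtype (gam I N).mkQ := LinearMap.exact_iff.2 (by simp)
  have hi : Function.Injective (gam I N).subtype := Submodule.subtype_injective _
  have hs := Submodule.mkQ_surjective (gam I N)
  constructor
  · rw [injective_iff_map_eq_zero]
    intro z hz
    obtain ⟨w, rfl⟩ := (LC.exact_mid I _ _ hi hs hex (i+1) z).1 hz
    rw [LC.of_torsion I i _ ht w, _root_.map_zero]
  · intro z
    obtain ⟨δ, h1, h2⟩ := LC.les I _ _ hi hs hex (i+1)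
    exact (h1 z).1 (LC.of_torsion I (i+1) _ ht _)
end gamma
end FileD

section FileE
section nak
variable {R : Type*} [CommRing R]

theorem complete_nakayama (m : Ideal R) [IsPrecomplete m R] {K : Type*} [AddCommGroup K] [Module R K]
    (hsep : ∀ x : K, (∀ n : ℕ, x ∈ m ^ n • (⊤ : Submodule R K)) → x = 0)
    (S : Submodule R K) (hS : S.FG) (hSm : S ⊔ m • (⊤ : Submodule R K) = ⊤) : S = ⊤ := by
  obtain ⟨k, s, hs⟩ := (Submodule.fg_iff_exists_fin_generating_family).1 hS
  let f : (Fin k → R) →ₗ[R] K := Fintype.linearCombination R s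
  have hf : LinearMap.range f = S := by
    rw [← hs]; exact Fintype.range_linearCombination R s
  have hvec : ∀ n : ℕ, ∀ x ∈ m ^ n • S, ∃ d : Fin k → R, (∀ i, d i ∈ m ^ n) ∧ f d = x := by
    intro n x hx
    refine Submodule.smul_induction_on hx ?_ ?_
    · intro r hr y hy
      rw [← hf] at hy
      obtain ⟨d, rfl⟩ := hy
      exact ⟨r • d, fun i => Ideal.mul_mem_right _ _ hr, map_smul _ _ _⟩
    · rintro x y ⟨d, hd, rfl⟩ ⟨e, he, rfl⟩
      exact ⟨d + e, fun i => Ideal.add_mem _ (hd i) (he i), map_add _ _ _⟩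
  rw [eq_top_iff]
  rintro z -
  have step : ∀ (n : ℕ) (a : Fin k → R), z - f a ∈ m ^ n • (⊤ : Submodule R K) →
      ∃ a' : Fin k → R, (∀ i, a' i - a i ∈ m ^ n) ∧ z - f a' ∈ m ^ (n+1) • (⊤ : Submodule R K) := by
    intro n a ha
    rw [← hSm, Submodule.smul_sup, ← mul_smul, ← pow_succ] at ha
    obtain ⟨x, hx, y, hy, hxy⟩ := Submodule.mem_sup.1 ha
    obtain ⟨d, hd, rfl⟩ := hvec n x hx
    refine ⟨a + d, fun i => by simpa using hd i, ?_⟩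
    have : z - f (a + d) = y := by
      rw [map_add, ← sub_sub, ← hxy]; abel
    rw [this]; exact hy
  choose g hg1 hg2 using step
  let seq : ∀ n : ℕ, {a : Fin k → R // z - f a ∈ m ^ n • (⊤ : Submodule R K)} := fun n =>
    Nat.rec ⟨0, by simp⟩ (fun n a => ⟨g n a.1 a.2, hg2 n a.1 a.2⟩) n
  have hseq : ∀ n i, (seq (n+1)).1 i - (seq n).1 i ∈ m ^ n := fun n i => hg1 n _ (seq n).2 i
  have hseq' : ∀ n j i, (seq (n+j)).1 i - (seq n).1 i ∈ m ^ n := by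
    intro n j i
    induction j with
    | zero => simp
    | succ j ih =>
      have := Ideal.add_mem _ (Ideal.pow_le_pow_right (Nat.le_add_right n j) (hseq (n+j) i)) ih
      simpa using! this
  have hlim : ∀ i, ∃ L : R, ∀ n, (seq n).1 i - L ∈ m ^ n := by
    intro i
    obtain ⟨L, hL⟩ := IsPrecomplete.prec (I := m) (M := R) inferInstance (f := fun n => (seq n).1 i) (by
      intro a b hab
      obtain ⟨c, rfl⟩ := Nat.exists_eq_add_of_le hab
      rw [SModEq.comm, SModEq.sub_mem]
      simpa using hseq' a c i)
    refine ⟨L, fun n => ?_⟩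
    have := hL n
    rw [SModEq.sub_mem] at this
    simpa using this
  choose L hL using hlim
  have : z - f L = 0 := by
    apply hsep
    intro n
    have h1 : z - f L = (z - f (seq n).1) + f ((seq n).1 - L) := by rw [map_sub]; abel
    rw [h1]
    refine Submodule.add_mem _ (seq n).2 ?_
    rw [Fintype.linearCombination_apply]
    exact Submodule.sum_mem _ fun i _ => Submodule.smul_mem_smul (hL i n) trivial
  rw [sub_eq_zero.1 this, ← hf]
  exact ⟨L, rfl⟩

theorem complete_nakayama' (m : Ideal R) [IsPrecomplete m R] {K : Type*} [AddCommGroup K] [Module R K]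
    (hsep : ∀ x : K, (∀ n : ℕ, x ∈ m ^ n • (⊤ : Submodule R K)) → x = 0)
    (hfin : Module.Finite R (K ⧸ m • (⊤ : Submodule R K))) : Module.Finite R K := by
  classical
  obtain ⟨t, ht⟩ := hfin.fg_top
  let e : K ⧸ m • (⊤ : Submodule R K) → K := Function.surjInv (Submodule.Quotient.mk_surjective _)
  have he : ∀ x, Submodule.Quotient.mk (e x) = x := Function.surjInv_eq _
  refine ⟨?_⟩
  have := complete_nakayama m hsep (Submodule.span R (t.image e)) ⟨_, rfl⟩ ?_
  · rw [← this]; exact ⟨_, rfl⟩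
  · have h1 : Submodule.map (m • (⊤ : Submodule R K)).mkQ (Submodule.span R (t.image e)) = ⊤ := by
      rw [Submodule.map_span, ← ht]
      congr 1
      ext x
      simp only [Finset.coe_image, Set.mem_image, exists_exists_and_eq_and, SetLike.mem_coe]
      constructor
      · rintro ⟨y, hy, rfl⟩; simpa [he] using hy
      · intro hx; exact ⟨x, hx, by simp [he]⟩
    have h2 := congrArg (Submodule.comap (m • (⊤ : Submodule R K)).mkQ) h1
    rw [Submodule.comap_map_mkQ, Submodule.comap_top] at h2
    rw [sup_comm]; exact h2
end nak
end FileE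

section FileF
open CategoryTheory Limits Opposite IsLocalRing Module
open scoped Pointwise

lemma prime_avoid {R : Type*} [CommRing R] (I : Ideal R) (S : Set (Ideal R)) (hS : S.Finite)
    (hp : ∀ p ∈ S, p.IsPrime) (h : ∀ p ∈ S, ¬ I ≤ p) : ∃ x ∈ I, ∀ p ∈ S, x ∉ p := by
  by_contra! hc
  obtain ⟨p, hpS, hle⟩ := (Ideal.subset_union_prime (s := hS.toFinset) (f := id) ⊥ ⊥ (by
    intro p hpS _ _
    exact hp p (hS.mem_toFinset.1 hpS)) (I := I)).1 (by
      intro x hx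
      obtain ⟨p, hpS, hxp⟩ := hc x hx
      simp only [Set.Finite.coe_toFinset, Set.mem_iUnion]
      exact ⟨p, hpS, hxp⟩)
  exact h p (hS.mem_toFinset.1 hpS) hle

lemma wb_lt {a b : WithBot ℕ∞} {i : ℕ} (h : a + 1 = b) (hb : b < ((i + 1 : ℕ) : WithBot ℕ∞)) :
    a < (i : WithBot ℕ∞) := by
  subst h
  induction a using WithBot.recBotCoe with
  | bot => exact WithBot.bot_lt_coe _
  | coe a =>
    have h2 : a + 1 < ((i + 1 : ℕ) : ℕ∞) := by exact_mod_cast hb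
    have : a < (i : ℕ∞) := by
      rw [Nat.cast_add, Nat.cast_one] at h2
      exact lt_of_add_lt_add_right h2
    exact_mod_cast this

section V
variable {R : Type u} [CommRing R] (I : Ideal R)
variable {N : Type u} [AddCommGroup N] [Module R N]

lemma LC.of_subsingleton [Subsingleton N] (i : ℕ) (z : LC I i N) : z = 0 := by
  rw [← LC.map_id I i z, Subsingleton.elim (LinearMap.id : N →ₗ[R] N) 0, LC.map_zero]

lemma quotSMulTop_exact (r : R) :
    Function.Exact (r • (LinearMap.id : N →ₗ[R] N)) (r • (⊤ : Submodule R N)).mkQ := by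
  rw [LinearMap.exact_iff, Submodule.ker_mkQ]
  ext x
  rw [Submodule.mem_smul_pointwise_iff_exists]
  simp

/-- long exact sequence for a regular element -/
lemma LC.les_reg {r : R} (hr : IsSMulRegular N r) (i : ℕ) :
    (∀ z : LC I i N, LC.map I i (r • (⊤ : Submodule R N)).mkQ z = 0 ↔ ∃ w, r • w = z) ∧
    ∃ δ : LC I i (QuotSMulTop r N) →ₗ[R] LC I (i+1) N,
      (∀ z, δ z = 0 ↔ ∃ w, LC.map I i (r • (⊤ : Submodule R N)).mkQ w = z) ∧
      (∀ z, r • z = 0 ↔ ∃ w, δ w = z) := by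
  have hex := quotSMulTop_exact (N := N) r
  have hi : Function.Injective (r • (LinearMap.id : N →ₗ[R] N)) := hr
  have hs := Submodule.mkQ_surjective (r • (⊤ : Submodule R N))
  constructor
  · intro z
    rw [LC.exact_mid I _ _ hi hs hex i z]
    simp [LC.map_smul_id]
  · obtain ⟨δ, h1, h2⟩ := LC.les I _ _ hi hs hex i
    refine ⟨δ, fun z => h1 z, fun z => ?_⟩
    rw [← LC.map_smul_id]
    exact h2 z

lemma eq_zero_of_regular_torsion {X : Type*} [AddCommGroup X] [Module R X] {r : R} (hr : r ∈ I)
    (hX : ∀ z : X, ∃ n : ℕ, ∀ r ∈ I ^ n, r • z = 0) (h : ∀ z : X, r • z = 0 → z = 0) (z : X) : z = 0 := by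
  obtain ⟨n, hn⟩ := hX z
  have := hn (r ^ n) (Ideal.pow_mem_pow hr n)
  clear hn
  induction n with
  | zero => simpa using this
  | succ n ih =>
    apply ih
    apply h
    rw [← mul_smul, ← pow_succ']; exact this

variable [IsNoetherianRing R] [IsLocalRing R]

lemma exists_regular [Module.Finite R N] (h : gam (maximalIdeal R) N = ⊥) :
    ∃ r ∈ maximalIdeal R, IsSMulRegular N r := by
  obtain ⟨r, hr, hra⟩ := prime_avoid (maximalIdeal R) (associatedPrimes R N) (associatedPrimes.finite R N)
    (fun p hp => hp.isPrime) (by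
      intro p hp hle
      obtain ⟨hpp, a, ha⟩ := isAssociatedPrime_iff.1 hp
      have h0 : a ∈ gam (maximalIdeal R) N := ⟨1, fun r hr => by
        rw [pow_one] at hr
        have := hle hr
        rw [ha] at this
        simpa using this⟩
      rw [h, Submodule.mem_bot] at h0
      apply hpp.ne_top
      rw [ha, h0, eq_top_iff]
      intro x _
      simp)
  refine ⟨r, hr, ?_⟩
  have h1 : r ∉ ⋃ p ∈ associatedPrimes R N, (p : Set R) := by simpa using hra
  rw [biUnion_associatedPrimes_eq_zero_divisors] at h1
  rw [isSMulRegular_iff_right_eq_zero_of_smul]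
  intro x hx
  by_contra hx0
  exact h1 ⟨x, hx0, hx⟩

/-- vanishing above the dimension -/
theorem LC.vanish : ∀ (i : ℕ) (N : Type u) [AddCommGroup N] [Module R N] [Module.Finite R N],
    supportDim R N < i → ∀ z : LC (maximalIdeal R) i N, z = 0 := by
  intro i
  induction i with
  | zero =>
    intro N _ _ _ h z
    have : Subsingleton N := by
      rw [← supportDim_eq_bot_iff_subsingleton (R := R)]
      by_contra hc
      have : Nontrivial N := (supportDim_ne_bot_iff_nontrivial R N).1 hc
      have h0 : (0 : WithBot ℕ∞) ≤ supportDim R N := by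
        have : Nonempty (Module.support R N) := nonempty_support_of_nontrivial.to_subtype
        exact Order.krullDim_nonneg
      exact absurd (h0.trans_lt h) (by simp)
    exact LC.of_subsingleton _ _ _
  | succ i ih =>
    intro N _ _ _ h z
    let N' := N ⧸ gam (maximalIdeal R) N
    have hN' : supportDim R N' < (i + 1 : ℕ) :=
      (supportDim_le_of_surjective _ (Submodule.mkQ_surjective (gam (maximalIdeal R) N))).trans_lt h
    suffices hz : ∀ z : LC (maximalIdeal R) (i+1) N', z = 0 by
      apply (LC.mod_gam (maximalIdeal R) i N).1
      rw [hz (LC.map _ _ _ z), _root_.map_zero]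
    obtain ⟨r, hr, hreg⟩ := exists_regular (gam_quot (maximalIdeal R) N)
    apply eq_zero_of_regular_torsion (maximalIdeal R) hr LC.torsion
    intro z hz
    obtain ⟨_, δ, h1, h2⟩ := LC.les_reg (maximalIdeal R) hreg i
    obtain ⟨w, rfl⟩ := (h2 z).1 hz
    rw [ih _ (wb_lt (supportDim_quotSMulTop_succ_eq_supportDim hreg hr) hN') w, _root_.map_zero]

end V
end FileF

section FileG
open CategoryTheory Limits Opposite IsLocalRing Module
open scoped Pointwise

section melk
variable {R : Type*} [CommRing R] {X : Type*} [AddCommGroup X] [Module R X]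

theorem artinian_of_ker (r : R) (ht : ∀ x : X, ∃ n : ℕ, r ^ n • x = 0)
    (K : Submodule R X) (hK : ∀ x, x ∈ K ↔ r • x = 0) [IsArtinian R K] : IsArtinian R X := by
  rw [← monotone_stabilizes_iff_artinian]
  intro f
  let F : ℕ → Submodule R X := fun n => OrderDual.ofDual (f n)
  have hF : ∀ {a b}, a ≤ b → F b ≤ F a := fun {a b} h => f.monotone h
  suffices h : ∃ n, ∀ m, n ≤ m → F n ≤ F m by
    obtain ⟨n, hn⟩ := h
    exact ⟨n, fun m hm => le_antisymm (hF hm) (hn m hm)⟩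
  let A : ℕ → ℕ → Submodule R K := fun k n =>
    Submodule.comap K.subtype (Submodule.map ((r ^ k) • (LinearMap.id : X →ₗ[R] X)) (F n))
  have hA : ∀ k n (z : K), z ∈ A k n ↔ ∃ x ∈ F n, r ^ k • x = z := by
    intro k n z
    simp [A]
  have hAn : ∀ k {a b}, a ≤ b → A k b ≤ A k a := by
    intro k a b hab z hz
    rw [hA] at hz ⊢
    obtain ⟨x, hx, hxz⟩ := hz
    exact ⟨x, hF hab hx, hxz⟩
  have hAk : ∀ n {a b}, a ≤ b → A b n ≤ A a n := by
    intro n a b hab z hz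
    rw [hA] at hz ⊢
    obtain ⟨x, hx, hxz⟩ := hz
    refine ⟨r ^ (b - a) • x, (F n).smul_mem _ hx, ?_⟩
    rw [← mul_smul, ← pow_add, Nat.add_sub_cancel' hab, hxz]
  obtain ⟨_, ⟨⟨k0, n0⟩, rfl⟩, hmin⟩ := IsArtinian.set_has_minimal (Set.range fun q : ℕ × ℕ => A q.1 q.2)
    ⟨_, ⟨(0, 0), rfl⟩⟩
  have h1 : ∀ k n, k0 ≤ k → n0 ≤ n → A k n = A k0 n0 := by
    intro k n hk hn
    have hle : A k n ≤ A k0 n0 := (hAk n hk).trans (hAn k0 hn)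
    exact eq_of_le_of_not_lt hle (hmin _ ⟨(k, n), rfl⟩)
  have h2 : ∀ k, ∃ nk, ∀ n, nk ≤ n → A k nk = A k n := by
    intro k
    exact IsArtinian.monotone_stabilizes (R := R) (M := K)
      ⟨fun n => OrderDual.toDual (A k n), fun a b hab => hAn k hab⟩
  choose ν hν using h2
  let n1 := n0 + ∑ k ∈ Finset.range k0, ν k
  have h3 : ∀ k n, n1 ≤ n → A k n1 = A k n := by
    intro k n hn
    by_cases hk : k < k0
    · have : ν k ≤ n1 := (Finset.single_le_sum (f := ν) (fun _ _ => Nat.zero_le _)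
        (Finset.mem_range.2 hk)).trans (Nat.le_add_left _ _)
      rw [← hν k n1 this, ← hν k n (this.trans hn)]
    · push Not at hk
      rw [h1 k n1 hk (Nat.le_add_right _ _), h1 k n hk ((Nat.le_add_right _ _).trans hn)]
  refine ⟨n1, fun m hm => ?_⟩
  have h4 : ∀ k, ∀ x ∈ F n1, r ^ k • x = 0 → x ∈ F m := by
    intro k
    induction k with
    | zero => intro x _ hx; rw [pow_zero, one_smul] at hx; rw [hx]; exact zero_mem _
    | succ k ih =>
      intro x hx hkx
      have hK1 : r ^ k • x ∈ K := by rw [hK, ← mul_smul, ← pow_succ']; exact hkx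
      have hz : (⟨r ^ k • x, hK1⟩ : K) ∈ A k n1 := (hA _ _ _).2 ⟨x, hx, rfl⟩
      rw [h3 k m hm, hA] at hz
      obtain ⟨y, hy, hyx⟩ := hz
      have := ih (x - y) ((F n1).sub_mem hx (hF hm hy)) (by rw [smul_sub, hyx, sub_self])
      simpa using (F m).add_mem this hy
  intro x hx
  obtain ⟨k, hk⟩ := ht x
  exact h4 k x hx hk
end melk

section A
variable {R : Type u} [CommRing R] [IsNoetherianRing R] [IsLocalRing R]

theorem artinian_of_pow {X : Type*} [AddCommGroup X] [Module R X] [Module.Finite R X] (n : ℕ)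
    (h : ∀ r ∈ maximalIdeal R ^ n, ∀ x : X, r • x = 0) : IsArtinian R X := by
  obtain _ | n := n
  · have : Subsingleton X := ⟨fun a b => by
      rw [← one_smul R a, ← one_smul R b, h 1 (by simp), h 1 (by simp)]⟩
    infer_instance
  · set J := maximalIdeal R ^ (n+1) with hJ
    have hJm : J ≤ maximalIdeal R := Ideal.pow_le_self (by simp)
    have : Nontrivial (R ⧸ J) := Ideal.Quotient.nontrivial_iff.2 (fun h => (maximalIdeal.isMaximal R).ne_top (top_le_iff.1 (h ▸ hJm)))
    have : IsLocalRing (R ⧸ J) := .of_surjective' _ Ideal.Quotient.mk_surjective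
    have hmax : maximalIdeal (R ⧸ J) = (maximalIdeal R).map (Ideal.Quotient.mk J) := by
      exact (map_maximalIdeal_of_surjective _ Ideal.Quotient.mk_surjective).symm
    have : IsArtinianRing (R ⧸ J) := by
      rw [isArtinianRing_iff_isNilpotent_maximalIdeal, hmax]
      refine ⟨n+1, ?_⟩
      rw [← Ideal.map_pow, ← hJ]
      simp
    let := Module.IsTorsionBySet.module (R := R) (M := X) (I := J) (fun x r => h r.1 r.2 x)
    have : IsScalarTower R (R ⧸ J) X := Module.IsTorsionBySet.isScalarTower (fun x r => h r.1 r.2 x)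
    have : Module.Finite (R ⧸ J) X := Module.Finite.of_restrictScalars_finite R _ _
    have : IsArtinian (R ⧸ J) X := inferInstance
    exact isArtinian_of_surjective_algebraMap (R := R ⧸ J) Ideal.Quotient.mk_surjective

theorem LC.artinian : ∀ (i : ℕ) (N : Type u) [AddCommGroup N] [Module R N] [Module.Finite R N],
    IsArtinian R (LC (maximalIdeal R) i N) := by
  intro i
  induction i with
  | zero =>
    intro N _ _ _
    have hinj := LC.ev_inj (N := N) (maximalIdeal R)
    have : Module.Finite R (LC (maximalIdeal R) 0 N) := Module.Finite.of_injective _ hinj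
    obtain ⟨n, hn⟩ := gam_fg (gam (maximalIdeal R) N) (IsNoetherian.noetherian _) le_rfl
    apply artinian_of_pow n
    intro r hr x
    apply hinj
    rw [_root_.map_smul, _root_.map_zero]
    exact hn r hr _ ((LC.mem_range_ev _ _).1 ⟨x, rfl⟩)
  | succ i ih =>
    intro N _ _ _
    obtain ⟨r, hr, hreg⟩ := exists_regular (gam_quot (maximalIdeal R) N)
    obtain ⟨_, δ, h1, h2⟩ := LC.les_reg (maximalIdeal R) hreg i
    have := ih (QuotSMulTop r (N ⧸ gam (maximalIdeal R) N))
    have h3 : IsArtinian R (LC (maximalIdeal R) (i+1) (N ⧸ gam (maximalIdeal R) N)) := by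
      refine artinian_of_ker r ?_ (LinearMap.range δ) ?_
      · intro x
        obtain ⟨n, hn⟩ := LC.torsion x
        exact ⟨n, hn _ (Ideal.pow_mem_pow hr n)⟩
      · intro x; rw [h2 x]; rfl
    exact isArtinian_of_linearEquiv (LinearEquiv.ofBijective _ (LC.mod_gam (maximalIdeal R) i N)).symm
end A
end FileG

section FileH
open CategoryTheory Limits Opposite IsLocalRing Module
open scoped Pointwise

section secondary
variable {R : Type*} [CommRing R] [IsNoetherianRing R] {X : Type*} [AddCommGroup X] [Module R X]

theorem artinian_avoid (m : Ideal R) [IsArtinian R X] :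
    ∃ T : Set (Ideal R), T.Finite ∧ (∀ p ∈ T, p.IsPrime ∧ ¬ m ≤ p) ∧
      ∀ r ∈ m, (∀ p ∈ T, r ∉ p) → ∃ n : ℕ, ∀ s ∈ m ^ n, ∀ x : X, ∃ y : X, s • x = r • y := by
  suffices h : ∀ Y : Submodule R X, ∃ T : Set (Ideal R), T.Finite ∧ (∀ p ∈ T, p.IsPrime ∧ ¬ m ≤ p) ∧
      ∀ r ∈ m, (∀ p ∈ T, r ∉ p) → ∃ n : ℕ, ∀ s ∈ m ^ n, ∀ x ∈ Y, ∃ y ∈ Y, s • x = r • y by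
    obtain ⟨T, h1, h2, h3⟩ := h ⊤
    refine ⟨T, h1, h2, fun r hr hrT => ?_⟩
    obtain ⟨n, hn⟩ := h3 r hr hrT
    refine ⟨n, fun s hs x => ?_⟩
    obtain ⟨y, _, hy⟩ := hn s hs x trivial
    exact ⟨y, hy⟩
  intro Y
  induction Y using IsArtinian.induction with
  | _ Y ih =>
  by_cases hsum : ∃ Y1 Y2 : Submodule R X, Y1 < Y ∧ Y2 < Y ∧ Y1 ⊔ Y2 = Y
  · obtain ⟨Y1, Y2, h1, h2, h12⟩ := hsum
    obtain ⟨T1, f1, p1, q1⟩ := ih Y1 h1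
    obtain ⟨T2, f2, p2, q2⟩ := ih Y2 h2
    refine ⟨T1 ∪ T2, f1.union f2, ?_, ?_⟩
    · rintro p (hp | hp)
      · exact p1 p hp
      · exact p2 p hp
    · intro r hr hrT
      obtain ⟨n1, hn1⟩ := q1 r hr (fun p hp => hrT p (Or.inl hp))
      obtain ⟨n2, hn2⟩ := q2 r hr (fun p hp => hrT p (Or.inr hp))
      refine ⟨n1 + n2, fun s hs x hx => ?_⟩
      rw [← h12] at hx
      obtain ⟨x1, hx1, x2, hx2, rfl⟩ := Submodule.mem_sup.1 hx
      obtain ⟨y1, hy1, e1⟩ := hn1 s (Ideal.pow_le_pow_right (Nat.le_add_right _ _) hs) x1 hx1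
      obtain ⟨y2, hy2, e2⟩ := hn2 s (Ideal.pow_le_pow_right (Nat.le_add_left _ _) hs) x2 hx2
      exact ⟨y1 + y2, add_mem (h1.le hy1) (h2.le hy2), by rw [smul_add, smul_add, e1, e2]⟩
  by_cases hY : Y = ⊥
  · refine ⟨∅, Set.finite_empty, by simp, fun r hr _ => ⟨0, fun s _ x hx => ⟨0, zero_mem _, ?_⟩⟩⟩
    rw [hY, Submodule.mem_bot] at hx
    simp [hx]
  -- dichotomy
  have key : ∀ r : R, (∀ x ∈ Y, ∃ y ∈ Y, x = r • y) ∨ ∃ n : ℕ, ∀ x ∈ Y, r ^ n • x = 0 := by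
    intro r
    let F : ℕ → Submodule R X := fun n => Submodule.map ((r ^ n) • (LinearMap.id : X →ₗ[R] X)) Y
    have hF : ∀ n x, x ∈ F n ↔ ∃ y ∈ Y, r ^ n • y = x := by intro n x; simp [F]
    have hanti : ∀ {a b}, a ≤ b → F b ≤ F a := by
      intro a b hab x hx
      rw [hF] at hx ⊢
      obtain ⟨y, hy, rfl⟩ := hx
      refine ⟨r ^ (b - a) • y, Y.smul_mem _ hy, ?_⟩
      rw [← mul_smul, ← pow_add, Nat.add_sub_cancel' hab]
    obtain ⟨n, hn⟩ := IsArtinian.monotone_stabilizes (R := R) (M := X)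
      ⟨fun n => OrderDual.toDual (F n), fun a b hab => hanti hab⟩
    have hn' : F (n+1) = F (n + 1 + (n+1)) := (hn _ (by omega)).symm.trans (hn _ (by omega))
    let K : Submodule R X := Y ⊓ LinearMap.ker ((r ^ (n+1)) • (LinearMap.id : X →ₗ[R] X))
    have hK : ∀ x, x ∈ K ↔ x ∈ Y ∧ r ^ (n+1) • x = 0 := by intro x; simp [K]
    have hle : F (n+1) ≤ Y := by
      intro x hx
      obtain ⟨y, hy, rfl⟩ := (hF _ _).1 hx
      exact Y.smul_mem _ hy
    have hsup : F (n+1) ⊔ K = Y := by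
      refine le_antisymm (sup_le hle inf_le_left) ?_
      intro x hx
      have h1 : r ^ (n+1) • x ∈ F (n+1) := (hF _ _).2 ⟨x, hx, rfl⟩
      rw [hn', hF] at h1
      obtain ⟨z, hz, hzx⟩ := h1
      refine Submodule.mem_sup.2 ⟨r ^ (n+1) • z, (hF _ _).2 ⟨z, hz, rfl⟩, x - r ^ (n+1) • z, (hK _).2 ⟨sub_mem hx (Y.smul_mem _ hz), ?_⟩, by abel⟩
      rw [smul_sub, ← hzx, ← mul_smul, ← pow_add, sub_self]
    by_cases h1 : F (n+1) = Y
    · left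
      intro x hx
      rw [← h1, hF] at hx
      obtain ⟨y, hy, rfl⟩ := hx
      exact ⟨r ^ n • y, Y.smul_mem _ hy, by rw [← mul_smul, ← pow_succ']⟩
    · right
      by_cases h2 : K = Y
      · refine ⟨n+1, fun x hx => ?_⟩
        rw [← h2] at hx
        exact ((hK x).1 hx).2
      · exact absurd ⟨_, _, lt_of_le_of_ne hle h1, lt_of_le_of_ne inf_le_left h2, hsup⟩ hsum
  let p : Ideal R := (Y.annihilator).radical
  have hp : ∀ r, r ∈ p ↔ ∃ n : ℕ, ∀ x ∈ Y, r ^ n • x = 0 := by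
    intro r
    simp only [p, Ideal.mem_radical_iff, Submodule.mem_annihilator]
  have hpp : p.IsPrime := by
    constructor
    · rw [Ideal.ne_top_iff_one, hp]
      rintro ⟨n, hn⟩
      apply hY
      rw [eq_bot_iff]
      intro x hx
      simpa using hn x hx
    · intro a b hab
      by_cases ha : a ∈ p
      · exact Or.inl ha
      · right
        rcases key a with h | h
        · obtain ⟨n, hn⟩ := (hp _).1 hab
          rw [hp]
          refine ⟨n, ?_⟩
          have : ∀ k : ℕ, ∀ x ∈ Y, ∃ y ∈ Y, x = a ^ k • y := by
            intro k
            induction k with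
            | zero => intro x hx; exact ⟨x, hx, by simp⟩
            | succ k ihk =>
              intro x hx
              obtain ⟨y, hy, rfl⟩ := ihk x hx
              obtain ⟨z, hz, rfl⟩ := h y hy
              exact ⟨z, hz, by rw [← mul_smul, ← pow_succ]⟩
          intro x hx
          obtain ⟨y, hy, rfl⟩ := this n x hx
          rw [← mul_smul, ← mul_pow, mul_comm b a]
          exact hn y hy
        · exact absurd ((hp a).2 h) ha
  by_cases hm : m ≤ p
  · obtain ⟨n, hn⟩ := Ideal.exists_pow_le_of_le_radical_of_fg hm (IsNoetherian.noetherian _)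
    refine ⟨∅, Set.finite_empty, by simp, fun r hr _ => ⟨n, fun s hs x hx => ⟨0, zero_mem _, ?_⟩⟩⟩
    rw [smul_zero]
    exact Submodule.mem_annihilator.1 (hn hs) x hx
  · refine ⟨{p}, Set.finite_singleton _, by simpa using ⟨hpp, hm⟩, fun r hr hrp => ⟨0, fun s hs x hx => ?_⟩⟩
    rcases key r with h | h
    · exact h _ (Y.smul_mem _ hx)
    · exact absurd ((hp r).2 h) (hrp p rfl)
end secondary
end FileH

section FileI1
open CategoryTheory Limits Opposite IsLocalRing Module
open scoped Pointwise

/-- a prime of the support attaining a given dimension bound -/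
lemma exists_prime_of_le_supportDim {R : Type*} [CommRing R] {M : Type*} [AddCommGroup M] [Module R M]
    (n : ℕ) (h : (n : WithBot ℕ∞) ≤ supportDim R M) :
    ∃ Q : Ideal R, Q.IsPrime ∧ Module.annihilator R M ≤ Q ∧ (n : WithBot ℕ∞) ≤ ringKrullDim (R ⧸ Q) := by
  obtain ⟨l, hl⟩ := Order.le_krullDim_iff.1 h
  refine ⟨l.head.1.asIdeal, l.head.1.2, annihilator_le_of_mem_support l.head.2, ?_⟩
  rw [ringKrullDim_quotient, Order.le_krullDim_iff]
  exact ⟨{ length := l.length, toFun := fun i => ⟨(l i).1, LTSeries.head_le l i⟩, step := fun i => l.step i }, hl⟩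

lemma supportDim_quotient' {R : Type*} [CommRing R] (P : Ideal R) : supportDim R (R ⧸ P) = ringKrullDim (R ⧸ P) :=
  supportDim_quotient_eq_ringKrullDim P

set_option linter.unusedSectionVars false
section NV
variable {R : Type u} [CommRing R] [IsNoetherianRing R] [IsLocalRing R]

/-- right exactness in top degree -/
lemma LC.top_surj {N N' : Type u} [AddCommGroup N] [Module R N] [AddCommGroup N'] [Module R N'] [Module.Finite R N]
    (d : ℕ) (hd : supportDim R N ≤ d) (f : N →ₗ[R] N') (hf : Function.Surjective f) :
    Function.Surjective (LC.map (maximalIdeal R) d f) := by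
  obtain ⟨δ, h1, h2⟩ := LC.les (maximalIdeal R) (LinearMap.ker f).subtype f Subtype.val_injective hf
    (by rw [LinearMap.exact_iff]; simp) d
  intro z
  refine (h1 z).1 (LC.vanish (d+1) _ ?_ _)
  refine ((supportDim_le_of_injective _ (LinearMap.ker f).injective_subtype).trans hd).trans_lt ?_
  exact_mod_cast Nat.lt_succ_self d

lemma LC.smul_surj {N : Type u} [AddCommGroup N] [Module R N] [Module.Finite R N]
    (d : ℕ) (hd : supportDim R N ≤ d) {a : R} (ha : a ∈ maximalIdeal R) (hreg : IsSMulRegular N a)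
    (z : LC (maximalIdeal R) d N) : ∃ w, z = a • w := by
  obtain ⟨h, _⟩ := LC.les_reg (maximalIdeal R) hreg d
  obtain ⟨w, hw⟩ := (h z).1 (LC.vanish d _ (wb_lt (supportDim_quotSMulTop_succ_eq_supportDim hreg ha)
    (hd.trans_lt (by exact_mod_cast Nat.lt_succ_self d))) _)
  exact ⟨w, hw.symm⟩

lemma LC.pi_zero (I : Ideal R) (i : ℕ) {N : Type u} [AddCommGroup N] [Module R N] (h : ∀ z : LC I i N, z = 0)
    (k : ℕ) (z : LC I i (Fin k → N)) : z = 0 := by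
  have hsum : ∀ (s : Finset (Fin k)) (f : Fin k → ((Fin k → N) →ₗ[R] (Fin k → N))),
      LC.map I i (∑ j ∈ s, f j) z = ∑ j ∈ s, LC.map I i (f j) z := by
    intro s f
    induction s using Finset.cons_induction with
    | empty => simp [LC.map_zero]
    | cons a s ha ih => rw [Finset.sum_cons, Finset.sum_cons, LC.map_add, ih]
  rw [← LC.map_id I i z, show (LinearMap.id : (Fin k → N) →ₗ[R] (Fin k → N)) =
    ∑ j, (LinearMap.single R (fun _ => N) j).comp (LinearMap.proj j) from ?_, hsum]
  · refine Finset.sum_eq_zero fun j _ => ?_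
    rw [← LC.map_comp, h (LC.map I i (LinearMap.proj j) z), _root_.map_zero]
  · ext v j
    simp [Finset.sum_apply, Pi.single_apply]

lemma supportDim_pi_le {N : Type*} [AddCommGroup N] [Module R N] (k : ℕ) :
    supportDim R (Fin k → N) ≤ supportDim R N := by
  refine Order.krullDim_le_of_strictMono (fun p => ⟨p.1, ?_⟩) (fun a b h => h)
  obtain ⟨p, hp⟩ := p
  rw [mem_support_iff_exists_annihilator] at hp ⊢
  obtain ⟨v, hv⟩ := hp
  by_contra! hc
  have : ∀ j, ∃ s : R, s ∉ p.asIdeal ∧ s • v j = 0 := by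
    intro j
    obtain ⟨s, hs, hs'⟩ := Set.not_subset.1 (hc (v j))
    refine ⟨s, hs', ?_⟩
    simpa [Submodule.mem_annihilator_span_singleton] using hs
  choose s hs hs' using this
  have h1 : ∏ j, s j ∈ p.asIdeal := hv (by
    rw [Submodule.mem_annihilator_span_singleton]
    ext j
    rw [Pi.smul_apply, ← Finset.mul_prod_erase _ _ (Finset.mem_univ j), mul_comm, mul_smul, hs' j]
    simp)
  obtain ⟨j, _, hj⟩ := (Ideal.IsPrime.prod_mem_iff (hp := p.2)).1 h1
  exact hs j hj

theorem LC.nonvanish : ∀ (d : ℕ) (P : Ideal R) [P.IsPrime], ringKrullDim (R ⧸ P) = d →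
    ∃ z : LC (maximalIdeal R) d (R ⧸ P), z ≠ 0 := by
  intro d
  induction d with
  | zero =>
    intro P hP hd
    have hPm : P = maximalIdeal R := by
      by_contra hne
      have hlt : P < maximalIdeal R := lt_of_le_of_ne (le_maximalIdeal hP.ne_top) hne
      have : (1 : WithBot ℕ∞) ≤ ringKrullDim (R ⧸ P) := by
        rw [ringKrullDim_quotient, Order.one_le_krullDim_iff]
        exact ⟨⟨⟨P, hP⟩, le_refl P⟩, ⟨⟨maximalIdeal R, inferInstance⟩, hlt.le⟩, hlt⟩
      rw [hd] at this
      exact absurd this (by decide)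
    obtain ⟨z, hz⟩ := (LC.mem_range_ev (maximalIdeal R) (1 : R ⧸ P)).2 ⟨1, fun r hr => by
      rw [pow_one, ← hPm] at hr
      rw [Algebra.smul_def, mul_one]
      exact Ideal.Quotient.eq_zero_iff_mem.2 hr⟩
    refine ⟨z, ?_⟩
    rintro rfl
    rw [_root_.map_zero] at hz
    exact zero_ne_one hz
  | succ d ih =>
    intro P hP hd
    by_contra! hvan
    let m := maximalIdeal R
    have hmP : ¬ m ≤ P := by
      intro hle
      have hPm : P = m := le_antisymm (le_maximalIdeal hP.ne_top) hle
      have : P.IsMaximal := hPm ▸ maximalIdeal.isMaximal R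
      let := Ideal.Quotient.field P
      rw [ringKrullDim_eq_zero_of_field] at hd
      exact absurd hd (by exact_mod_cast (Nat.succ_ne_zero d).symm)
    have := LC.artinian (R := R) d (R ⧸ P)
    obtain ⟨T, hTf, hTp, hT⟩ := artinian_avoid (X := LC m d (R ⧸ P)) m
    obtain ⟨r, hr, hrT⟩ := prime_avoid m (insert P T) (hTf.insert P)
      (by rintro p (rfl | hp); exacts [hP, (hTp p hp).1])
      (by rintro p (rfl | hp); exacts [hmP, (hTp p hp).2])
    have hrP : r ∉ P := hrT P (Set.mem_insert _ _)
    obtain ⟨n, hn⟩ := hT r hr (fun p hp => hrT p (Set.mem_insert_of_mem _ hp))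
    have hreg : ∀ (Q : Ideal R) [Q.IsPrime] (s : R), s ∉ Q → IsSMulRegular (R ⧸ Q) s := by
      intro Q hQ s hs
      rw [isSMulRegular_iff_right_eq_zero_of_smul]
      intro x hx
      rw [Algebra.smul_def] at hx
      rcases mul_eq_zero.1 hx with h | h
      · exact absurd (Ideal.Quotient.eq_zero_iff_mem.1 h) hs
      · exact h
    have hd1 : supportDim R (QuotSMulTop r (R ⧸ P)) + 1 = (d + 1 : ℕ) := by
      rw [supportDim_quotSMulTop_succ_eq_supportDim (hreg P r hrP) hr, supportDim_quotient', hd]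
    have hd2 : (d : WithBot ℕ∞) ≤ supportDim R (QuotSMulTop r (R ⧸ P)) := by
      by_contra! hc
      have hne : supportDim R (QuotSMulTop r (R ⧸ P)) + 1 < ((d + 1 : ℕ) : WithBot ℕ∞) := by
        generalize supportDim R (QuotSMulTop r (R ⧸ P)) = a at hc
        induction a using WithBot.recBotCoe with
        | bot => exact WithBot.bot_lt_coe _
        | coe a =>
          have h2 : a < (d : ℕ∞) := by exact_mod_cast hc
          have : a + 1 < ((d + 1 : ℕ) : ℕ∞) := by
            rw [Nat.cast_add, Nat.cast_one]
            exact ENat.add_lt_add_of_lt_of_le (by simp) h2 le_rfl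
          exact_mod_cast this
      exact hne.ne hd1
    obtain ⟨Q, hQ, hQann, hQd⟩ := exists_prime_of_le_supportDim d hd2
    have hrQ : r ∈ Q := hQann (by
      rw [mem_annihilator]
      intro x
      obtain ⟨x, rfl⟩ := Submodule.mkQ_surjective _ x
      rw [← _root_.map_smul, Submodule.mkQ_apply, Submodule.Quotient.mk_eq_zero]
      exact Submodule.smul_mem_pointwise_smul _ _ _ trivial)
    have hPQ : P ≤ Q := fun s hs => hQann (by
      rw [mem_annihilator]
      intro x
      obtain ⟨x, rfl⟩ := Submodule.mkQ_surjective _ x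
      obtain ⟨x, rfl⟩ := Ideal.Quotient.mk_surjective x
      rw [← _root_.map_smul, Algebra.smul_def]
      have : algebraMap R (R ⧸ P) s = 0 := Ideal.Quotient.eq_zero_iff_mem.2 hs
      rw [this, zero_mul, _root_.map_zero])
    have hQd' : ringKrullDim (R ⧸ Q) = d := by
      refine le_antisymm ?_ hQd
      have h1 := ringKrullDim_succ_le_of_surjective (Ideal.Quotient.factor hPQ) (Ideal.Quotient.factor_surjective hPQ)
        (r := Ideal.Quotient.mk P r) (mem_nonZeroDivisors_of_ne_zero (fun h => hrP (Ideal.Quotient.eq_zero_iff_mem.1 h)))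
        (by rw [Ideal.Quotient.factor_mk]; exact Ideal.Quotient.eq_zero_iff_mem.2 hrQ)
      rw [hd] at h1
      generalize ringKrullDim (R ⧸ Q) = a at h1
      induction a using WithBot.recBotCoe with
      | bot => exact bot_le
      | coe a =>
        have h2 : a + 1 ≤ ((d + 1 : ℕ) : ℕ∞) := by exact_mod_cast h1
        have : a ≤ (d : ℕ∞) := by
          rw [Nat.cast_add, Nat.cast_one] at h2
          exact (ENat.add_le_add_iff_right (by simp)).1 h2
        exact_mod_cast this
    obtain ⟨g, hg⟩ := ih Q hQd'
    -- surjection X → G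
    let π : (R ⧸ P) →ₗ[R] (R ⧸ Q) := (Ideal.Quotient.factorₐ R hPQ).toLinearMap
    have hπ : Function.Surjective π := Ideal.Quotient.factor_surjective hPQ
    have hsurj : Function.Surjective (LC.map m d π) := by
      obtain ⟨δ, h1, h2⟩ := LC.les m (LinearMap.ker π).subtype π Subtype.val_injective hπ
        (by rw [LinearMap.exact_iff]; simp) d
      intro z
      refine (h1 z).1 ?_
      -- vanishing of the kernel
      let K : Ideal (R ⧸ P) := RingHom.ker (Ideal.Quotient.factor hPQ)
      obtain ⟨k, f, hf⟩ := Module.Finite.exists_fin' (R ⧸ P) K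
      let f' : (Fin k → R ⧸ P) →ₗ[R] LinearMap.ker π :=
        LinearMap.codRestrict (LinearMap.ker π) ((K.subtype.comp f).restrictScalars R) (fun c => (f c).2)
      have hf' : Function.Surjective f' := by
        rintro ⟨x, hx⟩
        obtain ⟨c, hc⟩ := hf ⟨x, hx⟩
        exact ⟨c, Subtype.ext (congrArg Subtype.val hc)⟩
      obtain ⟨w, hw⟩ := LC.top_surj (d+1) ((supportDim_pi_le k).trans (by rw [supportDim_quotient', hd])) f' hf' (δ z)
      rw [← hw, LC.pi_zero m (d+1) hvan k w, _root_.map_zero]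
    have hrG : ∀ z : LC m d (R ⧸ Q), r • z = 0 := by
      intro z
      rw [← LC.map_smul_id, show r • (LinearMap.id : (R ⧸ Q) →ₗ[R] (R ⧸ Q)) = 0 from ?_, LC.map_zero]
      ext
      simp only [LinearMap.comp_apply, LinearMap.smul_apply, LinearMap.id_apply, LinearMap.zero_apply]
      exact Ideal.Quotient.eq_zero_iff_mem.2 (by simpa using hrQ)
    have hmn : ∀ s ∈ m ^ n, ∀ z : LC m d (R ⧸ Q), s • z = 0 := by
      intro s hs z
      obtain ⟨x, rfl⟩ := hsurj z
      obtain ⟨y, hy⟩ := hn s hs x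
      rw [← _root_.map_smul, hy, _root_.map_smul, hrG]
    by_cases hd0 : d = 0
    · subst hd0
      obtain ⟨x, rfl⟩ := hsurj g
      apply hg
      rw [eq_zero_of_regular_torsion m hr LC.torsion ?_ x, _root_.map_zero]
      intro z hz
      apply LC.ev_inj m
      rw [_root_.map_zero]
      refine (isSMulRegular_iff_right_eq_zero_of_smul).1 (hreg P r hrP) _ ?_
      rw [← _root_.map_smul, hz, _root_.map_zero]
    · have hmQ : ¬ m ≤ Q := by
        intro hle
        have hPm : Q = m := le_antisymm (le_maximalIdeal hQ.ne_top) hle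
        have : Q.IsMaximal := hPm ▸ maximalIdeal.isMaximal R
        let := Ideal.Quotient.field Q
        rw [ringKrullDim_eq_zero_of_field] at hQd'
        exact hd0 (by exact_mod_cast hQd'.symm)
      obtain ⟨a, ha, haQ⟩ := Set.not_subset.1 hmQ
      have hdiv : ∀ k : ℕ, ∀ z : LC m d (R ⧸ Q), ∃ w, z = a ^ k • w := by
        intro k
        induction k with
        | zero => intro z; exact ⟨z, by simp⟩
        | succ k ihk =>
          intro z
          obtain ⟨w, rfl⟩ := ihk z
          obtain ⟨w, rfl⟩ := LC.smul_surj d (by rw [supportDim_quotient', hQd']) ha (hreg Q a haQ) w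
          exact ⟨w, by rw [← mul_smul, ← pow_succ]⟩
      obtain ⟨w, rfl⟩ := hdiv n g
      exact hg (hmn _ (Ideal.pow_mem_pow ha n) w)
end NV
end FileI1

section FileJ
open CategoryTheory Limits Opposite IsLocalRing Module
open scoped Pointwise

set_option linter.unusedSectionVars false

lemma supportDim_le_of_ann {R : Type*} [CommRing R] {M : Type*} [AddCommGroup M] [Module R M]
    (J : Ideal R) (h : ∀ r ∈ J, ∀ x : M, r • x = 0) : supportDim R M ≤ ringKrullDim (R ⧸ J) := by
  rw [ringKrullDim_quotient]
  refine Order.krullDim_le_of_strictMono (fun p => ⟨p.1, ?_⟩) (fun a b h => h)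
  exact fun r hr => annihilator_le_of_mem_support p.2 (mem_annihilator.2 (h r hr))

section top
variable {R : Type u} [CommRing R] [IsNoetherianRing R] [IsLocalRing R] [IsDomain R]

lemma LC.dom_ne (d : ℕ) (hd : ringKrullDim R = d) : ∃ z : LC (maximalIdeal R) d R, z ≠ 0 := by
  let e : (R ⧸ (⊥ : Ideal R)) ≃ₗ[R] R := Submodule.quotEquivOfEqBot ⊥ rfl
  have h1 : ringKrullDim (R ⧸ (⊥ : Ideal R)) = d := by
    rw [← hd]
    exact ringKrullDim_eq_of_ringEquiv (RingEquiv.quotientBot R)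
  obtain ⟨z, hz⟩ := LC.nonvanish d (⊥ : Ideal R) h1
  refine ⟨LC.map _ d e.toLinearMap z, fun h => hz ?_⟩
  rw [← LC.map_id _ d z, show LinearMap.id = e.symm.toLinearMap.comp e.toLinearMap from ?_, ← LC.map_comp, h, _root_.map_zero]
  ext; simp

lemma LC.dom_div (d : ℕ) (hd : ringKrullDim R = d) (a : R) (ha : a ≠ 0) (z : LC (maximalIdeal R) d R) :
    ∃ w, z = a • w := by
  by_cases hu : a ∈ maximalIdeal R
  · exact LC.smul_surj d (by rw [supportDim_self_eq_ringKrullDim, hd]) hu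
      (isSMulRegular_iff_right_eq_zero_of_smul.2 fun x hx => by
        rcases mul_eq_zero.1 hx with h | h
        · exact absurd h ha
        · exact h) z
  · have : IsUnit a := by simpa using hu
    obtain ⟨u, rfl⟩ := this
    exact ⟨(↑u⁻¹ : R) • z, by rw [← mul_smul]; simp⟩

lemma LC.dom_faithful (d : ℕ) (hd : ringKrullDim R = d) (a : R)
    (h : ∀ z : LC (maximalIdeal R) d R, a • z = 0) : a = 0 := by
  by_contra ha
  obtain ⟨z, hz⟩ := LC.dom_ne d hd
  obtain ⟨w, rfl⟩ := LC.dom_div d hd a ha z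
  exact hz (h w)

lemma LC.dom_div2 (e : ℕ) (hd : ringKrullDim R = (e + 1 : ℕ)) (x y : R) (hx : x ≠ 0) (hxm : x ∈ maximalIdeal R)
    (hdim : ringKrullDim (R ⧸ Ideal.span {x, y}) < e) (z : LC (maximalIdeal R) (e + 1) R) (hz : x • z = 0) :
    ∃ w, x • w = 0 ∧ z = y • w := by
  have hreg : IsSMulRegular R x := isSMulRegular_iff_right_eq_zero_of_smul.2 fun t ht => by
    rcases mul_eq_zero.1 ht with h | h
    · exact absurd h hx
    · exact h
  obtain ⟨_, δ, h1, h2⟩ := LC.les_reg (maximalIdeal R) hreg e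
  let N := QuotSMulTop x R
  have hN : supportDim R N < (e+1 : ℕ) := by
    refine wb_lt (supportDim_quotSMulTop_succ_eq_supportDim hreg hxm) ?_
    rw [supportDim_self_eq_ringKrullDim, hd]
    exact_mod_cast Nat.lt_succ_self _
  have hN' : supportDim R N ≤ (e : ℕ) := by
    generalize supportDim R N = a at hN
    induction a using WithBot.recBotCoe with
    | bot => exact bot_le
    | coe a =>
      have h2 : a < ((e + 1 : ℕ) : ℕ∞) := by exact_mod_cast hN
      have : a ≤ (e : ℕ∞) := by
        rw [Nat.cast_add, Nat.cast_one] at h2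
        exact (ENat.lt_add_one_iff (by simp)).1 h2
      exact_mod_cast this
  obtain ⟨w, rfl⟩ := (h2 z).1 hz
  let Z : Submodule R N := LinearMap.range (y • (LinearMap.id : N →ₗ[R] N))
  let f : N →ₗ[R] Z := LinearMap.rangeRestrict _
  have hf : Function.Surjective f := LinearMap.surjective_rangeRestrict _
  have hfs := LC.top_surj e hN' f hf
  have hex := LC.exact_mid (maximalIdeal R) Z.subtype Z.mkQ Subtype.val_injective (Submodule.mkQ_surjective _)
    (by rw [LinearMap.exact_iff]; simp) e w
  have hann : ∀ r ∈ Ideal.span {x, y}, ∀ t : N ⧸ Z, r • t = 0 := ?_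
  · obtain ⟨w1, hw1⟩ := hex.1 (LC.vanish e _ (lt_of_le_of_lt (supportDim_le_of_ann (Ideal.span {x, y}) hann) hdim) _)
    obtain ⟨w2, rfl⟩ := hfs w1
    rw [LC.map_comp, show Z.subtype.comp f = y • LinearMap.id from rfl, LC.map_smul_id] at hw1
    exact ⟨δ w2, (h2 _).2 ⟨w2, rfl⟩, by rw [← hw1, _root_.map_smul]⟩
  · intro r hr t
    obtain ⟨t, rfl⟩ := Submodule.mkQ_surjective _ t
    rw [← _root_.map_smul, Submodule.mkQ_apply, Submodule.Quotient.mk_eq_zero]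
    obtain ⟨a, b, rfl⟩ := Ideal.mem_span_pair.1 hr
    refine ⟨b • t, ?_⟩
    have hxt : x • t = 0 := by
      obtain ⟨t, rfl⟩ := Submodule.mkQ_surjective _ t
      rw [← _root_.map_smul, Submodule.mkQ_apply, Submodule.Quotient.mk_eq_zero]
      exact Submodule.smul_mem_pointwise_smul _ _ _ trivial
    rw [add_smul, mul_smul, hxt, smul_zero, zero_add, LinearMap.smul_apply, LinearMap.id_apply, ← mul_smul, mul_comm]
end top

section F
variable {R : Type u} [CommRing R]

lemma complete_nakayama'' (m : Ideal R) [IsPrecomplete m R] {K Z : Type*} [AddCommGroup K] [Module R K]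
    [AddCommGroup Z] [Module R Z]
    (hsep : ∀ x : K, (∀ n : ℕ, x ∈ m ^ n • (⊤ : Submodule R K)) → x = 0)
    [IsNoetherian R Z] (f : K →ₗ[R] Z) (hf : LinearMap.ker f ≤ m • (⊤ : Submodule R K)) : Module.Finite R K := by
  apply complete_nakayama' m hsep
  have : Module.Finite R (K ⧸ LinearMap.ker f) := Module.Finite.equiv f.quotKerEquivRange.symm
  exact Module.Finite.of_surjective (Submodule.factor hf) (Submodule.factor_surjective hf)

lemma hom_sep (m : Ideal R) {X Y : Type*} [AddCommGroup X] [Module R X] [AddCommGroup Y] [Module R Y]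
    (hX : ∀ z : X, ∃ n : ℕ, ∀ r ∈ m ^ n, r • z = 0) (φ : X →ₗ[R] Y)
    (h : ∀ n : ℕ, φ ∈ m ^ n • (⊤ : Submodule R (X →ₗ[R] Y))) : φ = 0 := by
  ext z
  obtain ⟨n, hn⟩ := hX z
  have := h n
  clear h
  rw [LinearMap.zero_apply]
  induction this using Submodule.smul_induction_on' with
  | smul r hr ψ _ => rw [LinearMap.smul_apply, ← _root_.map_smul, hn r hr, _root_.map_zero]
  | add a _ b _ ha hb => rw [LinearMap.add_apply, ha, hb, add_zero]

lemma noetherian_of_pow [IsNoetherianRing R] [IsLocalRing R] {X : Type*} [AddCommGroup X] [Module R X]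
    [IsArtinian R X] (n : ℕ) (h : ∀ r ∈ maximalIdeal R ^ n, ∀ x : X, r • x = 0) : IsNoetherian R X := by
  obtain _ | n := n
  · have : Subsingleton X := ⟨fun a b => by
      rw [← one_smul R a, ← one_smul R b, h 1 (by simp), h 1 (by simp)]⟩
    infer_instance
  · set J := maximalIdeal R ^ (n+1) with hJ
    have hJm : J ≤ maximalIdeal R := Ideal.pow_le_self (by simp)
    have : Nontrivial (R ⧸ J) := Ideal.Quotient.nontrivial_iff.2 (fun h => (maximalIdeal.isMaximal R).ne_top (top_le_iff.1 (h ▸ hJm)))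
    have : IsLocalRing (R ⧸ J) := .of_surjective' _ Ideal.Quotient.mk_surjective
    have hmax : maximalIdeal (R ⧸ J) = (maximalIdeal R).map (Ideal.Quotient.mk J) :=
      (map_maximalIdeal_of_surjective _ Ideal.Quotient.mk_surjective).symm
    have : IsArtinianRing (R ⧸ J) := by
      rw [isArtinianRing_iff_isNilpotent_maximalIdeal, hmax]
      refine ⟨n+1, ?_⟩
      rw [← Ideal.map_pow, ← hJ]
      simp
    let := Module.IsTorsionBySet.module (R := R) (M := X) (I := J) (fun x r => h r.1 r.2 x)
    have : IsScalarTower R (R ⧸ J) X := Module.IsTorsionBySet.isScalarTower (fun x r => h r.1 r.2 x)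
    have : IsArtinian (R ⧸ J) X := isArtinian_of_tower R inferInstance
    have : IsNoetherian (R ⧸ J) X := IsSemiprimaryRing.isNoetherian_iff_isArtinian.2 this
    have : Module.Finite R X := Module.Finite.trans (R ⧸ J) X
    infer_instance

theorem LC.hom_finite [IsNoetherianRing R] [IsLocalRing R] [IsPrecomplete (maximalIdeal R) R]
    {W : Type u} [AddCommGroup W] [Module R W] [IsArtinian R W] :
    ∀ (j : ℕ) (N : Type u) [AddCommGroup N] [Module R N] [Module.Finite R N], supportDim R N ≤ j →
      Module.Finite R (LC (maximalIdeal R) j N →ₗ[R] W) := by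
  intro j
  induction j with
  | zero =>
    intro N _ _ _ _
    let H := LC (maximalIdeal R) 0 N
    have hinj := LC.ev_inj (N := N) (maximalIdeal R)
    have : Module.Finite R H := Module.Finite.of_injective _ hinj
    obtain ⟨n, hn⟩ := gam_fg (gam (maximalIdeal R) N) (IsNoetherian.noetherian _) le_rfl
    have hkill : ∀ r ∈ maximalIdeal R ^ n, ∀ x : H, r • x = 0 := by
      intro r hr x
      apply hinj
      rw [_root_.map_smul, _root_.map_zero]
      exact hn r hr _ ((LC.mem_range_ev _ _).1 ⟨x, rfl⟩)
    obtain ⟨k, f, hf⟩ := Module.Finite.exists_fin' R H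
    let W0 : Submodule R W := Submodule.torsionBySet R W (maximalIdeal R ^ n : Ideal R)
    have hW0 : ∀ w, w ∈ W0 ↔ ∀ r ∈ maximalIdeal R ^ n, r • w = 0 := by
      intro w
      rw [Submodule.mem_torsionBySet_iff]
      exact ⟨fun h r hr => h ⟨r, hr⟩, fun h r => h r.1 r.2⟩
    have : IsNoetherian R W0 := noetherian_of_pow n (fun r hr w => Subtype.ext ((hW0 w.1).1 w.2 r hr))
    let F : (H →ₗ[R] W) →ₗ[R] (Fin k → W0) :=
      { toFun := fun φ i => ⟨φ (f (Pi.single i 1)), (hW0 _).2 (fun r hr => by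
          rw [← _root_.map_smul, hkill r hr, _root_.map_zero])⟩
        map_add' := fun _ _ => rfl
        map_smul' := fun _ _ => rfl }
    refine Module.Finite.of_injective F ?_
    rw [injective_iff_map_eq_zero]
    intro φ hφ
    have h1 : φ.comp f = 0 := by
      ext i
      have := congrArg Subtype.val (congrFun hφ i)
      simpa [F] using this
    ext z
    obtain ⟨c, rfl⟩ := hf z
    exact LinearMap.congr_fun h1 c
  | succ j ih =>
    intro N _ _ _ hN
    let m := maximalIdeal R
    let N' := N ⧸ gam m N
    have hN' : supportDim R N' ≤ (j + 1 : ℕ) :=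
      (supportDim_le_of_surjective _ (Submodule.mkQ_surjective (gam (maximalIdeal R) N))).trans hN
    obtain ⟨r, hr, hreg⟩ := exists_regular (gam_quot m N)
    obtain ⟨_, δ, h1, h2⟩ := LC.les_reg m hreg j
    have h3 : supportDim R (QuotSMulTop r N') ≤ j := by
      have := supportDim_quotSMulTop_succ_eq_supportDim hreg hr
      rw [← this] at hN'
      generalize supportDim R (QuotSMulTop r N') = a at hN'
      induction a using WithBot.recBotCoe with
      | bot => exact bot_le
      | coe a =>
        have h2 : a + 1 ≤ ((j + 1 : ℕ) : ℕ∞) := by exact_mod_cast hN'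
        have : a ≤ (j : ℕ∞) := by
          rw [Nat.cast_add, Nat.cast_one] at h2
          exact (ENat.add_le_add_iff_right (by simp)).1 h2
        exact_mod_cast this
    have := ih (QuotSMulTop r N') h3
    let H := LC m (j+1) N'
    have hK : Module.Finite R (H →ₗ[R] W) := by
      refine complete_nakayama'' m (hom_sep m LC.torsion) (LinearMap.lcomp R W δ) ?_
      intro φ hφ
      have hφ' : ∀ z : H, r • z = 0 → φ z = 0 := by
        intro z hz
        obtain ⟨w, rfl⟩ := (h2 z).1 hz
        exact LinearMap.congr_fun (LinearMap.mem_ker.1 hφ) w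
      let μ : H →ₗ[R] H := r • LinearMap.id
      have hμ : Function.Surjective μ := fun z => by
        obtain ⟨w, hw⟩ := LC.smul_surj (j+1) hN' hr hreg z
        exact ⟨w, hw.symm⟩
      let e := μ.quotKerEquivOfSurjective hμ
      let ψ : H →ₗ[R] W := ((LinearMap.ker μ).liftQ φ (fun z hz => hφ' z hz)).comp e.symm.toLinearMap
      have hψ : φ = r • ψ := by
        ext z
        rw [LinearMap.smul_apply, ← _root_.map_smul]
        have : e.symm (r • z) = Submodule.Quotient.mk z := by
          rw [LinearEquiv.symm_apply_eq]
          rfl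
        change _ = ((LinearMap.ker μ).liftQ φ (fun z hz => hφ' z hz)) (e.symm (r • z))
        rw [this]
        rfl
      rw [hψ]
      exact Submodule.smul_mem_smul hr trivial
    let E := LinearEquiv.ofBijective _ (LC.mod_gam m j N)
    exact Module.Finite.equiv (LinearEquiv.congrLeft W R E.symm)
end F
end FileJ

section FileK
open CategoryTheory Limits Opposite IsLocalRing Module
open scoped Pointwise

set_option linter.unusedSectionVars false

lemma exists_div_hom {R : Type*} [CommRing R] {H W : Type*} [AddCommGroup H] [Module R H] [AddCommGroup W] [Module R W]
    (r : R) (hsurj : ∀ z : H, ∃ w, z = r • w) (φ : H →ₗ[R] W) (hφ : ∀ z, r • z = 0 → φ z = 0) :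
    ∃ ψ : H →ₗ[R] W, φ = r • ψ := by
  let μ : H →ₗ[R] H := r • LinearMap.id
  have hμ : Function.Surjective μ := fun z => by
    obtain ⟨w, hw⟩ := hsurj z
    exact ⟨w, hw.symm⟩
  let e := μ.quotKerEquivOfSurjective hμ
  let ψ : H →ₗ[R] W := ((LinearMap.ker μ).liftQ φ (fun z hz => hφ z hz)).comp e.symm.toLinearMap
  refine ⟨ψ, ?_⟩
  ext z
  rw [LinearMap.smul_apply, ← _root_.map_smul]
  have : e.symm (r • z) = Submodule.Quotient.mk z := by
    rw [LinearEquiv.symm_apply_eq]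
    rfl
  change _ = ((LinearMap.ker μ).liftQ φ (fun z hz => hφ z hz)) (e.symm (r • z))
  rw [this]
  rfl

lemma integral_div {R A : Type*} [CommRing R] [Ring A] [Algebra R A] (e : A) (he : IsIntegral R e) (x a : R)
    (hxe : x • e = algebraMap R A a) : ∃ (n : ℕ) (c : R), 0 < n ∧ algebraMap R A (a ^ n - x * c) = 0 := by
  obtain ⟨p, hp, hpe⟩ := he
  have hpe' : Polynomial.aeval e p = 0 := hpe
  rw [Polynomial.aeval_eq_sum_range] at hpe'
  have h1 : ∀ i ≤ p.natDegree, x ^ p.natDegree • (p.coeff i • e ^ i) =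
      algebraMap R A (p.coeff i * x ^ (p.natDegree - i) * a ^ i) := by
    intro i hi
    obtain ⟨k, hk⟩ := Nat.exists_eq_add_of_le hi
    have h2 : x ^ i • e ^ i = algebraMap R A (a ^ i) := by
      rw [← smul_pow, hxe, map_pow]
    rw [hk, Nat.add_sub_cancel_left, map_mul, ← h2, ← Algebra.smul_def, smul_smul, smul_smul]
    congr 1
    ring
  have h2 : algebraMap R A (∑ i ∈ Finset.range (p.natDegree + 1), p.coeff i * x ^ (p.natDegree - i) * a ^ i) = 0 := by
    have := congrArg (x ^ p.natDegree • ·) hpe'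
    simp only [smul_zero, Finset.smul_sum] at this
    rw [map_sum, ← this]
    exact Finset.sum_congr rfl fun i hi => (h1 i (Nat.lt_succ_iff.1 (Finset.mem_range.1 hi))).symm
  rw [Finset.sum_range_succ, Nat.sub_self, pow_zero, hp.coeff_natDegree] at h2
  have h3 : x ∣ ∑ i ∈ Finset.range p.natDegree, p.coeff i * x ^ (p.natDegree - i) * a ^ i := by
    refine Finset.dvd_sum fun i hi => ?_
    have := Finset.mem_range.1 hi
    exact Dvd.dvd.mul_right (Dvd.dvd.mul_left (dvd_pow_self x (by omega)) _) _
  obtain ⟨c, hc⟩ := h3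
  refine ⟨p.natDegree + 1, - c * a, Nat.succ_pos _, ?_⟩
  rw [hc] at h2
  rw [show a ^ (p.natDegree + 1) - x * (-c * a) = (x * c + 1 * 1 * a ^ p.natDegree) * a by ring, map_mul, h2, zero_mul]

section lemE
variable {R : Type u} [CommRing R] [IsNoetherianRing R] [IsLocalRing R] [IsDomain R]
  [IsPrecomplete (maximalIdeal R) R]

theorem lemE (e : ℕ) (hd : ringKrullDim R = (e + 1 : ℕ)) (x y a b : R) (hx : x ≠ 0) (hxm : x ∈ maximalIdeal R)
    (hdim : ringKrullDim (R ⧸ Ideal.span {x, y}) < e) (h : x * b = y * a) : ∃ n : ℕ, 0 < n ∧ x ∣ a ^ n := by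
  let G := LC (maximalIdeal R) (e+1) R
  have hfin : Module.Finite R (Module.End R G) := by
    have := LC.artinian (R := R) (e+1) R
    exact LC.hom_finite (e+1) R (by rw [supportDim_self_eq_ringKrullDim, hd])
  obtain ⟨ψ, hψ⟩ := exists_div_hom (H := G) (W := G) x (LC.dom_div _ hd x hx) (a • LinearMap.id) (by
    intro z hz
    obtain ⟨w, hw, rfl⟩ := LC.dom_div2 e hd x y hx hxm hdim z hz
    rw [LinearMap.smul_apply, LinearMap.id_apply, ← mul_smul, mul_comm, ← h, mul_comm, mul_smul, hw, smul_zero])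
  obtain ⟨n, c, hn, hc⟩ := integral_div (A := Module.End R G) ψ (IsIntegral.of_finite R ψ) x a (by
    rw [← hψ]; rfl)
  refine ⟨n, hn, c, sub_eq_zero.1 (LC.dom_faithful _ hd _ fun z => ?_)⟩
  exact LinearMap.congr_fun hc z
end lemE
end FileK

section FileL
open CategoryTheory Limits Opposite IsLocalRing Module
open scoped Pointwise

set_option linter.unusedSectionVars false

section dims
variable {R : Type*} [CommRing R]

lemma dim_mono {J J' : Ideal R} (h : J ≤ J') : ringKrullDim (R ⧸ J') ≤ ringKrullDim (R ⧸ J) :=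
  ringKrullDim_le_of_surjective (Ideal.Quotient.factor h) (Ideal.Quotient.factor_surjective h)

lemma dim_prime {J : Ideal R} {n : ℕ} (h : (n : WithBot ℕ∞) ≤ ringKrullDim (R ⧸ J)) :
    ∃ Q : Ideal R, Q.IsPrime ∧ J ≤ Q ∧ (n : WithBot ℕ∞) ≤ ringKrullDim (R ⧸ Q) := by
  rw [← supportDim_quotient'] at h
  obtain ⟨Q, h1, h2, h3⟩ := exists_prime_of_le_supportDim n h
  rw [Ideal.annihilator_quotient] at h2
  exact ⟨Q, h1, h2, h3⟩

lemma dim_strict {P Q : Ideal R} [P.IsPrime] (h : P < Q) {n : ℕ} (hn : (n : WithBot ℕ∞) ≤ ringKrullDim (R ⧸ Q)) :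
    ((n + 1 : ℕ) : WithBot ℕ∞) ≤ ringKrullDim (R ⧸ P) := by
  obtain ⟨r, hrQ, hrP⟩ := Set.exists_of_ssubset h
  have h1 := ringKrullDim_succ_le_of_surjective (Ideal.Quotient.factor h.le) (Ideal.Quotient.factor_surjective h.le)
    (r := Ideal.Quotient.mk P r) (mem_nonZeroDivisors_of_ne_zero (fun h => hrP (Ideal.Quotient.eq_zero_iff_mem.1 h)))
    (by rw [Ideal.Quotient.factor_mk]; exact Ideal.Quotient.eq_zero_iff_mem.2 hrQ)
  refine le_trans ?_ h1
  rw [Nat.cast_add, Nat.cast_one]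
  gcongr

lemma dim_span_lt [IsDomain R] [IsNoetherianRing R] {e : ℕ} (hd : ringKrullDim R = (e + 1 : ℕ)) {x : R} (hx : x ≠ 0) :
    ringKrullDim (R ⧸ Ideal.span {x}) < (e + 1 : ℕ) := by
  by_contra! hc
  obtain ⟨Q, hQ, hxQ, hQd⟩ := dim_prime hc
  have : (⊥ : Ideal R) < Q := by
    refine lt_of_le_of_ne bot_le fun h => hx ?_
    have := hxQ (Ideal.mem_span_singleton_self x)
    rwa [← h] at this
  have h2 := dim_strict this hQd
  rw [ringKrullDim_eq_of_ringEquiv (RingEquiv.quotientBot R), hd] at h2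
  exact absurd h2 (by rw [Nat.cast_le]; omega)

lemma min_prime_clear [IsNoetherianRing R] {J P : Ideal R} (hP : P ∈ J.minimalPrimes) :
    ∃ s ∉ P, ∃ n : ℕ, ∀ w ∈ P ^ n, s * w ∈ J := by
  have hPp : P.IsPrime := hP.1.1
  have hfin := (J.finite_minimalPrimes_of_isNoetherianRing R).subset (Set.sdiff_subset (t := {P}))
  let K : Ideal R := hfin.toFinset.inf id
  have hK : ¬ K ≤ P := by
    intro hle
    obtain ⟨Q, hQ, hQP⟩ := (Ideal.IsPrime.inf_le' hPp).1 hle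
    obtain ⟨h1, h2⟩ := hfin.mem_toFinset.1 hQ
    exact h2 (le_antisymm hQP (hP.2 h1.1 hQP))
  obtain ⟨s, hsK, hsP⟩ := Set.not_subset.1 hK
  have hle : Ideal.span {s} * P ≤ J.radical := by
    rw [← Ideal.sInf_minimalPrimes]
    refine le_sInf fun Q hQ => ?_
    by_cases hQP : Q = P
    · rw [hQP]; exact Ideal.mul_le_inf.trans inf_le_right
    · refine (Ideal.mul_le_inf.trans inf_le_left).trans ?_
      rw [Ideal.span_singleton_le_iff_mem]
      exact (Finset.inf_le (f := id) (hfin.mem_toFinset.2 ⟨hQ, hQP⟩) : K ≤ Q) hsK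
  obtain ⟨n, hn⟩ := Ideal.exists_pow_le_of_le_radical_of_fg hle (IsNoetherian.noetherian _)
  refine ⟨s ^ n, fun h => hsP (hPp.mem_of_pow_mem n h), n, fun w hw => hn ?_⟩
  rw [mul_pow]
  exact Ideal.mul_mem_mul (Ideal.pow_mem_pow (Ideal.mem_span_singleton_self s) n) hw

end dims

theorem cat_lemma {R : Type u} [CommRing R] [IsNoetherianRing R] [IsLocalRing R] [IsDomain R]
    [IsPrecomplete (maximalIdeal R) R] (e : ℕ) (hd : ringKrullDim R = (e + 1 : ℕ)) (P : Ideal R) [hP : P.IsPrime]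
    (hP0 : P ≠ ⊥) (hP1 : ∀ Q : Ideal R, Q.IsPrime → Q < P → Q = ⊥) : (e : WithBot ℕ∞) ≤ ringKrullDim (R ⧸ P) := by
  by_contra! hc
  obtain ⟨x, hxP, hx0⟩ := Submodule.exists_mem_ne_zero_of_ne_bot hP0
  have hPmin : P ∈ (Ideal.span {x}).minimalPrimes := by
    have hle : Ideal.span {x} ≤ P := (Ideal.span_singleton_le_iff_mem P).2 hxP
    refine ⟨⟨hP, hle⟩, fun Q hQ hQP => ?_⟩
    by_contra hne
    have hlt : Q < P := lt_of_le_not_ge hQP hne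
    have := hQ.2 (Ideal.mem_span_singleton_self x)
    rw [hP1 Q hQ.1 hlt] at this
    exact hx0 this
  let S : Set (Ideal R) := {Q ∈ (Ideal.span {x}).minimalPrimes | (e : WithBot ℕ∞) ≤ ringKrullDim (R ⧸ Q)}
  obtain ⟨y, hyP, hyS⟩ := prime_avoid P S (((Ideal.span {x}).finite_minimalPrimes_of_isNoetherianRing R).subset (Set.sep_subset _ _))
    (fun Q hQ => hQ.1.1.1) (fun Q hQ hle => absurd (hQ.2.trans (dim_mono hle)) (not_le.2 hc))
  obtain ⟨s, hsP, n, hs⟩ := min_prime_clear hPmin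
  have hs1 : s * y ^ (n + 1) ∈ Ideal.span {x} := by
    rw [pow_succ, ← mul_assoc]
    exact Ideal.mul_mem_right _ _ (hs _ (Ideal.pow_mem_pow hyP n))
  obtain ⟨b, hb⟩ := Ideal.mem_span_singleton.1 hs1
  have hdim : ringKrullDim (R ⧸ Ideal.span {x, y ^ (n+1)}) < e := by
    by_contra! hcc
    obtain ⟨Q', hQ', hle, hQd⟩ := dim_prime hcc
    have hxQ : x ∈ Q' := hle (Ideal.subset_span (by simp))
    have hyQ : y ∈ Q' := hQ'.mem_of_pow_mem _ (hle (Ideal.subset_span (by simp : y ^ (n+1) ∈ _)))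
    obtain ⟨Q, hQ, hQQ⟩ := Ideal.exists_minimalPrimes_le ((Ideal.span_singleton_le_iff_mem Q').2 hxQ)
    have : Q.IsPrime := hQ.1.1
    have hQe := hQd.trans (dim_mono hQQ)
    have hyQ1 : y ∉ Q := hyS Q ⟨hQ, hQe⟩
    have hlt : Q < Q' := lt_of_le_of_ne hQQ (fun h => hyQ1 (h ▸ hyQ))
    have h1 := (dim_strict hlt hQd).trans (dim_mono hQ.1.2)
    exact absurd h1 (not_le.2 (dim_span_lt hd hx0))
  obtain ⟨N, hN, hdvd⟩ := lemE e hd x (y ^ (n+1)) s b hx0 (le_maximalIdeal hP.ne_top hxP) hdim (by rw [← hb, mul_comm])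
  exact hsP (hP.mem_of_pow_mem N (P.mem_of_dvd hdvd hxP))
end FileL

section FileM
open CategoryTheory Limits Opposite IsLocalRing Module
open scoped Pointwise

set_option linter.unusedSectionVars false

section dims2
variable {R : Type*} [CommRing R] [IsNoetherianRing R] [IsLocalRing R]

lemma wb_le_of_lt {a : WithBot ℕ∞} {n : ℕ} (h : a < n) : a + 1 < (n + 1 : ℕ) := by
  induction a using WithBot.recBotCoe with
  | bot => exact WithBot.bot_lt_coe _
  | coe a =>
    have h2 : a < (n : ℕ∞) := by exact_mod_cast h
    have : a + 1 < ((n + 1 : ℕ) : ℕ∞) := by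
      rw [Nat.cast_add, Nat.cast_one]
      exact ENat.add_lt_add_of_lt_of_le (by simp) h2 le_rfl
    exact_mod_cast this

lemma dim_drop {J : Ideal R} {a : R} (ha : a ∈ maximalIdeal R) {n : ℕ}
    (h : ringKrullDim (R ⧸ (J ⊔ Ideal.span {a})) < n) : ringKrullDim (R ⧸ J) < (n + 1 : ℕ) := by
  rw [← supportDim_quotient']
  refine (supportDim_le_supportDim_quotSMulTop_succ ha).trans_lt (wb_le_of_lt ?_)
  refine (supportDim_le_of_ann (J ⊔ Ideal.span {a}) ?_).trans_lt h
  intro r hr t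
  obtain ⟨t, rfl⟩ := Submodule.mkQ_surjective _ t
  obtain ⟨t, rfl⟩ := Ideal.Quotient.mk_surjective t
  rw [← _root_.map_smul, Submodule.mkQ_apply, Submodule.Quotient.mk_eq_zero]
  obtain ⟨j, hj, b, hb, rfl⟩ := Submodule.mem_sup.1 hr
  obtain ⟨c, rfl⟩ := Ideal.mem_span_singleton.1 hb
  have hj0 : j • (Ideal.Quotient.mk J t) = 0 := by
    rw [Algebra.smul_def, show algebraMap R (R ⧸ J) j = 0 from Ideal.Quotient.eq_zero_iff_mem.2 hj, zero_mul]
  rw [add_smul, hj0, zero_add, mul_smul]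
  exact Submodule.smul_mem_pointwise_smul _ _ _ trivial

lemma dim_max (Q : Ideal R) (hQ : Q = maximalIdeal R) : ringKrullDim (R ⧸ Q) < (1 : ℕ) := by
  have : Q.IsMaximal := hQ ▸ maximalIdeal.isMaximal R
  let := Ideal.Quotient.field Q
  rw [ringKrullDim_eq_zero_of_field]
  exact_mod_cast Nat.zero_lt_one

lemma dim_zero {J : Ideal R} (h : ∀ Q : Ideal R, Q.IsPrime → J ≤ Q → Q = maximalIdeal R) :
    ringKrullDim (R ⧸ J) < (1 : ℕ) := by
  by_contra! hc
  obtain ⟨Q, hQ, hJQ, hQd⟩ := dim_prime hc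
  exact absurd hQd (not_le.2 (dim_max Q (h Q hQ hJQ)))

lemma eq_max_of_dim {Q : Ideal R} (hQ : Q.IsPrime) (h : ringKrullDim (R ⧸ Q) < (1 : ℕ)) : Q = maximalIdeal R := by
  by_contra hne
  have hlt : Q < maximalIdeal R := lt_of_le_of_ne (le_maximalIdeal hQ.ne_top) hne
  refine absurd h (not_lt.2 ?_)
  rw [Nat.cast_one, ringKrullDim_quotient, Order.one_le_krullDim_iff]
  exact ⟨⟨⟨Q, hQ⟩, le_refl Q⟩, ⟨⟨maximalIdeal R, inferInstance⟩, hlt.le⟩, hlt⟩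

lemma avoid_step (I J : Ideal R) (n : ℕ) (hJ : ringKrullDim (R ⧸ J) < (n + 1 : ℕ))
    (h : ∀ Q ∈ J.minimalPrimes, (n : WithBot ℕ∞) ≤ ringKrullDim (R ⧸ Q) → ¬ I ≤ Q) :
    ∃ u ∈ I, ringKrullDim (R ⧸ (J ⊔ Ideal.span {u})) < n := by
  let S : Set (Ideal R) := {Q ∈ J.minimalPrimes | (n : WithBot ℕ∞) ≤ ringKrullDim (R ⧸ Q)}
  obtain ⟨y, hyI, hyS⟩ := prime_avoid I S ((J.finite_minimalPrimes_of_isNoetherianRing R).subset (Set.sep_subset _ _))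
    (fun Q hQ => hQ.1.1.1) (fun Q hQ => h Q hQ.1 hQ.2)
  refine ⟨y, hyI, ?_⟩
  by_contra! hcc
  obtain ⟨Q', hQ', hle, hQd⟩ := dim_prime hcc
  have hyQ : y ∈ Q' := hle (Ideal.mem_sup_right (Ideal.mem_span_singleton_self y))
  obtain ⟨Q, hQ, hQQ⟩ := Ideal.exists_minimalPrimes_le (le_sup_left.trans hle)
  have : Q.IsPrime := hQ.1.1
  have hQe := hQd.trans (dim_mono hQQ)
  have hyQ1 : y ∉ Q := hyS Q ⟨hQ, hQe⟩
  have hlt : Q < Q' := lt_of_le_of_ne hQQ (fun h => hyQ1 (h ▸ hyQ))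
  have h1 := (dim_strict hlt hQd).trans (dim_mono hQ.1.2)
  exact absurd h1 (not_le.2 hJ)

end dims2

lemma precomplete_quot {R : Type*} [CommRing R] (m P : Ideal R) [IsPrecomplete m R] :
    IsPrecomplete (m.map (Ideal.Quotient.mk P)) (R ⧸ P) := by
  constructor
  intro f hf
  have hstep : ∀ n, ∃ c ∈ m ^ n, Ideal.Quotient.mk P c = f (n+1) - f n := by
    intro n
    have h1 := (SModEq.sub_mem.1 (hf (Nat.le_succ n)).symm)
    rw [smul_eq_mul, Ideal.mul_top, ← Ideal.map_pow] at h1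
    exact (Ideal.mem_map_iff_of_surjective _ Ideal.Quotient.mk_surjective).1 h1
  choose c hc hcf using hstep
  obtain ⟨g0, hg0⟩ := Ideal.Quotient.mk_surjective (f 0)
  let g : ℕ → R := fun n => g0 + ∑ i ∈ Finset.range n, c i
  have hgf : ∀ n, Ideal.Quotient.mk P (g n) = f n := by
    intro n
    induction n with
    | zero => simp [g, hg0]
    | succ n ih =>
      have : g (n+1) = g n + c n := by simp only [g, Finset.sum_range_succ, add_assoc]
      rw [this, map_add, ih, hcf]
      abel
  obtain ⟨L, hL⟩ := IsPrecomplete.prec ‹IsPrecomplete m R› (f := g) (by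
    intro a b hab
    rw [SModEq.comm, SModEq.sub_mem, smul_eq_mul, Ideal.mul_top]
    have : g b - g a = ∑ i ∈ Finset.Ico a b, c i := by
      simp only [g, Finset.sum_Ico_eq_sub _ hab]; ring
    rw [this]
    exact Ideal.sum_mem _ fun i hi => Ideal.pow_le_pow_right (Finset.mem_Ico.1 hi).1 (hc i))
  refine ⟨Ideal.Quotient.mk P L, fun n => ?_⟩
  have h1 := SModEq.sub_mem.1 (hL n)
  rw [smul_eq_mul, Ideal.mul_top] at h1
  rw [SModEq.sub_mem, smul_eq_mul, Ideal.mul_top, ← Ideal.map_pow, ← hgf, ← map_sub]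
  exact Ideal.mem_map_of_mem _ h1
end FileM

section FileN
open CategoryTheory Limits Opposite IsLocalRing Module
open scoped Pointwise

set_option linter.unusedSectionVars false

lemma dim_bot (R : Type*) [CommRing R] : ringKrullDim (R ⧸ (⊥ : Ideal R)) = ringKrullDim R :=
  ringKrullDim_eq_of_ringEquiv (RingEquiv.quotientBot R)

lemma wb_le_of_lt' {a : WithBot ℕ∞} {n : ℕ} (h : a < (n + 1 : ℕ)) : a ≤ n := by
  induction a using WithBot.recBotCoe with
  | bot => exact bot_le
  | coe a =>
    have h2 : a < ((n + 1 : ℕ) : ℕ∞) := by exact_mod_cast h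
    have : a ≤ (n : ℕ∞) := by
      rw [Nat.cast_add, Nat.cast_one] at h2
      exact Order.le_of_lt_add_one h2
    exact_mod_cast this

lemma clear_pow {A F : Type*} [CommRing A] [Field F] [Algebra A F] {x v : A} {T : F}
    (hT : algebraMap A F x * T = algebraMap A F v) (p : Polynomial A) :
    ∃ (k : ℕ) (b : A), algebraMap A F x ^ k * Polynomial.aeval T p = algebraMap A F b := by
  induction p using Polynomial.induction_on' with
  | add p q hp hq =>
    obtain ⟨k, b, h⟩ := hp
    obtain ⟨l, c, h'⟩ := hq
    refine ⟨k + l, x ^ l * b + x ^ k * c, ?_⟩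
    rw [_root_.map_add, _root_.map_add, map_mul, map_mul, ← h, ← h', map_pow, map_pow]
    ring
  | monomial n a =>
    refine ⟨n, a * v ^ n, ?_⟩
    rw [Polynomial.aeval_monomial, map_mul, map_pow, ← hT]
    ring

theorem exists_L {A : Type u} [CommRing A] [IsNoetherianRing A] [IsLocalRing A] [IsDomain A]
    (x y u v : A) (hx : x ∈ maximalIdeal A) (hy : y ∈ maximalIdeal A)
    (hrel : u * x = v * y)
    (hm : ∀ Q : Ideal A, Q.IsPrime → x ∈ Q → y ∈ Q → u ∈ Q → v ∈ Q → Q = maximalIdeal A)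
    (q : Ideal A) [hq : q.IsPrime] (hq0 : q ≠ ⊥) (huq : u ∈ q) (hvq : v ∈ q) (hxq : x ∉ q)
    (hdim : ((2 : ℕ) : WithBot ℕ∞) ≤ ringKrullDim (A ⧸ q)) :
    ∃ (L : Type u) (_ : CommRing L) (_ : IsNoetherianRing L) (_ : IsLocalRing L) (_ : IsDomain L)
      (f : A →+* L), Function.Injective f ∧ (∀ a ∈ maximalIdeal A, f a ∈ maximalIdeal L) ∧
      ringKrullDim L = (2 + 1 : ℕ) ∧ ringKrullDim (L ⧸ Ideal.span {f x, f y}) < (2 : ℕ) := by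
  let F := FractionRing A
  have hinjF : Function.Injective (algebraMap A F) := IsFractionRing.injective A F
  have hx0 : x ≠ 0 := fun h => hxq (h ▸ q.zero_mem)
  have hxF : algebraMap A F x ≠ 0 := fun h => hx0 (hinjF (by rw [h, _root_.map_zero]))
  let T : F := algebraMap A F v / algebraMap A F x
  have hT : algebraMap A F x * T = algebraMap A F v := mul_div_cancel₀ _ hxF
  have hTy : algebraMap A F y * T = algebraMap A F u := by
    refine mul_left_cancel₀ hxF ?_
    rw [mul_left_comm, hT, ← map_mul, ← map_mul, mul_comm y v, ← hrel, mul_comm]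
  let K : Ideal (Polynomial A) := RingHom.ker (Polynomial.aeval (R := A) T).toRingHom
  have hKmem : ∀ p, p ∈ K ↔ Polynomial.aeval T p = 0 := fun p => Iff.rfl
  have hKp : K.IsPrime := RingHom.ker_isPrime _
  have hK0 : ∀ p ∈ K, p.coeff 0 ∈ q := by
    intro p hp
    rw [hKmem] at hp
    obtain ⟨k, b, hb⟩ := clear_pow hT p.divX
    have h1 : Polynomial.aeval T p = Polynomial.aeval T p.divX * T + algebraMap A F (p.coeff 0) := by
      conv_lhs => rw [← Polynomial.divX_mul_X_add p]
      simp
    rw [hp] at h1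
    have h2 : algebraMap A F (b * v + x ^ (k+1) * p.coeff 0) = 0 := by
      rw [_root_.map_add, map_mul, map_mul, ← hb, ← hT, map_pow]
      linear_combination - (algebraMap A F x) ^ (k+1) * h1
    have h3 : b * v + x ^ (k+1) * p.coeff 0 = 0 := hinjF (by rw [h2, _root_.map_zero])
    have h4 : x ^ (k+1) * p.coeff 0 ∈ q := by
      rw [← Ideal.add_mem_iff_right q (q.mul_mem_left b hvq), h3]
      exact q.zero_mem
    exact (hq.mem_or_mem h4).resolve_left (fun h => hxq (hq.mem_of_pow_mem _ h))
  let C := Polynomial A ⧸ K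
  have : IsDomain C := Ideal.Quotient.isDomain K
  let φ : C →+* A ⧸ q := Ideal.Quotient.lift K ((Ideal.Quotient.mk q).comp Polynomial.constantCoeff)
    (fun p hp => Ideal.Quotient.eq_zero_iff_mem.2 (hK0 p hp))
  have hφ : ∀ p : Polynomial A, φ (Ideal.Quotient.mk K p) = Ideal.Quotient.mk q (p.coeff 0) := fun p => rfl
  have hφs : Function.Surjective φ := by
    intro a
    obtain ⟨a, rfl⟩ := Ideal.Quotient.mk_surjective a
    exact ⟨Ideal.Quotient.mk K (Polynomial.C a), by rw [hφ, Polynomial.coeff_C_zero]⟩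
  have : Nontrivial (A ⧸ q) := Ideal.Quotient.nontrivial_iff.2 hq.ne_top
  have : IsLocalRing (A ⧸ q) := IsLocalRing.of_surjective' _ Ideal.Quotient.mk_surjective
  let N : Ideal C := (maximalIdeal (A ⧸ q)).comap φ
  have hNp : N.IsPrime := Ideal.IsPrime.comap φ
  have hle : N.primeCompl ≤ nonZeroDivisors C := Ideal.primeCompl_le_nonZeroDivisors N
  obtain ⟨L, _, _, hloc⟩ : ∃ (L : Type u) (_ : CommRing L) (_ : Algebra C L), IsLocalization.AtPrime L N :=
    ⟨Localization.AtPrime N, inferInstance, inferInstance, inferInstance⟩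
  have hLl : IsLocalRing L := IsLocalization.AtPrime.isLocalRing L N
  have hLd : IsDomain L := IsLocalization.isDomain_of_le_nonZeroDivisors L hle
  have hLn : IsNoetherianRing L := IsLocalization.isNoetherianRing N.primeCompl L inferInstance
  have hCL : Function.Injective (algebraMap C L) := IsLocalization.injective L hle
  let ι : A →+* C := (Ideal.Quotient.mk K).comp Polynomial.C
  have hι : Function.Injective ι := by
    rw [injective_iff_map_eq_zero]
    intro a ha
    have := Ideal.Quotient.eq_zero_iff_mem.1 ha
    rw [hKmem, Polynomial.aeval_C] at this
    exact hinjF (by rw [this, _root_.map_zero])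
  let f : A →+* L := (algebraMap C L).comp ι
  have hf : Function.Injective f := hCL.comp hι
  have hmem : ∀ c : C, algebraMap C L c ∈ maximalIdeal L ↔ c ∈ N := fun c => by
    exact IsLocalization.AtPrime.to_map_mem_maximal_iff L N c
  have hfm : ∀ a ∈ maximalIdeal A, f a ∈ maximalIdeal L := by
    intro a ha
    refine (hmem _).2 ?_
    show φ (Ideal.Quotient.mk K (Polynomial.C a)) ∈ maximalIdeal (A ⧸ q)
    rw [hφ, Polynomial.coeff_C_zero, ← map_maximalIdeal_of_surjective _ Ideal.Quotient.mk_surjective]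
    exact Ideal.mem_map_of_mem _ ha
  let τ : C := Ideal.Quotient.mk K Polynomial.X
  have hτx : ι x * τ = ι v := by
    refine Ideal.Quotient.eq.2 ?_
    rw [hKmem]
    simp [hT]
  have hτy : ι y * τ = ι u := by
    refine Ideal.Quotient.eq.2 ?_
    rw [hKmem]
    simp [hTy]
  have hdec : ∀ c : C, ∃ (a : A) (d : C), c = ι a + d * τ ∧ φ c = Ideal.Quotient.mk q a := by
    intro c
    obtain ⟨p, rfl⟩ := Ideal.Quotient.mk_surjective c
    refine ⟨p.coeff 0, Ideal.Quotient.mk K p.divX, ?_, hφ p⟩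
    show _ = Ideal.Quotient.mk K (Polynomial.C _) + _ * Ideal.Quotient.mk K Polynomial.X
    rw [← map_mul, ← _root_.map_add, add_comm, Polynomial.divX_mul_X_add]
  have hτm : algebraMap C L τ ∈ maximalIdeal L := by
    refine (hmem _).2 ?_
    show φ (Ideal.Quotient.mk K Polynomial.X) ∈ maximalIdeal (A ⧸ q)
    rw [hφ, Polynomial.coeff_X_zero, _root_.map_zero]
    exact Ideal.zero_mem _
  let ψ : L →+* A ⧸ q := IsLocalization.lift (M := N.primeCompl) (g := φ) (fun s => by
    by_contra h
    exact s.2 ((mem_maximalIdeal _).2 h))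
  have hψ : ∀ c, ψ (algebraMap C L c) = φ c := fun c => IsLocalization.lift_eq _ c
  have hψs : Function.Surjective ψ := fun a => by
    obtain ⟨c, rfl⟩ := hφs a
    exact ⟨_, hψ c⟩
  have hge : ((2 + 1 : ℕ) : WithBot ℕ∞) ≤ ringKrullDim L := by
    obtain ⟨w, hw, hw0⟩ := Submodule.exists_mem_ne_zero_of_ne_bot hq0
    have h1 := ringKrullDim_succ_le_of_surjective ψ hψs
      (r := f w) (mem_nonZeroDivisors_of_ne_zero (fun h => hw0 (hf (by rw [h, _root_.map_zero])))) (by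
        show ψ (algebraMap C L (ι w)) = 0
        rw [hψ]
        show φ (Ideal.Quotient.mk K (Polynomial.C w)) = 0
        rw [hφ, Polynomial.coeff_C_zero]
        exact Ideal.Quotient.eq_zero_iff_mem.2 hw)
    refine le_trans ?_ h1
    rw [Nat.cast_add, Nat.cast_one]
    gcongr
  have hd1 : ringKrullDim (L ⧸ (Ideal.span {f x, f y} ⊔ Ideal.span {algebraMap C L τ})) < (1 : ℕ) := by
    refine dim_zero fun Q hQ hJ => ?_
    have hxQ : f x ∈ Q := hJ (Ideal.mem_sup_left (Ideal.subset_span (by simp)))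
    have hyQ : f y ∈ Q := hJ (Ideal.mem_sup_left (Ideal.subset_span (by simp)))
    have hτQ : algebraMap C L τ ∈ Q := hJ (Ideal.mem_sup_right (Ideal.subset_span (by simp)))
    have hQA : Q.comap f = maximalIdeal A := by
      refine hm _ (Ideal.IsPrime.comap f) hxQ hyQ ?_ ?_
      · show algebraMap C L (ι u) ∈ Q
        rw [← hτy, map_mul]
        exact Q.mul_mem_left _ hτQ
      · show algebraMap C L (ι v) ∈ Q
        rw [← hτx, map_mul]
        exact Q.mul_mem_left _ hτQ
    refine le_antisymm (le_maximalIdeal hQ.ne_top) fun z hz => ?_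
    obtain ⟨⟨c, s⟩, hcs⟩ := IsLocalization.surj N.primeCompl z
    have hc : c ∈ N := by
      rw [← hmem]
      rw [← hcs]
      exact Ideal.mul_mem_right _ _ hz
    have hcQ : algebraMap C L c ∈ Q := by
      obtain ⟨a, d, h1, h2⟩ := hdec c
      have ha : a ∈ maximalIdeal A := by
        have h3 : φ c ∈ maximalIdeal (A ⧸ q) := hc
        rw [h2] at h3
        rw [mem_maximalIdeal] at h3 ⊢
        exact fun h => h3 (h.map _)
      rw [h1, _root_.map_add, map_mul]
      refine Q.add_mem ?_ (Q.mul_mem_left _ hτQ)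
      rw [← hQA] at ha
      exact ha
    rw [← hcs] at hcQ
    refine (hQ.mem_or_mem hcQ).resolve_right fun h => hQ.ne_top ?_
    exact Ideal.eq_top_of_isUnit_mem _ h (IsLocalization.map_units L s)
  have hd2 := dim_drop hτm hd1
  have hd3 : ringKrullDim L < (3 + 1 : ℕ) := by
    rw [← dim_bot L]
    refine dim_drop (hfm x hx) ?_
    rw [bot_sup_eq]
    refine dim_drop (hfm y hy) ?_
    rwa [← Ideal.span_union, ← Set.insert_eq]
  refine ⟨L, inferInstance, hLn, hLl, hLd, f, hf, hfm, le_antisymm ?_ hge, hd2⟩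
  exact wb_le_of_lt' hd3
end FileN

section FileO
open CategoryTheory Limits Opposite IsLocalRing Module
open scoped Pointwise

set_option linter.unusedSectionVars false

lemma dim_pair {R : Type*} [CommRing R] [IsNoetherianRing R] [IsLocalRing R] {a b : R}
    (ha : a ∈ maximalIdeal R) (hb : b ∈ maximalIdeal R) {n : ℕ}
    (h : ringKrullDim (R ⧸ Ideal.span {a, b}) < n) : ringKrullDim R < (n + 1 + 1 : ℕ) := by
  rw [← dim_bot R]
  refine dim_drop ha ?_
  rw [bot_sup_eq]
  refine dim_drop hb ?_
  rwa [← Ideal.span_union, ← Set.insert_eq]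

theorem exists_q {A : Type u} [CommRing A] [IsNoetherianRing A] [IsLocalRing A] [IsDomain A]
    [IsPrecomplete (maximalIdeal A) A] (hdA : ringKrullDim A = (2 + 1 : ℕ))
    (x y u v : A) (hx : x ∈ maximalIdeal A) (hy : y ∈ maximalIdeal A)
    (hu : u ∈ maximalIdeal A) (hv : v ∈ maximalIdeal A)
    (hrel : u * x = v * y)
    (hm : ∀ Q : Ideal A, Q.IsPrime → x ∈ Q → y ∈ Q → u ∈ Q → v ∈ Q → Q = maximalIdeal A) :
    ∃ q : Ideal A, q.IsPrime ∧ q ≠ ⊥ ∧ u ∈ q ∧ v ∈ q ∧ (x ∉ q ∨ y ∉ q) ∧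
      ((2 : ℕ) : WithBot ℕ∞) ≤ ringKrullDim (A ⧸ q) := by
  have hdlt : ∀ n : ℕ, n ≤ 3 → ¬ ringKrullDim A < n := by
    intro n hn
    rw [hdA, not_lt]
    exact_mod_cast hn
  by_cases hc : ringKrullDim (A ⧸ Ideal.span {u, v}) < (2 : ℕ)
  · exfalso
    have hu0 : u ≠ 0 := by
      rintro rfl
      have : ringKrullDim A < (2 + 1 : ℕ) := by
        rw [← dim_bot A]
        refine dim_drop hv ?_
        rw [bot_sup_eq]
        rwa [Ideal.span_insert_zero] at hc
      exact hdlt 3 le_rfl this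
    have hv0 : v ≠ 0 := by
      rintro rfl
      have : ringKrullDim A < (2 + 1 : ℕ) := by
        rw [← dim_bot A]
        refine dim_drop hu ?_
        rw [bot_sup_eq]
        rwa [Set.pair_comm, Ideal.span_insert_zero] at hc
      exact hdlt 3 le_rfl this
    obtain ⟨n, -, h1⟩ := lemE 2 hdA u v y x hu0 hu hc hrel
    obtain ⟨k, -, h2⟩ := lemE 2 hdA v u x y hv0 hv (by rwa [Set.pair_comm]) hrel.symm
    have : ringKrullDim (A ⧸ Ideal.span {u, v}) < (1 : ℕ) := by
      refine dim_zero fun Q hQ hJ => ?_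
      have huQ : u ∈ Q := hJ (Ideal.subset_span (by simp))
      have hvQ : v ∈ Q := hJ (Ideal.subset_span (by simp))
      exact hm Q hQ (hQ.mem_of_pow_mem k (Q.mem_of_dvd h2 hvQ))
        (hQ.mem_of_pow_mem n (Q.mem_of_dvd h1 huQ)) huQ hvQ
    exact hdlt 3 le_rfl (dim_pair hu hv this)
  · obtain ⟨q, hq, hJ, hqd⟩ := dim_prime (not_lt.1 hc)
    have huQ : u ∈ q := hJ (Ideal.subset_span (by simp))
    have hvQ : v ∈ q := hJ (Ideal.subset_span (by simp))
    refine ⟨q, hq, ?_, huQ, hvQ, ?_, hqd⟩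
    · rintro rfl
      have : ringKrullDim (A ⧸ Ideal.span {x, y}) < (1 : ℕ) := by
        refine dim_zero fun Q hQ hJ => ?_
        exact hm Q hQ (hJ (Ideal.subset_span (by simp))) (hJ (Ideal.subset_span (by simp)))
          (bot_le (a := Q) huQ) (bot_le (a := Q) hvQ)
      exact hdlt 3 le_rfl (dim_pair hx hy this)
    · by_contra! h
      have := hm q hq h.1 h.2 huQ hvQ
      refine absurd hqd (not_le.2 ((dim_max q this).trans_le ?_))
      exact_mod_cast Nat.le_succ 1

/-- The package: a module `G` over `A` with good properties. -/
theorem exists_G_of_L {A : Type u} [CommRing A] [IsLocalRing A] (x y : A)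
    (L : Type u) [CommRing L] [IsNoetherianRing L] [IsLocalRing L] [IsDomain L]
    (f : A →+* L) (hf : Function.Injective f) (hfm : ∀ a ∈ maximalIdeal A, f a ∈ maximalIdeal L)
    (hd : ringKrullDim L = (2 + 1 : ℕ)) (hxy : ringKrullDim (L ⧸ Ideal.span {f x, f y}) < (2 : ℕ))
    (hx0 : x ≠ 0) (hx : x ∈ maximalIdeal A) :
    ∃ (G : Type u) (_ : AddCommGroup G) (_ : Module A G),
      (∀ g : G, ∃ n : ℕ, ∀ r ∈ maximalIdeal A ^ n, r • g = 0) ∧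
      (∀ r : A, (∀ g : G, r • g = 0) → r = 0) ∧
      (∀ g : G, ∃ w : G, g = x • w) ∧
      (∀ g : G, x • g = 0 → ∃ w : G, x • w = 0 ∧ g = y • w) := by
  letI : Module A (LC (maximalIdeal L) (2+1) L) := Module.compHom _ f
  have hs : ∀ (a : A) (g : LC (maximalIdeal L) (2+1) L), a • g = f a • g := fun _ _ => rfl
  have hfx : f x ≠ 0 := fun h => hx0 (hf (by rw [h, _root_.map_zero]))
  refine ⟨LC (maximalIdeal L) (2+1) L, inferInstance, inferInstance, ?_, ?_, ?_, ?_⟩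
  · intro g
    obtain ⟨n, hn⟩ := LC.torsion g
    refine ⟨n, fun r hr => ?_⟩
    rw [hs]
    refine hn _ ?_
    have h1 : (maximalIdeal A).map f ≤ maximalIdeal L := Ideal.map_le_iff_le_comap.2 hfm
    refine Ideal.pow_right_mono h1 n ?_
    rw [← Ideal.map_pow]
    exact Ideal.mem_map_of_mem f hr
  · intro r hr
    refine hf ?_
    rw [_root_.map_zero]
    exact LC.dom_faithful (2+1) hd (f r) hr
  · exact fun g => LC.dom_div (2+1) hd (f x) hfx g
  · exact fun g hg => LC.dom_div2 2 hd (f x) (f y) hfx (hfm x hx) hxy g hg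

theorem exists_G {A : Type u} [CommRing A] [IsNoetherianRing A] [IsLocalRing A] [IsDomain A]
    [IsPrecomplete (maximalIdeal A) A] (hdA : ringKrullDim A = (2 + 1 : ℕ))
    (x y u v : A) (hx : x ∈ maximalIdeal A) (hy : y ∈ maximalIdeal A)
    (hu : u ∈ maximalIdeal A) (hv : v ∈ maximalIdeal A)
    (hrel : u * x = v * y)
    (hm : ∀ Q : Ideal A, Q.IsPrime → x ∈ Q → y ∈ Q → u ∈ Q → v ∈ Q → Q = maximalIdeal A) :
    ∃ x' y' : A, ((x' = x ∧ y' = y) ∨ (x' = y ∧ y' = x)) ∧ x' ≠ 0 ∧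
    ∃ (G : Type u) (_ : AddCommGroup G) (_ : Module A G),
      (∀ g : G, ∃ n : ℕ, ∀ r ∈ maximalIdeal A ^ n, r • g = 0) ∧
      (∀ r : A, (∀ g : G, r • g = 0) → r = 0) ∧
      (∀ g : G, ∃ w : G, g = x' • w) ∧
      (∀ g : G, x' • g = 0 → ∃ w : G, x' • w = 0 ∧ g = y' • w) := by
  obtain ⟨q, hq, hq0, huq, hvq, h | h, hqd⟩ := exists_q hdA x y u v hx hy hu hv hrel hm
  · have hx0 : x ≠ 0 := fun h' => h (h' ▸ q.zero_mem)
    obtain ⟨L, _, _, _, _, f, hf, hfm, h1, h2⟩ := exists_L x y u v hx hy hrel hm q hq0 huq hvq h hqd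
    exact ⟨x, y, Or.inl ⟨rfl, rfl⟩, hx0, exists_G_of_L x y L f hf hfm h1 h2 hx0 hx⟩
  · have hy0 : y ≠ 0 := fun h' => h (h' ▸ q.zero_mem)
    obtain ⟨L, _, _, _, _, f, hf, hfm, h1, h2⟩ := exists_L y x v u hy hx hrel.symm
      (fun Q hQ h1 h2 h3 h4 => hm Q hQ h2 h1 h4 h3) q hq0 hvq huq h hqd
    exact ⟨y, x, Or.inr ⟨rfl, rfl⟩, hy0, exists_G_of_L y x L f hf hfm h1 h2 hy0 hy⟩
end FileO

section FileP
open CategoryTheory Limits Opposite IsLocalRing Module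
open scoped Pointwise

set_option linter.unusedSectionVars false

lemma height_ge_two {R : Type*} [CommRing R] [IsDomain R] {Q P : Ideal R} [Q.IsPrime] [P.IsPrime] (h0 : Q ≠ ⊥) (h : Q < P) :
    2 ≤ P.height := by
  have h1 := Ideal.height_add_one_le_of_lt_of_isPrime (bot_lt_iff_ne_bot.2 h0)
  have h2 := Ideal.height_add_one_le_of_lt_of_isPrime h
  refine le_trans ?_ h2
  have h3 : (1 : ℕ∞) ≤ Q.height := le_trans (by simp) h1
  calc (2 : ℕ∞) = 1 + 1 := by norm_num
    _ ≤ _ := by gcongr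

theorem package {R : Type u} [CommRing R] [IsNoetherianRing R] [IsLocalRing R] [IsDomain R]
    [IsPrecomplete (maximalIdeal R) R] (hdim : ringKrullDim R = (3 + 1 : ℕ)) (I p : Ideal R) [hp : p.IsPrime]
    (hIp : I ≤ p) (hp3 : p.height < 3) (hge : ∀ Q : Ideal R, Q.IsPrime → I ≤ Q → 2 ≤ Q.height) :
    ∃ (P : Ideal R) (x y : R), P.IsPrime ∧ x ∈ I ∧ y ∈ I ∧ x ∉ P ∧ P ≤ p ∧
      (∀ Q : Ideal R, Q.IsPrime → P < Q → ¬ Q < p) ∧ ringKrullDim (R ⧸ P) < (3 + 1 : ℕ) ∧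
      ∃ (G : Type u) (_ : AddCommGroup G) (_ : Module R G),
      (∀ g : G, ∃ n : ℕ, ∀ r ∈ maximalIdeal R ^ n, r • g = 0) ∧
      (∀ r : R, (∀ g : G, r • g = 0) ↔ r ∈ P) ∧
      (∀ g : G, ∃ w : G, g = x • w) ∧
      (∀ g : G, x • g = 0 → ∃ w : G, x • w = 0 ∧ g = y • w) := by
  have hIm : I ≤ maximalIdeal R := hIp.trans (le_maximalIdeal hp.ne_top)
  have hpr : ∀ (g : R) (Q : Ideal R), Q ∈ (Ideal.span {g}).minimalPrimes → ¬ (2 : ℕ∞) ≤ Q.height := by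
    intro g Q hQ h
    have h1 := Ideal.height_le_one_of_isPrincipal_of_mem_minimalPrimes (Ideal.span {g}) Q hQ
    exact absurd (h.trans h1) (by norm_num)
  have hI0 : I ≠ ⊥ := by
    rintro rfl
    have := hge ⊥ Ideal.isPrime_bot le_rfl
    simp at this
  obtain ⟨x, hxI, hx0⟩ := Submodule.exists_mem_ne_zero_of_ne_bot hI0
  obtain ⟨y, hyI, hy⟩ := avoid_step I (Ideal.span {x}) 3 (dim_span_lt hdim hx0)
    (fun Q hQ _ hIQ => hpr x Q hQ (hge Q hQ.1.1 hIQ))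
  have hmax : ∀ (J : Ideal R) (n : ℕ), 1 ≤ n → ∀ Q ∈ J.minimalPrimes, (n : WithBot ℕ∞) ≤ ringKrullDim (R ⧸ Q) →
      ¬ maximalIdeal R ≤ Q := by
    intro J n hn Q hQ h1 h2
    have : Q = maximalIdeal R := le_antisymm (le_maximalIdeal hQ.1.1.ne_top) h2
    refine absurd h1 (not_le.2 ((dim_max Q this).trans_le ?_))
    exact_mod_cast hn
  obtain ⟨u, hum, hu⟩ := avoid_step (maximalIdeal R) _ 2 hy (hmax _ 2 (by norm_num))
  obtain ⟨v, hvm, hv⟩ := avoid_step (maximalIdeal R) _ 1 hu (hmax _ 1 le_rfl)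
  have hm : ∀ Q : Ideal R, Q.IsPrime → x ∈ Q → y ∈ Q → u ∈ Q → v ∈ Q → Q = maximalIdeal R := by
    intro Q hQ h1 h2 h3 h4
    refine eq_max_of_dim hQ ((dim_mono ?_).trans_lt hv)
    simp only [sup_le_iff, Ideal.span_singleton_le_iff_mem]
    exact ⟨⟨⟨h1, h2⟩, h3⟩, h4⟩
  have hg : ∃ g : R, g ≠ 0 ∧ g ∈ p ∧ g ∣ u * x - v * y := by
    by_cases hf : u * x - v * y = 0
    · exact ⟨x, hx0, hIp hxI, hf ▸ dvd_zero x⟩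
    · exact ⟨_, hf, p.sub_mem (p.mul_mem_left _ (hIp hxI)) (p.mul_mem_left _ (hIp hyI)), dvd_rfl⟩
  obtain ⟨g, hg0, hgp, hgf⟩ := hg
  obtain ⟨P, hPmin, hPp⟩ := Ideal.exists_minimalPrimes_le ((Ideal.span_singleton_le_iff_mem p).2 hgp)
  have hP : P.IsPrime := hPmin.1.1
  have hgP : g ∈ P := (Ideal.span_singleton_le_iff_mem P).1 hPmin.1.2
  have hfP : u * x - v * y ∈ P := P.mem_of_dvd hgf hgP
  have hP0 : P ≠ ⊥ := fun h => hg0 (by rwa [h, Ideal.mem_bot] at hgP)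
  have hP1 : ∀ Q : Ideal R, Q.IsPrime → Q < P → Q = ⊥ := by
    intro Q hQ hlt
    by_contra h
    exact hpr g P hPmin (height_ge_two h hlt)
  have hIP : ¬ I ≤ P := fun h => hpr g P hPmin (hge P hP h)
  have hbet : ∀ Q : Ideal R, Q.IsPrime → P < Q → ¬ Q < p := by
    intro Q hQ h1 h2
    have h3 := height_ge_two hP0 h1
    have h4 := Ideal.height_add_one_le_of_lt_of_isPrime h2
    refine absurd hp3 (not_lt.2 (le_trans ?_ h4))
    calc (3 : ℕ∞) = 2 + 1 := by norm_num
      _ ≤ _ := by gcongr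
  let A := R ⧸ P
  have : Nontrivial A := Ideal.Quotient.nontrivial_iff.2 hP.ne_top
  have : IsLocalRing A := IsLocalRing.of_surjective' _ Ideal.Quotient.mk_surjective
  have : IsDomain A := Ideal.Quotient.isDomain P
  have hmA : (maximalIdeal R).map (Ideal.Quotient.mk P) = maximalIdeal A :=
    map_maximalIdeal_of_surjective _ Ideal.Quotient.mk_surjective
  have : IsPrecomplete (maximalIdeal A) A := by
    rw [← hmA]
    exact precomplete_quot _ _
  have hlt : ringKrullDim A < (3 + 1 : ℕ) := by
    by_contra! hc
    have := dim_strict (bot_lt_iff_ne_bot.2 hP0) hc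
    rw [dim_bot, hdim] at this
    exact absurd this (not_le.2 (by exact_mod_cast Nat.lt_succ_self 4))
  have hdA : ringKrullDim A = (2 + 1 : ℕ) := le_antisymm (wb_le_of_lt' hlt) (cat_lemma 3 hdim P hP0 hP1)
  have hmk : ∀ r ∈ maximalIdeal R, Ideal.Quotient.mk P r ∈ maximalIdeal A := fun r hr => by
    rw [← hmA]
    exact Ideal.mem_map_of_mem _ hr
  obtain ⟨x', y', hxy', hx'0, G, _, _, hG1, hG2, hG3, hG4⟩ := exists_G hdA (Ideal.Quotient.mk P x) (Ideal.Quotient.mk P y)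
    (Ideal.Quotient.mk P u) (Ideal.Quotient.mk P v) (hmk x (hIm hxI)) (hmk y (hIm hyI)) (hmk u hum) (hmk v hvm)
    (by rw [← map_mul, ← map_mul]; exact Ideal.Quotient.eq.2 hfP) (by
      intro Q hQ h1 h2 h3 h4
      have h5 := hm (Q.comap (Ideal.Quotient.mk P)) (Ideal.IsPrime.comap _) h1 h2 h3 h4
      refine le_antisymm (le_maximalIdeal hQ.ne_top) ?_
      rw [← hmA, Ideal.map_le_iff_le_comap, h5])
  obtain ⟨X, Y, hXI, hYI, rfl, rfl⟩ : ∃ X Y : R, X ∈ I ∧ Y ∈ I ∧ Ideal.Quotient.mk P X = x' ∧ Ideal.Quotient.mk P Y = y' := by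
    rcases hxy' with ⟨h1, h2⟩ | ⟨h1, h2⟩
    · exact ⟨x, y, hxI, hyI, h1.symm, h2.symm⟩
    · exact ⟨y, x, hyI, hxI, h1.symm, h2.symm⟩
  let : Module R G := Module.compHom G (Ideal.Quotient.mk P)
  have hs : ∀ (r : R) (g : G), r • g = (Ideal.Quotient.mk P r) • g := fun _ _ => rfl
  refine ⟨P, X, Y, hP, hXI, hYI, fun h => hx'0 (Ideal.Quotient.eq_zero_iff_mem.2 h), hPp, hbet, hlt, G, inferInstance,
    inferInstance, ?_, ?_, hG3, hG4⟩
  · intro g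
    obtain ⟨n, hn⟩ := hG1 g
    refine ⟨n, fun r hr => ?_⟩
    rw [hs]
    refine hn _ ?_
    rw [← hmA, ← Ideal.map_pow]
    exact Ideal.mem_map_of_mem _ hr
  · intro r
    refine ⟨fun h => Ideal.Quotient.eq_zero_iff_mem.1 (hG2 _ h), fun h g => ?_⟩
    rw [hs, Ideal.Quotient.eq_zero_iff_mem.2 h, zero_smul]
end FileP

section FileQ
open CategoryTheory Limits Opposite IsLocalRing Module
open scoped Pointwise

set_option linter.unusedSectionVars false

section FF
variable {R : Type u} [CommRing R] [IsNoetherianRing R]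

/-- all `Ext^j(R/I, N)` are finitely generated -/
def FF (I : Ideal R) (N : Type u) [AddCommGroup N] [Module R N] : Prop :=
  ∀ j : ℕ, Module.Finite R (Abelian.Ext (ModuleCat.of R (R ⧸ I)) (ModuleCat.of R N) j)

lemma fg_of_le' {X : Type*} [AddCommGroup X] [Module R X] {S T : Submodule R X} (hS : S.FG) (h : T ≤ S) : T.FG := by
  have : IsNoetherian R S := isNoetherian_of_fg_of_noetherian _ hS
  have h1 : (T.comap S.subtype).FG := IsNoetherian.noetherian _
  have h2 := h1.map S.subtype
  rwa [Submodule.map_comap_subtype, inf_eq_right.2 h] at h2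

lemma finite_of_exact {X Y Z : Type*} [AddCommGroup X] [Module R X] [AddCommGroup Y] [Module R Y]
    [AddCommGroup Z] [Module R Z] (f : X →ₗ[R] Y) (g : Y →ₗ[R] Z) (hX : Module.Finite R X) (hZ : Module.Finite R Z)
    (h : ∀ y, g y = 0 → ∃ x, f x = y) : Module.Finite R Y := by
  have h1 : (LinearMap.range f).FG := by
    have := Module.Finite.range f
    exact Module.Finite.iff_fg.1 this
  have h2 : (LinearMap.ker g).FG := by
    exact fg_of_le' h1 (fun y hy => h y hy)
  refine ⟨Submodule.fg_of_fg_map_of_fg_inf_ker g ?_ (by rwa [top_inf_eq])⟩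
  have : IsNoetherian R Z := isNoetherian_of_isNoetherianRing_of_finite R Z
  exact IsNoetherian.noetherian _

variable {I : Ideal R} {N N' N'' : Type u} [AddCommGroup N] [Module R N] [AddCommGroup N'] [Module R N']
  [AddCommGroup N''] [Module R N'']

lemma FF.of_finite (I : Ideal R) (N : Type u) [AddCommGroup N] [Module R N] [Module.Finite R N] : FF I N := by
  intro j
  have : Module.Finite R (ModuleCat.of R N) := inferInstanceAs (Module.Finite R N)
  have : Module.Finite R (ModuleCat.of R (R ⧸ I)) := inferInstanceAs (Module.Finite R (R ⧸ I))
  infer_instance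

section
variable (f : N →ₗ[R] N') (g : N' →ₗ[R] N'') (hf : Function.Injective f) (hg : Function.Surjective g)
  (hfg : Function.Exact f g)
include hf hg hfg

lemma FF.mid (h1 : FF I N) (h3 : FF I N'') : FF I N' := by
  intro j
  have hS := scOf_shortExact f g hf hg hfg
  exact finite_of_exact
    (Abelian.Ext.postcompOfLinear (Abelian.Ext.mk₀ (scOf f g hfg).f) R (ModuleCat.of R (R ⧸ I)) (add_zero j))
    (Abelian.Ext.postcompOfLinear (Abelian.Ext.mk₀ (scOf f g hfg).g) R (ModuleCat.of R (R ⧸ I)) (add_zero j))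
    (h1 j) (h3 j) (fun y hy => Abelian.Ext.covariant_sequence_exact₂ _ hS y hy)

lemma FF.right (h1 : FF I N) (h3 : FF I N') : FF I N'' := by
  intro j
  have hS := scOf_shortExact f g hf hg hfg
  exact finite_of_exact
    (Abelian.Ext.postcompOfLinear (Abelian.Ext.mk₀ (scOf f g hfg).g) R (ModuleCat.of R (R ⧸ I)) (add_zero j))
    (Abelian.Ext.postcompOfLinear hS.extClass R (ModuleCat.of R (R ⧸ I)) (rfl : j + 1 = j + 1))
    (h3 j) (h1 (j+1)) (fun y hy => Abelian.Ext.covariant_sequence_exact₃ _ hS y rfl hy)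

lemma FF.left (h1 : FF I N') (h3 : FF I N'') : FF I N := by
  intro j
  have hS := scOf_shortExact f g hf hg hfg
  cases j with
  | zero =>
    have : Mono (scOf f g hfg).f := hS.mono_f
    have hinj : Function.Injective (Abelian.Ext.postcompOfLinear (Abelian.Ext.mk₀ (scOf f g hfg).f) R (ModuleCat.of R (R ⧸ I)) (add_zero 0)) :=
      Abelian.Ext.postcomp_mk₀_injective_of_mono _ (scOf f g hfg).f
    have h10 : Module.Finite R (Abelian.Ext (ModuleCat.of R (R ⧸ I)) (scOf f g hfg).X₂ 0) := h1 0
    have : IsNoetherian R (Abelian.Ext (ModuleCat.of R (R ⧸ I)) (scOf f g hfg).X₂ 0) :=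
      isNoetherian_of_isNoetherianRing_of_finite R _
    exact Module.Finite.of_injective _ hinj
  | succ j =>
    exact finite_of_exact
      (Abelian.Ext.postcompOfLinear hS.extClass R (ModuleCat.of R (R ⧸ I)) (rfl : j + 1 = j + 1))
      (Abelian.Ext.postcompOfLinear (Abelian.Ext.mk₀ (scOf f g hfg).f) R (ModuleCat.of R (R ⧸ I)) (add_zero (j+1)))
      (h3 j) (h1 (j+1)) (fun y hy => Abelian.Ext.covariant_sequence_exact₁ _ hS y hy rfl)

end

lemma FF.equiv (e : N ≃ₗ[R] N') (h : FF I N) : FF I N' :=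
  FF.right (N := PUnit.{u+1}) 0 e.toLinearMap (fun _ _ _ => rfl) e.surjective (fun x => by
    constructor
    · intro hx
      exact ⟨0, by rw [_root_.map_zero]; exact (e.map_eq_zero_iff.1 hx).symm⟩
    · rintro ⟨y, rfl⟩
      simp) (FF.of_finite I _) h

/-- `0 :_N I` -/
def annSub (I : Ideal R) (N : Type u) [AddCommGroup N] [Module R N] : Submodule R N where
  carrier := {n | ∀ r ∈ I, r • n = 0}
  add_mem' h1 h2 r hr := by rw [smul_add, h1 r hr, h2 r hr, add_zero]
  zero_mem' r _ := smul_zero r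
  smul_mem' c n hn r hr := by rw [smul_comm, hn r hr, smul_zero]

lemma annSub_fg (h : Module.Finite R (Abelian.Ext (ModuleCat.of R (R ⧸ I)) (ModuleCat.of R N) 0)) :
    (annSub I N).FG := by
  let ε : Abelian.Ext (ModuleCat.of R (R ⧸ I)) (ModuleCat.of R N) 0 →ₗ[R] N :=
    { toFun := fun x => (Abelian.Ext.linearEquiv₀ (R := R) x).hom (Ideal.Quotient.mk I 1)
      map_add' := fun x y => by rw [_root_.map_add]; rfl
      map_smul' := fun r x => by rw [_root_.map_smul]; rfl }
  have h1 : (LinearMap.range ε).FG := by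
    have := Module.Finite.range ε
    exact Module.Finite.iff_fg.1 this
  refine fg_of_le' h1 ?_
  intro n hn
  let φ : (R ⧸ I) →ₗ[R] N := Submodule.liftQ I (LinearMap.toSpanSingleton R N n) (fun r hr => hn r hr)
  refine ⟨(Abelian.Ext.linearEquiv₀ (R := R)).symm (ModuleCat.ofHom φ), ?_⟩
  show ((Abelian.Ext.linearEquiv₀ (R := R)) ((Abelian.Ext.linearEquiv₀ (R := R)).symm (ModuleCat.ofHom φ))).hom _ = n
  rw [LinearEquiv.apply_symm_apply]
  exact one_smul R n

lemma FF.sub_finite (k : ℕ) (N : Type u) [AddCommGroup N] [Module R N] (h : FF I N) (W : Submodule R N)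
    (hW : ∀ r ∈ I ^ k, ∀ w ∈ W, r • w = 0) : W.FG := by
  induction k generalizing N with
  | zero =>
    have : W = ⊥ := by
      rw [eq_bot_iff]
      intro w hw
      have := hW 1 (by simp) w hw
      rwa [one_smul] at this
    rw [this]
    exact Submodule.fg_bot
  | succ k ih =>
    have hS := annSub_fg (h 0)
    have : Module.Finite R (annSub I N) := Module.Finite.iff_fg.2 hS
    have hq : FF I (N ⧸ annSub I N) := FF.right (annSub I N).subtype (annSub I N).mkQ (Submodule.subtype_injective _)
      (Submodule.mkQ_surjective _) (LinearMap.exact_subtype_mkQ _) (FF.of_finite I _) h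
    refine Submodule.fg_of_fg_map_of_fg_inf_ker (annSub I N).mkQ (ih _ hq _ ?_) ?_
    · rintro r hr _ ⟨w, hw, rfl⟩
      rw [← _root_.map_smul, Submodule.mkQ_apply, Submodule.Quotient.mk_eq_zero]
      intro s hs
      rw [← mul_smul]
      refine hW _ ?_ w hw
      rw [pow_succ']
      exact Ideal.mul_mem_mul hs hr
    · refine fg_of_le' hS ?_
      rw [Submodule.ker_mkQ]
      exact inf_le_right

end FF
end FileQ

section FileS1
open CategoryTheory Limits Opposite IsLocalRing Module
open scoped Pointwise

set_option linter.unusedSectionVars false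

section DD
variable {R : Type u} [CommRing R] [IsNoetherianRing R]

lemma LC.depth_two (I : Ideal R) {E : Type u} [AddCommGroup E] [Module R E] {x y : R} (hx : x ∈ I) (hy : y ∈ I)
    (hxr : IsSMulRegular E x) (hyr : ∀ φ ψ : E, y • φ = x • ψ → ∃ χ : E, φ = x • χ) :
    (∀ z : LC I 0 E, z = 0) ∧ (∀ z : LC I 1 E, z = 0) := by
  have hreg0 : ∀ (r : R), r ∈ I → ∀ (N : Type u) [AddCommGroup N] [Module R N], (∀ n : N, r • n = 0 → n = 0) →
      ∀ z : LC I 0 N, z = 0 := by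
    intro r hr N _ _ h z
    refine eq_zero_of_regular_torsion I hr LC.torsion (fun z hz => ?_) z
    refine LC.ev_inj I ?_
    rw [_root_.map_zero]
    refine h _ ?_
    rw [← _root_.map_smul, hz, _root_.map_zero]
  have h0 : ∀ z : LC I 0 (QuotSMulTop x E), z = 0 := by
    refine hreg0 y hy _ ?_
    intro n hn
    obtain ⟨φ, rfl⟩ := Submodule.mkQ_surjective _ n
    rw [← _root_.map_smul, Submodule.mkQ_apply, Submodule.Quotient.mk_eq_zero, Submodule.mem_smul_pointwise_iff_exists] at hn
    obtain ⟨ψ, -, hψ⟩ := hn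
    obtain ⟨χ, rfl⟩ := hyr φ ψ hψ.symm
    rw [Submodule.mkQ_apply, Submodule.Quotient.mk_eq_zero]
    exact Submodule.smul_mem_pointwise_smul _ _ _ trivial
  refine ⟨hreg0 x hx E (fun n hn => hxr (by show x • n = x • 0; rw [hn, smul_zero])), ?_⟩
  refine eq_zero_of_regular_torsion I hx LC.torsion ?_
  intro z hz
  obtain ⟨_, δ, h1, h2⟩ := LC.les_reg I hxr 0
  obtain ⟨w, rfl⟩ := (h2 z).1 hz
  rw [h0 w, _root_.map_zero]

/-- The ideal transform, as a subalgebra. -/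
def DD (I : Ideal R) (E : Type u) [Ring E] [Algebra R E] : Subalgebra R E where
  carrier := {φ | ∃ n : ℕ, ∀ w ∈ I ^ n, ∃ c : R, w • φ = algebraMap R E c}
  mul_mem' := by
    rintro φ ψ ⟨n, hn⟩ ⟨k, hk⟩
    refine ⟨n + k, fun w hw => ?_⟩
    rw [pow_add] at hw
    refine Submodule.mul_induction_on hw ?_ ?_
    · intro a ha b hb
      obtain ⟨c, hc⟩ := hn a ha
      obtain ⟨d, hd⟩ := hk b hb
      exact ⟨c * d, by rw [map_mul, ← hc, ← hd, smul_mul_smul_comm]⟩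
    · rintro a b ⟨c, hc⟩ ⟨d, hd⟩
      exact ⟨c + d, by rw [_root_.map_add, ← hc, ← hd, add_smul]⟩
  add_mem' := by
    rintro φ ψ ⟨n, hn⟩ ⟨k, hk⟩
    refine ⟨n + k, fun w hw => ?_⟩
    obtain ⟨c, hc⟩ := hn w (Ideal.pow_le_pow_right (Nat.le_add_right n k) hw)
    obtain ⟨d, hd⟩ := hk w (Ideal.pow_le_pow_right (Nat.le_add_left k n) hw)
    exact ⟨c + d, by rw [_root_.map_add, ← hc, ← hd, smul_add]⟩
  algebraMap_mem' r := ⟨0, fun w _ => ⟨w * r, by rw [map_mul, Algebra.smul_def]⟩⟩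

/-- the image of `R` -/
def MM (R : Type u) [CommRing R] (E : Type u) [Ring E] [Algebra R E] : Submodule R E :=
  LinearMap.range (Algebra.linearMap R E)

instance (E : Type u) [Ring E] [Algebra R E] : Module.Finite R (MM R E) :=
  inferInstanceAs (Module.Finite R (LinearMap.range (Algebra.linearMap R E)))

lemma FF.of_DD (I : Ideal R) {E : Type u} [Ring E] [Algebra R E] (h0 : ∀ z : LC I 0 E, z = 0)
    (h1 : ∀ z : LC I 1 E, z = 0) (hF : FF I (LC I 1 (MM R E))) : FF I (DD I E) := by
  obtain ⟨δ, hδ1, hδ2⟩ := LC.les I (MM R E).subtype (MM R E).mkQ (Submodule.subtype_injective _)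
      (Submodule.mkQ_surjective _) (LinearMap.exact_subtype_mkQ _) 0
  have hmem : ∀ d : E, (MM R E).mkQ d ∈ LinearMap.range (LC.ev I (E ⧸ MM R E)) ↔ d ∈ DD I E := by
    intro d
    rw [LC.mem_range_ev]
    refine exists_congr fun n => forall₂_congr fun w hw => ?_
    rw [← _root_.map_smul, Submodule.mkQ_apply, Submodule.Quotient.mk_eq_zero]
    exact exists_congr fun c => ⟨fun h => h.symm, fun h => h.symm⟩
  let e0 : LC I 0 (E ⧸ MM R E) ≃ₗ[R] LinearMap.range (LC.ev I (E ⧸ MM R E)) := LinearEquiv.ofInjective _ (LC.ev_inj I)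
  let α : DD I E →ₗ[R] LinearMap.range (LC.ev I (E ⧸ MM R E)) :=
    LinearMap.codRestrict _ ((MM R E).mkQ.comp (Subalgebra.toSubmodule (DD I E)).subtype) (fun d => (hmem d.1).2 d.2)
  have hα : Function.Surjective α := by
    rintro ⟨n, hn⟩
    obtain ⟨d, rfl⟩ := Submodule.mkQ_surjective _ n
    exact ⟨⟨d, (hmem d).1 hn⟩, rfl⟩
  have hδi : ∀ z, δ z = 0 → z = 0 := by
    intro z hz
    obtain ⟨w, rfl⟩ := (hδ1 z).1 hz
    rw [h0 w, _root_.map_zero]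
  have hδs : Function.Surjective δ := fun z => (hδ2 z).1 (h1 _)
  let θ : DD I E →ₗ[R] LC I 1 (MM R E) := δ.comp (e0.symm.toLinearMap.comp α)
  have hθ : Function.Surjective θ := hδs.comp (e0.symm.surjective.comp hα)
  have hle : MM R E ≤ Subalgebra.toSubmodule (DD I E) := by
    rintro _ ⟨r, rfl⟩
    exact (DD I E).algebraMap_mem r
  refine FF.mid (Submodule.inclusion hle) θ (Submodule.inclusion_injective hle) hθ ?_ (FF.of_finite I _) hF
  intro d
  constructor
  · intro hd
    have h2 : α d = 0 := e0.symm.map_eq_zero_iff.1 (hδi _ hd)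
    have h3 : (MM R E).mkQ d.1 = 0 := congrArg Subtype.val h2
    rw [Submodule.mkQ_apply, Submodule.Quotient.mk_eq_zero] at h3
    exact ⟨⟨d.1, h3⟩, rfl⟩
  · rintro ⟨s, rfl⟩
    have h2 : α (Submodule.inclusion hle s) = 0 := by
      refine Subtype.ext ?_
      show (MM R E).mkQ s.1 = 0
      rw [Submodule.mkQ_apply, Submodule.Quotient.mk_eq_zero]
      exact s.2
    show δ (e0.symm (α (Submodule.inclusion hle s))) = 0
    rw [h2, _root_.map_zero, _root_.map_zero]

end DD
end FileS1

section FileT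
open CategoryTheory Limits Opposite IsLocalRing Module
open scoped Pointwise

set_option linter.unusedSectionVars false

section Kos
variable {R : Type u} [CommRing R] [IsNoetherianRing R] {I : Ideal R}

lemma FF.prod {X Y : Type u} [AddCommGroup X] [Module R X] [AddCommGroup Y] [Module R Y] (hX : FF I X) (hY : FF I Y) :
    FF I (X × Y) :=
  FF.mid (LinearMap.inl R X Y) (LinearMap.snd R X Y) LinearMap.inl_injective LinearMap.snd_surjective
    Function.Exact.inl_snd hX hY

lemma FF.quot {X : Type u} [AddCommGroup X] [Module R X] (B : Submodule R X) (hB : FF I B) (hX : FF I X) :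
    FF I (X ⧸ B) :=
  FF.right B.subtype B.mkQ (Submodule.subtype_injective _)
      (Submodule.mkQ_surjective _) (LinearMap.exact_subtype_mkQ _) hB hX

lemma FF.step {Y Z : Type u} [AddCommGroup Y] [Module R Y] [AddCommGroup Z] [Module R Z]
    (B : Submodule R Y) (g : Y →ₗ[R] Z) (hB : B ≤ LinearMap.ker g) (k : ℕ)
    (h : ∀ y, g y = 0 → ∀ r ∈ I ^ k, r • y ∈ B) (hFB : FF I B) (hFY : FF I Y) : FF I (LinearMap.range g) := by
  have hq := FF.quot B hFB hFY
  let W : Submodule R (Y ⧸ B) := (LinearMap.ker g).map B.mkQ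
  have hW : W.FG := by
    refine FF.sub_finite k _ hq W ?_
    rintro r hr _ ⟨y, hy, rfl⟩
    rw [← _root_.map_smul, Submodule.mkQ_apply, Submodule.Quotient.mk_eq_zero]
    exact h y hy r hr
  have : Module.Finite R W := Module.Finite.iff_fg.2 hW
  let gb : (Y ⧸ B) →ₗ[R] LinearMap.range g := B.liftQ g.rangeRestrict (by
    rw [LinearMap.ker_rangeRestrict]
    exact hB)
  refine FF.right W.subtype gb (Submodule.subtype_injective _) ?_ ?_ (FF.of_finite I W) hq
  · rintro ⟨_, y, rfl⟩
    exact ⟨B.mkQ y, rfl⟩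
  · intro z
    obtain ⟨y, rfl⟩ := Submodule.mkQ_surjective _ z
    constructor
    · intro hz
      have h1 : g y = 0 := congrArg Subtype.val hz
      exact ⟨⟨B.mkQ y, y, h1, rfl⟩, rfl⟩
    · rintro ⟨⟨_, y', hy', rfl⟩, h2⟩
      rw [← h2]
      exact Subtype.ext hy'

variable {D : Type u} [AddCommGroup D] [Module R D]

/-- Koszul differentials -/
def kgrad (a b c : R) : D →ₗ[R] D × D × D where
  toFun d := (a • d, b • d, c • d)
  map_add' x y := by simp [smul_add]
  map_smul' r x := by simp [smul_comm r]

/-- Koszul differentials -/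
def kcurl (a b c : R) : (D × D × D) →ₗ[R] D × D × D where
  toFun d := (b • d.2.2 - c • d.2.1, c • d.1 - a • d.2.2, a • d.2.1 - b • d.1)
  map_add' x y := by
    refine Prod.ext ?_ (Prod.ext ?_ ?_) <;> simp only [Prod.fst_add, Prod.snd_add, smul_add] <;> abel
  map_smul' r x := by
    refine Prod.ext ?_ (Prod.ext ?_ ?_) <;>
      simp only [Prod.smul_fst, Prod.smul_snd, smul_sub, RingHom.id_apply, smul_comm r]

/-- Koszul differentials -/
def kdiv (a b c : R) : (D × D × D) →ₗ[R] D where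
  toFun d := a • d.1 + b • d.2.1 + c • d.2.2
  map_add' x y := by simp only [Prod.fst_add, Prod.snd_add, smul_add]; abel
  map_smul' r x := by simp only [Prod.smul_fst, Prod.smul_snd, smul_add, RingHom.id_apply, smul_comm r]

theorem FF.koszul (P : Ideal R) (hP : ∀ r ∈ P, ∀ d : D, r • d = 0) (a b c : R) (k : ℕ)
    (hI : I ^ k ≤ Ideal.span {a, b, c} ⊔ P) (hD : FF I D) :
    Module.Finite R (D ⧸ (LinearMap.range (kdiv (D := D) a b c))) := by
  have key : ∀ {Y : Type u} [AddCommGroup Y] [Module R Y] (B : Submodule R Y) (y : Y),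
      a • y ∈ B → b • y ∈ B → c • y ∈ B → (∀ r ∈ P, r • y = 0) → ∀ r ∈ I ^ k, r • y ∈ B := by
    intro Y _ _ B y h1 h2 h3 h4 r hr
    have : Ideal.span {a, b, c} ⊔ P ≤ B.comap (LinearMap.toSpanSingleton R Y y) := by
      refine sup_le ?_ ?_
      · rw [Ideal.span_le]
        rintro z (rfl | rfl | rfl)
        · exact h1
        · exact h2
        · exact h3
      · intro r hr
        show r • y ∈ B
        rw [h4 r hr]
        exact B.zero_mem
    exact this (hI hr)
  have hP3 : ∀ r ∈ P, ∀ d : D × D × D, r • d = 0 := fun r hr d => by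
    refine Prod.ext ?_ (Prod.ext ?_ ?_) <;> exact hP r hr _
  have hD3 : FF I (D × D × D) := hD.prod (hD.prod hD)
  have h1 : FF I (LinearMap.range (kgrad (D := D) a b c)) := by
    refine FF.step ⊥ _ bot_le k ?_ (FF.of_finite I _) hD
    intro d hd
    have e1 : a • d = 0 := congrArg (fun t => t.1) hd
    have e2 : b • d = 0 := congrArg (fun t => t.2.1) hd
    have e3 : c • d = 0 := congrArg (fun t => t.2.2) hd
    exact key _ d e1 e2 e3 (fun r hr => hP r hr d)
  have h2 : FF I (LinearMap.range (kcurl (D := D) a b c)) := by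
    refine FF.step _ _ ?_ k ?_ h1 hD3
    · rintro _ ⟨d, rfl⟩
      refine Prod.ext ?_ (Prod.ext ?_ ?_)
      · show b • c • d - c • b • d = 0
        rw [smul_comm, sub_self]
      · show c • a • d - a • c • d = 0
        rw [smul_comm, sub_self]
      · show a • b • d - b • a • d = 0
        rw [smul_comm, sub_self]
    · rintro ⟨d, e, f⟩ hd
      have e1 : b • f = c • e := sub_eq_zero.1 (congrArg (fun t => t.1) hd)
      have e2 : c • d = a • f := sub_eq_zero.1 (congrArg (fun t => t.2.1) hd)
      have e3 : a • e = b • d := sub_eq_zero.1 (congrArg (fun t => t.2.2) hd)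
      refine key _ _ ⟨d, ?_⟩ ⟨e, ?_⟩ ⟨f, ?_⟩ (fun r hr => hP3 r hr _)
      · exact Prod.ext rfl (Prod.ext e3.symm e2)
      · exact Prod.ext e3 (Prod.ext rfl e1.symm)
      · exact Prod.ext e2.symm (Prod.ext e1 rfl)
  have h3 : FF I (LinearMap.range (kdiv (D := D) a b c)) := by
    refine FF.step _ _ ?_ k ?_ h2 hD3
    · rintro _ ⟨⟨d, e, f⟩, rfl⟩
      show a • (b • f - c • e) + b • (c • d - a • f) + c • (a • e - b • d) = 0
      simp only [smul_sub, ← mul_smul]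
      rw [mul_comm b a, mul_comm c a, mul_comm c b]
      abel
    · rintro ⟨d, e, f⟩ hd
      have e1 : a • d + b • e + c • f = 0 := hd
      refine key _ _ ⟨(0, f, -e), ?_⟩ ⟨(-f, 0, d), ?_⟩ ⟨(e, -d, 0), ?_⟩ (fun r hr => hP3 r hr _)
      · refine Prod.ext ?_ (Prod.ext ?_ ?_)
        · show b • (-e) - c • f = a • d
          rw [smul_neg, ← sub_eq_zero, ← neg_eq_zero, ← e1]
          abel
        · show c • (0 : D) - a • (-e) = a • e
          simp
        · show a • f - b • (0 : D) = a • f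
          simp
      · refine Prod.ext ?_ (Prod.ext ?_ ?_)
        · show b • d - c • (0 : D) = b • d
          simp
        · show c • (-f) - a • d = b • e
          rw [smul_neg, ← sub_eq_zero, ← neg_eq_zero, ← e1]
          abel
        · show a • (0 : D) - b • (-f) = b • f
          simp
      · refine Prod.ext ?_ (Prod.ext ?_ ?_)
        · show b • (0 : D) - c • (-d) = c • d
          simp
        · show c • e - a • (0 : D) = c • e
          simp
        · show a • (-d) - b • e = c • f
          rw [smul_neg, ← sub_eq_zero, ← neg_eq_zero, ← e1]
          abel
  have h4 := FF.quot _ h3 hD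
  refine ⟨FF.sub_finite k _ h4 ⊤ ?_⟩
  rintro r hr z -
  obtain ⟨d, rfl⟩ := Submodule.mkQ_surjective _ z
  rw [← _root_.map_smul, Submodule.mkQ_apply, Submodule.Quotient.mk_eq_zero]
  refine key (LinearMap.range (kdiv (D := D) a b c)) d ⟨(d, 0, 0), ?_⟩ ⟨(0, d, 0), ?_⟩ ⟨(0, 0, d), ?_⟩ (fun r hr => hP r hr d) r hr
  · show a • d + b • (0 : D) + c • (0 : D) = a • d
    simp
  · show a • (0 : D) + b • d + c • (0 : D) = b • d
    simp
  · show a • (0 : D) + b • (0 : D) + c • d = c • d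
    simp

end Kos
end FileT

section FileU
open CategoryTheory Limits Opposite IsLocalRing Module
open scoped Pointwise

set_option linter.unusedSectionVars false

section fin
variable {R : Type u} [CommRing R] [IsNoetherianRing R] [IsLocalRing R]

lemma avoid_step2 (I J : Ideal R) (n : ℕ)
    (h : ∀ Q : Ideal R, Q.IsPrime → J ≤ Q → ¬ I ≤ Q → ringKrullDim (R ⧸ Q) < (n + 1 : ℕ)) :
    ∃ a ∈ I, ∀ Q : Ideal R, Q.IsPrime → J ⊔ Ideal.span {a} ≤ Q → ¬ I ≤ Q → ringKrullDim (R ⧸ Q) < n := by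
  obtain ⟨a, haI, ha⟩ := prime_avoid I {Q ∈ J.minimalPrimes | ¬ I ≤ Q}
    ((J.finite_minimalPrimes_of_isNoetherianRing R).subset (Set.sep_subset _ _)) (fun Q hQ => hQ.1.1.1) (fun Q hQ => hQ.2)
  refine ⟨a, haI, fun Q hQ hJQ hIQ => ?_⟩
  by_contra! hc
  obtain ⟨Q0, hQ0, hle⟩ := Ideal.exists_minimalPrimes_le (le_sup_left.trans hJQ)
  have hQ0p : Q0.IsPrime := hQ0.1.1
  have hI0 : ¬ I ≤ Q0 := fun h' => hIQ (h'.trans hle)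
  have ha0 : a ∉ Q0 := ha Q0 ⟨hQ0, hI0⟩
  have haQ : a ∈ Q := hJQ (Ideal.mem_sup_right (Ideal.mem_span_singleton_self a))
  have hlt : Q0 < Q := lt_of_le_of_ne hle (fun h' => ha0 (h' ▸ haQ))
  exact absurd (dim_strict hlt hc) (not_le.2 (h Q0 hQ0p hQ0.1.2 hI0))

lemma exists_abc (I P : Ideal R) (hI : I ≤ maximalIdeal R) (hP : ringKrullDim (R ⧸ P) < (3 + 1 : ℕ)) :
    ∃ a ∈ I, ∃ b ∈ I, ∃ c ∈ I, ∃ k : ℕ, I ^ k ≤ Ideal.span {a, b, c} ⊔ P := by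
  obtain ⟨a, ha, h1⟩ := avoid_step2 I P 3 (fun Q _ hQ _ => (dim_mono hQ).trans_lt hP)
  obtain ⟨b, hb, h2⟩ := avoid_step2 I _ 2 h1
  obtain ⟨c, hc, h3⟩ := avoid_step2 I _ 1 h2
  refine ⟨a, ha, b, hb, c, hc, ?_⟩
  refine Ideal.exists_pow_le_of_le_radical_of_fg ?_ (IsNoetherian.noetherian I)
  rw [Ideal.radical_eq_sInf]
  refine le_sInf ?_
  rintro Q ⟨hQ, hQp⟩
  by_contra hIQ
  have h4 : ringKrullDim (R ⧸ Q) < (1 : ℕ) := by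
    refine h3 Q hQp ?_ hIQ
    have h5 : Ideal.span {a, b, c} ≤ Q := le_sup_left.trans hQ
    simp only [sup_le_iff, Ideal.span_singleton_le_iff_mem]
    exact ⟨⟨⟨le_sup_right.trans hQ, h5 (Ideal.subset_span (by simp))⟩, h5 (Ideal.subset_span (by simp))⟩,
      h5 (Ideal.subset_span (by simp))⟩
  exact hIQ (hI.trans (eq_max_of_dim hQp h4).ge)

theorem final_step [IsPrecomplete (maximalIdeal R) R] (I p P : Ideal R) [hp : p.IsPrime] [hPp : P.IsPrime]
    (hIp : I ≤ p) (x y : R) (hxI : x ∈ I) (hyI : y ∈ I) (hxP : x ∉ P) (hPle : P ≤ p)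
    (hbet : ∀ Q : Ideal R, Q.IsPrime → P < Q → ¬ Q < p) (hdim : ringKrullDim (R ⧸ P) < (3 + 1 : ℕ))
    (G : Type u) [AddCommGroup G] [Module R G]
    (htors : ∀ g : G, ∃ n : ℕ, ∀ r ∈ maximalIdeal R ^ n, r • g = 0)
    (hann : ∀ r : R, (∀ g : G, r • g = 0) ↔ r ∈ P)
    (hsx : ∀ g : G, ∃ w : G, g = x • w)
    (hsy : ∀ g : G, x • g = 0 → ∃ w : G, x • w = 0 ∧ g = y • w)
    (hF : ∀ (N : Type u) [AddCommGroup N] [Module R N], Module.Finite R N → FF I (LC I 1 N)) : False := by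
  have hIm : I ≤ maximalIdeal R := hIp.trans (le_maximalIdeal hp.ne_top)
  have hxr : ∀ φ : Module.End R G, x • φ = 0 → φ = 0 := by
    intro φ hφ
    ext g
    obtain ⟨w, rfl⟩ := hsx g
    rw [_root_.map_smul]
    exact LinearMap.congr_fun hφ w
  have hxreg : IsSMulRegular (Module.End R G) x := by
    intro φ ψ h
    have h' : x • φ = x • ψ := h
    rw [← sub_eq_zero]
    exact hxr _ (by rw [smul_sub, h', sub_self])
  -- the element `e`
  have hmin : p ∈ (Ideal.span {x} ⊔ P).minimalPrimes := by
    refine ⟨⟨hp, sup_le ((Ideal.span_singleton_le_iff_mem p).2 (hIp hxI)) hPle⟩, ?_⟩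
    rintro Q ⟨hQ, hJQ⟩ hQp
    have hxQ : x ∈ Q := hJQ (Ideal.mem_sup_left (Ideal.mem_span_singleton_self x))
    have hPQ : P < Q := lt_of_le_of_ne (le_sup_right.trans hJQ) (fun h => hxP (h ▸ hxQ))
    by_contra hne
    exact hbet Q hQ hPQ (lt_of_le_not_ge hQp hne)
  obtain ⟨t, htp, n, ht⟩ := min_prime_clear hmin
  have hJ : ∀ r ∈ Ideal.span {x} ⊔ P, ∃ c : R, ∀ g : G, r • g = x • c • g := by
    intro r hr
    obtain ⟨s, hs, π, hπ, rfl⟩ := Submodule.mem_sup.1 hr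
    obtain ⟨c, rfl⟩ := Ideal.mem_span_singleton.1 hs
    exact ⟨c, fun g => by rw [add_smul, (hann π).2 hπ g, add_zero, mul_smul]⟩
  have hyn : ∀ (j : ℕ) (g : G), x • g = 0 → ∃ w : G, x • w = 0 ∧ g = y ^ j • w := by
    intro j
    induction j with
    | zero => exact fun g hg => ⟨g, hg, by rw [pow_zero, one_smul]⟩
    | succ j ih =>
      intro g hg
      obtain ⟨w, hw, rfl⟩ := ih g hg
      obtain ⟨w', hw', rfl⟩ := hsy w hw
      exact ⟨w', hw', by rw [pow_succ, mul_smul]⟩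
  obtain ⟨e, he⟩ := exists_div_hom x hsx (t • (LinearMap.id : G →ₗ[R] G)) (by
    intro z hz
    obtain ⟨w, hw, rfl⟩ := hyn n z hz
    obtain ⟨c, hc⟩ := hJ _ (ht (y ^ n) (Ideal.pow_mem_pow (hIp hyI) n))
    show t • y ^ n • w = 0
    rw [← mul_smul, hc, smul_comm, hw, smul_zero])
  have he' : x • (e : Module.End R G) = algebraMap R (Module.End R G) t := by
    ext g
    exact (LinearMap.congr_fun he g).symm
  have heD : (e : Module.End R G) ∈ DD I (Module.End R G) := by
    refine ⟨n, fun w hw => ?_⟩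
    obtain ⟨c, hc⟩ := hJ _ (ht w (Ideal.pow_right_mono hIp n hw))
    refine ⟨c, hxreg ?_⟩
    show x • w • (e : Module.End R G) = x • _
    rw [smul_comm, he']
    ext g
    show w • t • g = x • c • g
    rw [← hc, ← mul_smul, mul_comm]
  -- finiteness of `DD`
  obtain ⟨hL0, hL1⟩ := LC.depth_two I (E := Module.End R G) hxI hyI hxreg (by
    intro φ ψ h
    refine exists_div_hom x hsx φ ?_
    intro z hz
    obtain ⟨w, hw, rfl⟩ := hsy z hz
    have := LinearMap.congr_fun h w
    rw [_root_.map_smul]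
    refine this.trans ?_
    show x • ψ w = 0
    rw [← _root_.map_smul, hw, _root_.map_zero])
  have hFD : FF I (DD I (Module.End R G)) := FF.of_DD I hL0 hL1 (hF _ inferInstance)
  obtain ⟨a, ha, b, hb, c, hc, k, hk⟩ := exists_abc I P hIm hdim
  have hfin := FF.koszul (D := DD I (Module.End R G)) P (by
    intro r hr d
    refine Subtype.ext ?_
    ext g
    exact (hann r).2 hr _) a b c k hk hFD
  have hDfin : Module.Finite R (DD I (Module.End R G)) := by
    refine complete_nakayama' (maximalIdeal R) ?_ ?_
    · intro d hd
      refine Subtype.ext (hom_sep (maximalIdeal R) htors d.1 fun j => ?_)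
      have h1 := Submodule.mem_map_of_mem (f := (Subalgebra.toSubmodule (DD I (Module.End R G))).subtype) (hd j)
      rw [Submodule.map_smul''] at h1
      exact Submodule.smul_mono le_rfl le_top h1
    · have hle : LinearMap.range (kdiv (D := DD I (Module.End R G)) a b c) ≤ maximalIdeal R • ⊤ := by
        rintro _ ⟨⟨d, e, f⟩, rfl⟩
        exact Submodule.add_mem _ (Submodule.add_mem _ (Submodule.smul_mem_smul (hIm ha) trivial)
          (Submodule.smul_mem_smul (hIm hb) trivial)) (Submodule.smul_mem_smul (hIm hc) trivial)
      exact Module.Finite.of_surjective (Submodule.factor hle) (Submodule.factor_surjective hle)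
  have h_integral : IsIntegral R (e : Module.End R G) :=
    IsIntegral.of_mem_of_fg (DD I (Module.End R G)) (Module.Finite.iff_fg.1 hDfin) e heD
  obtain ⟨N, d, hN, h0⟩ := integral_div (e : Module.End R G) h_integral x t he'
  have h1 : t ^ N - x * d ∈ P := by
    rw [← hann]
    intro g
    exact LinearMap.congr_fun h0 g
  have h2 : t ^ N ∈ p := by
    have h3 := p.add_mem (hPle h1) (p.mul_mem_right d (hIp hxI))
    rwa [sub_add_cancel] at h3
  exact htp (hp.mem_of_pow_mem N h2)

end fin
end FileU

section FileV
open IsLocalRing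
theorem MemCofiniteClass.ff_one {R : Type u} [CommRing R] [IsNoetherianRing R] {I : Ideal R}
    (h : MemCofiniteClass R I) (N : Type u) [AddCommGroup N] [Module R N] (hN : Module.Finite R N) :
    FF I (LC I 1 N) := by
  obtain ⟨e⟩ := localCohomology_equiv I 1 (ModuleCat.of R N)
  have h1 : FF I ((localCohomology I 1).obj (ModuleCat.of R N)) := fun j => by
    have := (h (ModuleCat.of R N) hN 1).2 j
    exact Module.Finite.equiv
      (oldExtEquiv (ModuleCat.of R (R ⧸ I)) ((localCohomology I 1).obj (ModuleCat.of R N)) j)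
  exact FF.equiv e h1

theorem exists_prime_of_idealHeight {R : Type u} [CommRing R] {I : Ideal R} (hht : idealHeight I = 2) :
    (∃ p : Ideal R, p.IsPrime ∧ I ≤ p ∧ p.height < 3) ∧
      ∀ Q : Ideal R, Q.IsPrime → I ≤ Q → 2 ≤ Q.height := by
  constructor
  · by_contra! hcon
    have : (3 : ℕ∞) ≤ idealHeight I := by
      refine le_iInf₂ fun p hp => ?_
      rw [← PrimeSpectrum.height_eq_orderHeight]
      exact hcon p.asIdeal p.2 hp
    rw [hht] at this
    exact absurd this (by decide)
  · intro Q hQ hIQ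
    rw [← hht]
    have := PrimeSpectrum.height_eq_orderHeight (⟨Q, hQ⟩ : PrimeSpectrum R)
    simp only at this
    rw [this]
    exact iInf₂_le (f := fun (p : PrimeSpectrum R) (_ : p ∈ {p : PrimeSpectrum R | I ≤ p.asIdeal}) => Order.height p) ⟨Q, hQ⟩ hIQ

end FileV

/-- Let `(R, m)` be a Noetherian complete local domain of dimension 4 and let
`I` be an ideal of `R` of height 2.  Then `I ∉ 𝓘(R)`: there exist a finitely generated
`R`-module `M` and an `i ≥ 0` such that `H^i_I(M)` is not `I`-cofinite. -/
theorem not_memCofiniteClass_of_height_two {R : Type u} [CommRing R] [IsNoetherianRing R]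
    [IsLocalRing R] [IsDomain R] [IsAdicComplete (IsLocalRing.maximalIdeal R) R]
    (hdim : ringKrullDim R = 4) (I : Ideal R) (hht : idealHeight I = 2) :
    ¬ MemCofiniteClass R I := by
  intro h
  obtain ⟨⟨p, hp, hIp, hp3⟩, hge⟩ := exists_prime_of_idealHeight hht
  have hdim' : ringKrullDim R = ((3 + 1 : ℕ) : WithBot ℕ∞) := by rw [hdim]; rfl
  obtain ⟨P, x, y, hP, hxI, hyI, hxP, hPle, hbet, hPd, G, _, _, h1, h2, h3, h4⟩ :=
    package hdim' I p hIp hp3 hge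
  exact final_step I p P hIp x y hxI hyI hxP hPle hbet hPd G h1 h2 h3 h4
    (fun N _ _ hN => h.ff_one N hN)
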